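/- Let ℒ be a subset of the family of SL(2) lines in ℝ³ such that the set dir(ℒ) ⊆ S² of unit directions of lines in ℒ has positive 2-dimensional Hausdorff measure. Then the union ⋃ℒ of all lines in ℒ has Hausdorff dimension 3. -/

import Mathlib

open MeasureTheory ENNReal

noncomputable section

/-- `ℝ³` with the Euclidean metric. -/
abbrev E3 := EuclideanSpace ℝ (Fin 3)

/-- `ℝ²` with the Euclidean metric. -/
abbrev E2 := EuclideanSpace ℝ (Fin 2)

/-- The horizontal line `ℓ_{(a,b,c)} = {(as + b, s, (b/2)s + c) : s ∈ ℝ}`. -/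
def horizLine (a b c : ℝ) : Set E3 :=
  {q | ∃ s : ℝ, q = ![a * s + b, s, b / 2 * s + c]}

/-- The `SL(2)` line `L_{α,β,γ,δ} = (α,β,0) + span(γ,δ,1)`. -/
def SLline (α β γ δ : ℝ) : Set E3 :=
  {q | ∃ s : ℝ, q = ![α + s * γ, β + s * δ, s]}

/-- The set of directions of a family of lines: unit vectors `e` such that
some member of the family is a line parallel to `span(e)`. -/
def dirSet (𝓛 : Set (Set E3)) : Set E3 :=
  {e | ‖e‖ = 1 ∧ ∃ L ∈ 𝓛, ∃ x : E3, L = {q | ∃ t : ℝ, q = x + t • e}}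


/-- The family of all `SL(2)` lines: lines through the origin in the `xy`-plane,
together with the lines `L_{α,β,γ,δ}` with `αδ - βγ = 1`. -/
def SL2Lines : Set (Set E3) :=
  {L | (∃ γ δ : ℝ, (γ, δ) ≠ (0, 0) ∧ L = {q : E3 | ∃ s : ℝ, q = ![s * γ, s * δ, 0]}) ∨
    ∃ α β γ δ : ℝ, α * δ - β * γ = 1 ∧ L = SLline α β γ δ}

/-- The character `t ↦ exp (2 * π * i * t)` of `ℝ`. -/
def ech (t : ℝ) : ℂ := Complex.exp (2 * Real.pi * t * Complex.I)

lemma ech_add (s t : ℝ) : ech (s + t) = ech s * ech t := by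
  simp only [ech, ← Complex.exp_add]; congr 1; push_cast; ring

@[simp] lemma ech_zero : ech 0 = 1 := by simp [ech]

@[simp] lemma norm_ech (t : ℝ) : ‖ech t‖ = 1 := by
  have : (2 * Real.pi * t * Complex.I : ℂ) = ((2 * Real.pi * t : ℝ) : ℂ) * Complex.I := by
    push_cast; ring
  rw [ech, this, Complex.norm_exp_ofReal_mul_I]

lemma conj_ech (t : ℝ) : (starRingEnd ℂ) (ech t) = ech (-t) := by
  simp only [ech, ← Complex.exp_conj, map_mul, Complex.conj_I, Complex.conj_ofReal]
  congr 1
  rw [Complex.conj_ofNat]; push_cast; ring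

@[fun_prop] lemma continuous_ech : Continuous ech := by
  unfold ech; fun_prop

lemma fourier_eq_ech (f : ℝ → ℂ) (t : ℝ) :
    FourierTransform.fourier f t = ∫ x, ech (-(x * t)) * f x := by
  rw [Real.fourier_real_eq_integral_exp_smul]
  congr 1; ext x
  rw [smul_eq_mul]; congr 2
  push_cast; ring

open SchwartzMap in
/-- Existence of a probability measure whose characteristic function vanishes off `(-1, 1)` and
which has density bounded below on a given bounded interval. -/
theorem exists_measure_bandlimited (A : ℝ) (hA : 0 < A) :
    ∃ ν : Measure ℝ, IsProbabilityMeasure ν ∧ (∀ ξ : ℝ, 1 ≤ |ξ| → ∫ t, ech (ξ * t) ∂ν = 0) ∧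
      ∃ c : ℝ, 0 < c ∧ ∀ t ρ : ℝ, |t| ≤ A → 0 ≤ ρ → ρ ≤ 1 →
        ENNReal.ofReal (c * ρ) ≤ ν (Set.Icc (t - ρ) (t + ρ)) := by
  set r : ℝ := 1 / (6 * (A + 1)) with hr
  have hr0 : 0 < r := by positivity
  have hr1 : r * (A + 1) = 1 / 6 := by rw [hr]; field_simp
  have hr4 : r ≤ 1 / 6 := by nlinarith
  let b : ContDiffBump (0 : ℝ) := ⟨r / 2, r, by linarith, by linarith⟩
  have hbsupp : ∀ x, r ≤ |x| → b x = 0 := fun x hx =>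
    b.zero_of_le_dist (by simpa [Real.dist_eq] using hx)
  let bc : ℝ → ℂ := fun x => (b x : ℂ)
  have hbc : ContDiff ℝ (⊤ : ℕ∞) bc := (Complex.ofRealCLM.contDiff.comp b.contDiff)
  have hbcs : HasCompactSupport bc := by
    have := b.hasCompactSupport
    exact this.comp_left (g := fun x : ℝ => (x : ℂ)) (by simp)
  have hbint : Integrable bc := hbc.continuous.integrable_of_hasCompactSupport hbcs
  have hbint' : Integrable (fun x => b x) := b.continuous.integrable_of_hasCompactSupport
    b.hasCompactSupport
  let φ : 𝓢(ℝ, ℂ) := hbcs.toSchwartzMap hbc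
  have hφ : ∀ x, φ x = bc x := fun x => rfl
  let F : 𝓢(ℝ, ℂ) := FourierTransform.fourier φ
  have hF : ∀ t, F t = ∫ x, ech (-(x * t)) * bc x := by
    intro t
    have : F t = FourierTransform.fourier (φ : ℝ → ℂ) t := by
      rw [← SchwartzMap.fourier_coe]
    rw [this, fourier_eq_ech]; rfl
  have hbpos : 0 < ∫ x, b x := b.integral_pos
  set B := ∫ x, b x with hB
  have hFlow : ∀ t, |t| ≤ A + 1 → B / 2 ≤ ‖F t‖ := by
    intro t ht
    have h1 : (F t).re = ∫ x, Real.cos (2 * Real.pi * (x * t)) * b x := by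
      rw [hF]
      have hi : Integrable (fun x => ech (-(x * t)) * bc x) := by
        refine hbint.bdd_mul (c := 1) (by fun_prop) ?_
        filter_upwards with x; simp
      have := Complex.reCLM.integral_comp_comm hi
      simp only [Complex.reCLM_apply] at this
      rw [← this]
      congr 1; ext x
      simp only [bc, Complex.re_mul_ofReal]
      congr 1
      have : (2 * Real.pi * ((-(x * t) : ℝ) : ℂ) * Complex.I : ℂ) = ((-(2 * Real.pi * (x * t)) : ℝ) : ℂ) * Complex.I := by
        push_cast; ring
      rw [ech, this, Complex.exp_ofReal_mul_I_re, Real.cos_neg]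
    have h2 : B / 2 ≤ ∫ x, Real.cos (2 * Real.pi * (x * t)) * b x := by
      have : B / 2 = ∫ x, (1 / 2) * b x := by rw [integral_const_mul]; ring
      rw [this]
      apply integral_mono (hbint'.const_mul _)
      · refine hbint'.bdd_mul (c := 1) (by fun_prop) ?_
        filter_upwards with x; simpa using Real.abs_cos_le_one _
      intro x
      by_cases hx : r ≤ |x|
      · simp [hbsupp x hx]
      · push Not at hx
        apply mul_le_mul_of_nonneg_right _ b.nonneg
        rw [← Real.cos_abs, ← Real.cos_pi_div_three]
        have h3 : |x * t| ≤ 1 / 6 := by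
          rw [abs_mul, ← hr1]
          exact mul_le_mul hx.le ht (abs_nonneg _) hr0.le
        have hpi := Real.pi_pos
        have h4 : |2 * Real.pi * (x * t)| ≤ Real.pi / 3 := by
          rw [abs_mul, abs_of_pos (by positivity)]
          nlinarith
        exact Real.cos_le_cos_of_nonneg_of_le_pi (abs_nonneg _) (by linarith) h4
    calc B / 2 ≤ (F t).re := by rw [h1]; exact h2
      _ ≤ ‖F t‖ := Complex.re_le_norm _
  let w : ℝ → ℝ := fun t => ‖F t‖ ^ 2
  have hwc : Continuous w := by
    have := F.continuous
    fun_prop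
  have hwint : Integrable w := by
    have h := F.memLp 2 (volume : Measure ℝ)
    exact h.integrable_norm_pow (by norm_num)
  have hw0 : ∀ t, 0 ≤ w t := fun t => by positivity
  have hwlow : ∀ t, |t| ≤ A + 1 → (B / 2) ^ 2 ≤ w t := fun t ht => by
    have := hFlow t ht
    show _ ≤ ‖F t‖ ^ 2
    gcongr
  have hT : 0 < ∫ t, w t := by
    rw [integral_pos_iff_support_of_nonneg hw0 hwint]
    refine hwc.isOpen_support.measure_pos _ ?_
    refine ⟨0, ?_⟩
    have := hwlow 0 (by simp; linarith)
    simp only [Function.mem_support]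
    have h : 0 < (B / 2) ^ 2 := by positivity
    linarith
  set T := ∫ t, w t with hTdef
  have hvan : ∀ ξ : ℝ, 1 ≤ |ξ| → ∫ t, ech (ξ * t) * (w t : ℂ) = 0 := by
    intro ξ hξ
    let bt : ℝ → ℂ := fun x => bc (x + ξ)
    have hbt : ContDiff ℝ (⊤ : ℕ∞) bt := hbc.comp (contDiff_id.add contDiff_const)
    have hbts : HasCompactSupport bt := hbcs.comp_homeomorph (Homeomorph.addRight ξ)
    let φt : 𝓢(ℝ, ℂ) := hbts.toSchwartzMap hbt
    let Ft : 𝓢(ℝ, ℂ) := FourierTransform.fourier φt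
    have hFt : ∀ t, Ft t = ech (ξ * t) * F t := by
      intro t
      have : Ft t = FourierTransform.fourier (φt : ℝ → ℂ) t := by
        rw [← SchwartzMap.fourier_coe]
      rw [this, fourier_eq_ech, hF, ← integral_const_mul]
      rw [← integral_add_right_eq_self (fun x => ech (ξ * t) * (ech (-(x * t)) * bc x)) ξ]
      congr 1; ext x
      rw [← mul_assoc, ← ech_add]
      show _ * bc (x + ξ) = _
      congr 2; ring
    have hP := SchwartzMap.integral_inner_fourier_fourier φ φt
    have hz : ∫ x, inner ℂ (φ x) (φt x) = 0 := by
      rw [← integral_zero ℝ ℂ]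
      congr 1; ext x
      have h1 : φ x = (b x : ℂ) := rfl
      have h2 : φt x = (b (x + ξ) : ℂ) := rfl
      by_cases hx : r ≤ |x|
      · rw [h1, hbsupp x hx]; simp
      · rw [h2, hbsupp (x + ξ)]
        · simp
        · push Not at hx
          have := abs_sub_abs_le_abs_sub ξ (-x)
          rw [abs_neg, sub_neg_eq_add, add_comm ξ x] at this
          linarith
    rw [hz] at hP
    rw [← hP]
    congr 1; ext t
    show _ = inner ℂ (F t) (Ft t)
    rw [hFt]
    simp only [RCLike.inner_apply, w]
    rw [mul_assoc, RCLike.mul_conj]; simp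
  have hwm : Measurable w := hwc.measurable
  have hden : Measurable fun t => ENNReal.ofReal (w t / T) := by fun_prop
  refine ⟨volume.withDensity fun t => ENNReal.ofReal (w t / T), ?_, ?_, (B / 2) ^ 2 / T, by positivity, ?_⟩
  · constructor
    rw [withDensity_apply _ MeasurableSet.univ, Measure.restrict_univ,
      ← ofReal_integral_eq_lintegral_ofReal (hwint.div_const _)
        (Filter.Eventually.of_forall fun t => div_nonneg (hw0 t) hT.le), integral_div, div_self hT.ne',
        ENNReal.ofReal_one]
  · intro ξ hξ
    rw [integral_withDensity_eq_integral_toReal_smul hden (by simp)]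
    have : ∀ t, (ENNReal.ofReal (w t / T)).toReal • ech (ξ * t) = (ech (ξ * t) * (w t : ℂ)) * (T : ℂ)⁻¹ := by
      intro t
      rw [ENNReal.toReal_ofReal (div_nonneg (hw0 t) hT.le), Complex.real_smul]
      push_cast; ring
    simp_rw [this]
    rw [integral_mul_const, hvan ξ hξ, zero_mul]
  · intro t ρ ht h0 h1
    rw [withDensity_apply _ measurableSet_Icc]
    calc ENNReal.ofReal ((B / 2) ^ 2 / T * ρ) ≤ ∫⁻ _ in Set.Icc (t - ρ) (t + ρ), ENNReal.ofReal ((B / 2) ^ 2 / T) := by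
          rw [setLIntegral_const, Real.volume_Icc, ← ENNReal.ofReal_mul (by positivity)]
          apply ENNReal.ofReal_le_ofReal
          apply mul_le_mul_of_nonneg_left _ (by positivity)
          linarith
      _ ≤ _ := by
          apply setLIntegral_mono hden
          intro x hx
          apply ENNReal.ofReal_le_ofReal
          gcongr
          apply hwlow
          rw [abs_le] at ht ⊢
          constructor <;> linarith [hx.1, hx.2]

/-- The space of parameters of lines. -/
abbrev Par := ℝ × ℝ × ℝ

/-- The characters of the parameter space. -/
def ch (ξ p : Par) : ℂ := ech (ξ.1 * p.1 + ξ.2.1 * p.2.1 + ξ.2.2 * p.2.2)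

lemma ch_add (ξ η p : Par) : ch (ξ + η) p = ch ξ p * ch η p := by
  simp only [ch, ← ech_add, Prod.fst_add, Prod.snd_add]; congr 1; ring

lemma conj_ch (ξ p : Par) : (starRingEnd ℂ) (ch ξ p) = ch (-ξ) p := by
  simp only [ch, conj_ech, Prod.fst_neg, Prod.snd_neg]; congr 1; ring

@[fun_prop] lemma continuous_ch (ξ : Par) : Continuous (ch ξ) := by
  unfold ch; fun_prop

@[simp] lemma norm_ch (ξ p : Par) : ‖ch ξ p‖ = 1 := by simp [ch]

/-- `μ` is band-limited if its characteristic function is supported in the unit cube. -/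
def BandLimited (μ : Measure Par) : Prop := ∀ ξ : Par, 1 ≤ ‖ξ‖ → ∫ p, ch ξ p ∂μ = 0

theorem exists_bandLimited (A : ℝ) (hA : 0 < A) :
    ∃ μ : Measure Par, IsProbabilityMeasure μ ∧ BandLimited μ ∧
      ∃ c : ℝ, 0 < c ∧ ∀ (p : Par) (ρ : ℝ), ‖p‖ ≤ A → 0 ≤ ρ → ρ ≤ 1 →
        ENNReal.ofReal (c * ρ ^ 3) ≤ μ (Metric.closedBall p ρ) := by
  obtain ⟨ν, hν, h0, c, hc, hlow⟩ := exists_measure_bandlimited A hA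
  refine ⟨ν.prod (ν.prod ν), inferInstance, ?_, c ^ 3, by positivity, ?_⟩
  · intro ξ hξ
    have h1 : ∀ p : Par, ch ξ p = ech (ξ.1 * p.1) * (ech (ξ.2.1 * p.2.1) * ech (ξ.2.2 * p.2.2)) := by
      intro p; rw [ch, ech_add, ech_add, mul_assoc]
    simp_rw [h1]
    rw [integral_prod_mul (fun x => ech (ξ.1 * x))
      (fun y : ℝ × ℝ => ech (ξ.2.1 * y.1) * ech (ξ.2.2 * y.2)),
      integral_prod_mul (fun x => ech (ξ.2.1 * x)) (fun x => ech (ξ.2.2 * x))]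
    rw [Prod.norm_def, Prod.norm_def, le_max_iff, le_max_iff] at hξ
    simp only [Real.norm_eq_abs] at hξ
    rcases hξ with h | h | h <;> simp [h0 _ h]
  · intro p ρ hp hρ hρ1
    rw [Prod.norm_def, max_le_iff, Prod.norm_def, max_le_iff] at hp
    have : Metric.closedBall p ρ = Metric.closedBall p.1 ρ ×ˢ
        (Metric.closedBall p.2.1 ρ ×ˢ Metric.closedBall p.2.2 ρ) := by
      rw [closedBall_prod_same, closedBall_prod_same]
    rw [this, Measure.prod_prod, Measure.prod_prod]
    simp only [Real.closedBall_eq_Icc]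
    calc ENNReal.ofReal (c ^ 3 * ρ ^ 3)
        = ENNReal.ofReal (c * ρ) * (ENNReal.ofReal (c * ρ) * ENNReal.ofReal (c * ρ)) := by
          rw [← ENNReal.ofReal_mul (by positivity), ← ENNReal.ofReal_mul (by positivity)]
          congr 1; ring
      _ ≤ _ := by
          gcongr
          · exact hlow _ _ hp.1 hρ hρ1
          · exact hlow _ _ hp.2.1 hρ hρ1
          · exact hlow _ _ hp.2.2 hρ hρ1

/-- The space of trigonometric polynomials with frequencies in `X`. -/
def trig (X : Set Par) : Submodule ℂ (Par → ℂ) := Submodule.span ℂ (ch '' X)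

lemma ch_mem_trig {X : Set Par} {ξ : Par} (h : ξ ∈ X) : ch ξ ∈ trig X :=
  Submodule.subset_span ⟨ξ, h, rfl⟩

lemma trig_mono {X Y : Set Par} (h : X ⊆ Y) : trig X ≤ trig Y :=
  Submodule.span_mono (Set.image_mono h)

open scoped Pointwise in
lemma mul_mem_trig {X Y : Set Par} {f g : Par → ℂ} (hf : f ∈ trig X) (hg : g ∈ trig Y) :
    f * g ∈ trig (X + Y) := by
  have h : f * g ∈ trig X * trig Y := Submodule.mul_mem_mul hf hg
  rw [trig, trig, Submodule.span_mul_span] at h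
  refine Submodule.span_mono ?_ h
  rintro _ ⟨_, ⟨ξ, hξ, rfl⟩, _, ⟨η, hη, rfl⟩, rfl⟩
  exact ⟨ξ + η, Set.add_mem_add hξ hη, funext fun p => ch_add ξ η p⟩

lemma continuous_of_mem_trig {X : Set Par} {f : Par → ℂ} (hf : f ∈ trig X) : Continuous f := by
  induction hf using Submodule.span_induction with
  | mem f h => obtain ⟨ξ, -, rfl⟩ := h; fun_prop
  | zero => exact continuous_const
  | add f g _ _ hf hg => exact hf.add hg
  | smul a f _ hf => exact hf.const_smul a

/-- Bounded continuous functions on the parameter space. -/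
def BddCont (f : Par → ℂ) : Prop := Continuous f ∧ ∃ C, ∀ p, ‖f p‖ ≤ C

lemma BddCont.mul {f g : Par → ℂ} (hf : BddCont f) (hg : BddCont g) :
    BddCont (fun p => f p * g p) := by
  obtain ⟨hf, C, hC⟩ := hf
  obtain ⟨hg, D, hD⟩ := hg
  refine ⟨hf.mul hg, C * D, fun p => ?_⟩
  rw [norm_mul]
  exact mul_le_mul (hC p) (hD p) (norm_nonneg _) ((norm_nonneg _).trans (hC p))

lemma BddCont.conj {f : Par → ℂ} (hf : BddCont f) :
    BddCont (fun p => (starRingEnd ℂ) (f p)) := by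
  obtain ⟨hf, C, hC⟩ := hf
  exact ⟨Complex.continuous_conj.comp hf, C, fun p => by simpa using hC p⟩

lemma BddCont.add {f g : Par → ℂ} (hf : BddCont f) (hg : BddCont g) :
    BddCont (fun p => f p + g p) := by
  obtain ⟨hf, C, hC⟩ := hf
  obtain ⟨hg, D, hD⟩ := hg
  exact ⟨hf.add hg, C + D, fun p => (norm_add_le _ _).trans (add_le_add (hC p) (hD p))⟩

lemma BddCont.sum {ι : Type*} (s : Finset ι) {f : ι → Par → ℂ} (hf : ∀ i ∈ s, BddCont (f i)) :
    BddCont (fun p => ∑ i ∈ s, f i p) := by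
  classical
  induction s using Finset.induction_on with
  | empty => exact ⟨by simpa using continuous_const, 0, by simp⟩
  | insert a s ha ih =>
    have h1 := hf a (Finset.mem_insert_self _ _)
    have h2 := ih fun i hi => hf i (Finset.mem_insert_of_mem hi)
    have := h1.add h2
    simpa [Finset.sum_insert ha] using this

lemma BddCont.of_mem_trig {X : Set Par} {f : Par → ℂ} (hf : f ∈ trig X) : BddCont f := by
  refine ⟨continuous_of_mem_trig hf, ?_⟩
  induction hf using Submodule.span_induction with
  | mem f h => obtain ⟨ξ, -, rfl⟩ := h; exact ⟨1, fun p => by simp⟩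
  | zero => exact ⟨0, by simp⟩
  | add f g _ _ hf hg =>
    obtain ⟨C, hC⟩ := hf
    obtain ⟨D, hD⟩ := hg
    exact ⟨C + D, fun p => (norm_add_le _ _).trans (add_le_add (hC p) (hD p))⟩
  | smul a f _ hf =>
    obtain ⟨C, hC⟩ := hf
    refine ⟨‖a‖ * C, fun p => ?_⟩
    simp only [Pi.smul_apply, norm_smul]
    exact mul_le_mul_of_nonneg_left (hC p) (norm_nonneg _)

section Integration

variable {μ : Measure Par} [IsProbabilityMeasure μ]

lemma BddCont.integrable {f : Par → ℂ} (hf : BddCont f) : Integrable f μ := by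
  obtain ⟨hf, C, hC⟩ := hf
  exact Integrable.of_bound hf.aestronglyMeasurable C (Filter.Eventually.of_forall hC)

lemma BddCont.integrable_norm_pow {f : Par → ℂ} (hf : BddCont f) (k : ℕ) :
    Integrable (fun p => ‖f p‖ ^ k) μ := by
  obtain ⟨hf, C, hC⟩ := hf
  refine Integrable.of_bound (by fun_prop) (C ^ k) (Filter.Eventually.of_forall fun p => ?_)
  simp only [norm_pow, norm_norm]
  exact pow_le_pow_left₀ (norm_nonneg _) (hC p) k

lemma integral_trig_mul_conj_eq_zero (hμ : BandLimited μ) {X Y : Set Par} {f g : Par → ℂ}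
    (hf : f ∈ trig X) (hg : g ∈ trig Y) (h : ∀ ξ ∈ X, ∀ η ∈ Y, 1 ≤ ‖ξ - η‖) :
    ∫ p, f p * (starRingEnd ℂ) (g p) ∂μ = 0 := by
  revert hg
  induction hf using Submodule.span_induction with
  | zero => simp
  | add f₁ f₂ h₁ h₂ ih₁ ih₂ =>
    intro hg
    have hb := (BddCont.of_mem_trig hg).conj
    simp only [Pi.add_apply, add_mul]
    rw [integral_add ((BddCont.of_mem_trig h₁).mul hb).integrable
      ((BddCont.of_mem_trig h₂).mul hb).integrable, ih₁ hg, ih₂ hg, add_zero]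
  | smul a f hf ih =>
    intro hg
    simp only [Pi.smul_apply, smul_eq_mul, mul_assoc]
    rw [integral_const_mul, ih hg, mul_zero]
  | mem f hf =>
    obtain ⟨ξ, hξ, rfl⟩ := hf
    intro hg
    induction hg using Submodule.span_induction with
    | zero => simp
    | add f₁ f₂ h₁ h₂ ih₁ ih₂ =>
      have hb : BddCont (ch ξ) := ⟨by fun_prop, 1, by simp⟩
      simp only [Pi.add_apply, map_add, mul_add]
      rw [integral_add (hb.mul (BddCont.of_mem_trig h₁).conj).integrable
        (hb.mul (BddCont.of_mem_trig h₂).conj).integrable, ih₁, ih₂, add_zero]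
    | smul a f hf ih =>
      simp only [Pi.smul_apply, smul_eq_mul, map_mul]
      have h1 : ∀ p, ch ξ p * ((starRingEnd ℂ) a * (starRingEnd ℂ) (f p))
          = (starRingEnd ℂ) a * (ch ξ p * (starRingEnd ℂ) (f p)) := fun p => by ring
      simp_rw [h1]
      rw [integral_const_mul, ih, mul_zero]
    | mem f hf =>
      obtain ⟨η, hη, rfl⟩ := hf
      simp_rw [conj_ch, ← ch_add, ← sub_eq_add_neg]
      exact hμ _ (h ξ hξ η hη)

/-- Almost orthogonality: if each function of the family fails to be orthogonal to at most `K`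
members of the family, then the square function bound holds with constant `K`. -/
lemma integral_norm_sum_sq_le {ι : Type*} (s : Finset ι) {g : ι → Par → ℂ}
    (hg : ∀ i ∈ s, BddCont (g i)) (K : ℕ)
    (hK : ∀ i ∈ s, {j ∈ (s : Set ι) | ∫ p, g i p * (starRingEnd ℂ) (g j p) ∂μ ≠ 0}.ncard ≤ K) :
    ∫ p, ‖∑ i ∈ s, g i p‖ ^ 2 ∂μ ≤ K * ∑ i ∈ s, ∫ p, ‖g i p‖ ^ 2 ∂μ := by
  classical
  set B : ι → ι → ℂ := fun i j => ∫ p, g i p * (starRingEnd ℂ) (g j p) ∂μ with hB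
  have hsymm : ∀ i j, B j i ≠ 0 → B i j ≠ 0 := by
    intro i j h h'
    apply h
    have : B j i = (starRingEnd ℂ) (B i j) := by
      simp only [hB, ← integral_conj]
      congr 1; ext p; simp [mul_comm]
    rw [this, h', map_zero]
  have hexp : ∫ p, ‖∑ i ∈ s, g i p‖ ^ 2 ∂μ = ∑ i ∈ s, ∑ j ∈ s, (B i j).re := by
    have h1 : ∀ p, ((‖∑ i ∈ s, g i p‖ ^ 2 : ℝ) : ℂ)
        = ∑ i ∈ s, ∑ j ∈ s, g i p * (starRingEnd ℂ) (g j p) := by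
      intro p
      rw [← Finset.sum_mul_sum, ← map_sum, Complex.mul_conj, Complex.normSq_eq_norm_sq]
    have h2 : ((∫ p, ‖∑ i ∈ s, g i p‖ ^ 2 ∂μ : ℝ) : ℂ) = ∑ i ∈ s, ∑ j ∈ s, B i j := by
      rw [← integral_complex_ofReal]
      simp_rw [h1]
      rw [integral_finsetSum _ fun i hi => (BddCont.sum s fun j hj =>
        (hg i hi).mul (hg j hj).conj).integrable]
      refine Finset.sum_congr rfl fun i hi => ?_
      rw [integral_finsetSum _ fun j hj => ((hg i hi).mul (hg j hj).conj).integrable]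
    have := congrArg Complex.re h2
    simpa using this
  have hle : ∀ i ∈ s, ∀ j ∈ s, (B i j).re ≤ if B i j ≠ 0 then
      (∫ p, ‖g i p‖ ^ 2 ∂μ) / 2 + (∫ p, ‖g j p‖ ^ 2 ∂μ) / 2 else 0 := by
    intro i hi j hj
    split_ifs with h
    · have h_int := ((hg i hi).mul (hg j hj).conj).integrable (μ := μ)
      calc (B i j).re ≤ ‖B i j‖ := Complex.re_le_norm _
        _ ≤ ∫ p, ‖g i p * (starRingEnd ℂ) (g j p)‖ ∂μ := norm_integral_le_integral_norm _
        _ ≤ ∫ p, (‖g i p‖ ^ 2 / 2 + ‖g j p‖ ^ 2 / 2) ∂μ := by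
            apply integral_mono h_int.norm
            · exact (((hg i hi).integrable_norm_pow 2).div_const 2).add
                (((hg j hj).integrable_norm_pow 2).div_const 2)
            · intro p
              simp only [norm_mul, RCLike.norm_conj]
              nlinarith [sq_nonneg (‖g i p‖ - ‖g j p‖)]
        _ = _ := by
            rw [integral_add (((hg i hi).integrable_norm_pow 2).div_const 2)
              (((hg j hj).integrable_norm_pow 2).div_const 2), integral_div, integral_div]
    · push Not at h
      simp [h]
  have hcard : ∀ i ∈ s, ((s.filter fun j => B i j ≠ 0).card : ℝ) ≤ K := by
    intro i hi
    have := hK i hi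
    rw [show {j ∈ (s : Set ι) | B i j ≠ 0} = ((s.filter fun j => B i j ≠ 0 : Finset ι) : Set ι) by
      ext; simp, Set.ncard_coe_finset] at this
    exact_mod_cast this
  have hnn : ∀ i, 0 ≤ ∫ p, ‖g i p‖ ^ 2 ∂μ := fun i => integral_nonneg fun p => by positivity
  rw [hexp]
  have e1 : ∑ i ∈ s, ∑ j ∈ s, (if B i j ≠ 0 then (∫ p, ‖g i p‖ ^ 2 ∂μ) / 2 else 0)
      ≤ ∑ i ∈ s, K * ((∫ p, ‖g i p‖ ^ 2 ∂μ) / 2) := by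
    refine Finset.sum_le_sum fun i hi => ?_
    rw [← Finset.sum_filter, Finset.sum_const, nsmul_eq_mul]
    exact mul_le_mul_of_nonneg_right (hcard i hi) (by linarith [hnn i])
  have e2 : ∑ i ∈ s, ∑ j ∈ s, (if B i j ≠ 0 then (∫ p, ‖g j p‖ ^ 2 ∂μ) / 2 else 0)
      = ∑ i ∈ s, ∑ j ∈ s, (if B i j ≠ 0 then (∫ p, ‖g i p‖ ^ 2 ∂μ) / 2 else 0) := by
    rw [Finset.sum_comm]
    refine Finset.sum_congr rfl fun i _ => Finset.sum_congr rfl fun j _ => ?_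
    simp only [show (B j i ≠ 0) = (B i j ≠ 0) from propext ⟨hsymm i j, hsymm j i⟩]
  calc ∑ i ∈ s, ∑ j ∈ s, (B i j).re
      ≤ ∑ i ∈ s, ∑ j ∈ s, (if B i j ≠ 0 then
      (∫ p, ‖g i p‖ ^ 2 ∂μ) / 2 + (∫ p, ‖g j p‖ ^ 2 ∂μ) / 2 else 0) :=
        Finset.sum_le_sum fun i hi => Finset.sum_le_sum fun j hj => hle i hi j hj
    _ = ∑ i ∈ s, ∑ j ∈ s, (if B i j ≠ 0 then (∫ p, ‖g i p‖ ^ 2 ∂μ) / 2 else 0)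
        + ∑ i ∈ s, ∑ j ∈ s, (if B i j ≠ 0 then (∫ p, ‖g j p‖ ^ 2 ∂μ) / 2 else 0) := by
        simp_rw [← Finset.sum_add_distrib]
        refine Finset.sum_congr rfl fun i _ => Finset.sum_congr rfl fun j _ => ?_
        split_ifs <;> simp
    _ ≤ K * ∑ i ∈ s, ∫ p, ‖g i p‖ ^ 2 ∂μ := by
        rw [e2, Finset.mul_sum]
        have : ∑ i ∈ s, K * ((∫ p, ‖g i p‖ ^ 2 ∂μ) / 2) + ∑ i ∈ s, K * ((∫ p, ‖g i p‖ ^ 2 ∂μ) / 2)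
          = ∑ i ∈ s, K * ∫ p, ‖g i p‖ ^ 2 ∂μ := by
          rw [← Finset.sum_add_distrib]
          exact Finset.sum_congr rfl fun i _ => by ring
        linarith

/-- One-variable trigonometric polynomials with frequencies in `I`. -/
def tp (I : Set ℤ) : Submodule ℂ (ℝ → ℂ) :=
  Submodule.span ℂ ((fun (m : ℤ) (z : ℝ) => ech (m * z)) '' I)

lemma ech_mem_tp {I : Set ℤ} {m : ℤ} (h : m ∈ I) : (fun z : ℝ => ech (m * z)) ∈ tp I :=
  Submodule.subset_span ⟨m, h, rfl⟩

lemma tp_mono {I J : Set ℤ} (h : I ⊆ J) : tp I ≤ tp J :=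
  Submodule.span_mono (Set.image_mono h)

open scoped Pointwise in
lemma mul_mem_tp {I J : Set ℤ} {f g : ℝ → ℂ} (hf : f ∈ tp I) (hg : g ∈ tp J) :
    f * g ∈ tp (I + J) := by
  have h : f * g ∈ tp I * tp J := Submodule.mul_mem_mul hf hg
  rw [tp, tp, Submodule.span_mul_span] at h
  refine Submodule.span_mono ?_ h
  rintro _ ⟨_, ⟨m, hm, rfl⟩, _, ⟨l, hl, rfl⟩, rfl⟩
  refine ⟨m + l, Set.add_mem_add hm hl, funext fun z => ?_⟩
  simp only [Pi.mul_apply, ← ech_add]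
  congr 1; push_cast; ring

lemma shift_mem_tp {I : Set ℤ} {f : ℝ → ℂ} (hf : f ∈ tp I) (t : ℝ) :
    (fun z => f (z - t)) ∈ tp I := by
  induction hf using Submodule.span_induction with
  | zero => exact Submodule.zero_mem _
  | add f g _ _ hf hg => exact Submodule.add_mem _ hf hg
  | smul a f _ hf => exact Submodule.smul_mem _ a hf
  | mem f h =>
    obtain ⟨m, hm, rfl⟩ := h
    have : (fun z : ℝ => ech (m * (z - t))) = ech (m * -t) • fun z : ℝ => ech (m * z) := by
      funext z
      simp only [Pi.smul_apply, smul_eq_mul, ← ech_add]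
      congr 1; ring
    exact this ▸ Submodule.smul_mem _ _ (ech_mem_tp hm)

/-- The pairing of a frequency with a parameter. -/
def pair (ξ p : Par) : ℝ := ξ.1 * p.1 + ξ.2.1 * p.2.1 + ξ.2.2 * p.2.2

lemma comp_pair_mem_trig {I : Set ℤ} {f : ℝ → ℂ} (hf : f ∈ tp I) (ξ : Par) :
    (fun p => f (pair ξ p)) ∈ trig ((fun m : ℤ => (m : ℝ) • ξ) '' I) := by
  induction hf using Submodule.span_induction with
  | zero => exact Submodule.zero_mem _
  | add f g _ _ hf hg => exact Submodule.add_mem _ hf hg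
  | smul a f _ hf => exact Submodule.smul_mem _ a hf
  | mem f h =>
    obtain ⟨m, hm, rfl⟩ := h
    have : (fun p => ech (m * pair ξ p)) = ch ((m : ℝ) • ξ) := by
      funext p
      simp only [ch, pair, Prod.smul_fst, Prod.smul_snd, smul_eq_mul]
      congr 1; ring
    exact this ▸ ch_mem_trig ⟨m, hm, rfl⟩

lemma ech_intCast (k : ℤ) : ech k = 1 := by
  rw [ech, Complex.exp_eq_one_iff]
  exact ⟨k, by push_cast; ring⟩

lemma ech_eq_one_iff (t : ℝ) : ech t = 1 ↔ ∃ k : ℤ, t = k := by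
  constructor
  · intro h
    rw [ech, Complex.exp_eq_one_iff] at h
    obtain ⟨k, hk⟩ := h
    refine ⟨k, ?_⟩
    have h2 : (2 * Real.pi * Complex.I : ℂ) ≠ 0 := by simp [Real.pi_ne_zero]
    have : (t : ℂ) = k := by
      apply mul_right_cancel₀ h2
      rw [← hk]; ring
    exact_mod_cast this
  · rintro ⟨k, rfl⟩; exact ech_intCast k

lemma ech_nat_mul (n : ℕ) (t : ℝ) : ech (n * t) = ech t ^ n := by
  rw [ech, ech, ← Complex.exp_nat_mul]; congr 1; push_cast; ring

/-- Sums of a trigonometric polynomial of low degree without constant term over a grid vanish. -/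
lemma sum_grid_eq_zero {G : ℕ} {I : Set ℤ} (hI : ∀ m ∈ I, m ≠ 0 ∧ |m| < G) {f : ℝ → ℂ}
    (hf : f ∈ tp I) (z : ℝ) : ∑ p ∈ Finset.range G, f (z - p / G) = 0 := by
  induction hf using Submodule.span_induction with
  | zero => simp
  | add f g _ _ hf hg => simp [Finset.sum_add_distrib, hf, hg]
  | smul a f _ hf => simp only [Pi.smul_apply, ← Finset.smul_sum, hf, smul_zero]
  | mem f h =>
    obtain ⟨m, hm, rfl⟩ := h
    obtain ⟨hm0, hmG⟩ := hI m hm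
    have hG : (G : ℝ) ≠ 0 := by
      rintro h
      have : (G : ℤ) = 0 := by exact_mod_cast h
      rw [this] at hmG; exact absurd hmG (abs_nonneg m).not_gt
    have h1 : ∀ p : ℕ, ech (m * (z - p / G)) = ech (m * z) * ech (-(m / G)) ^ p := by
      intro p
      rw [← ech_nat_mul, ← ech_add]
      congr 1; field_simp; ring
    simp_rw [h1]
    rw [← Finset.mul_sum, geom_sum_eq, ← ech_nat_mul]
    · have : (G : ℝ) * -(m / G) = ((-m : ℤ) : ℝ) := by push_cast; field_simp
      rw [this, ech_intCast]; simp
    · rw [Ne, ech_eq_one_iff]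
      rintro ⟨k, hk⟩
      have h2 : (-m : ℝ) = k * G := by
        rw [← hk]; field_simp
      have h3 : -m = k * G := by exact_mod_cast h2
      have hk0 : k ≠ 0 := by rintro rfl; simp at h3; exact hm0 h3
      have : (G : ℤ) ≤ |m| := by
        rw [← abs_neg, h3, abs_mul, Nat.abs_cast]
        have := Int.one_le_abs hk0
        nlinarith [Int.natCast_nonneg G]
      omega

/-- The Fejér kernels of degree `2 ^ j`, written as Riesz products. -/
def fejer (j : ℕ) (z : ℝ) : ℝ := ∏ i ∈ Finset.range j, (1 + Real.cos (2 * Real.pi * (2 ^ i * z)))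

lemma fejer_succ (j : ℕ) (z : ℝ) :
    fejer (j + 1) z = fejer j z * (1 + Real.cos (2 * Real.pi * (2 ^ j * z))) :=
  Finset.prod_range_succ _ _

lemma fejer_nonneg (j : ℕ) (z : ℝ) : 0 ≤ fejer j z :=
  Finset.prod_nonneg fun i _ => by linarith [Real.neg_one_le_cos (2 * Real.pi * (2 ^ i * z))]

lemma fejer_sub_int (j : ℕ) (z : ℝ) (k : ℤ) : fejer j (z - k) = fejer j z := by
  refine Finset.prod_congr rfl fun i _ => ?_
  have : 2 * Real.pi * (2 ^ i * (z - k)) = 2 * Real.pi * (2 ^ i * z) - ((2 ^ i * k : ℤ) : ℝ) * (2 * Real.pi) := by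
    push_cast; ring
  rw [this, Real.cos_sub_int_mul_two_pi]

lemma fejer_lower (j : ℕ) (z : ℝ) (hz : |z| * (8 * 2 ^ j) ≤ 1) : 2 ^ j / 2 ≤ fejer j z := by
  have key : ∀ k ≤ j, 2 ^ k * (1 - (2 ^ k / 2 ^ j) ^ 2 / 2) ≤ fejer k z := by
    intro k
    induction k with
    | zero => 
      intro _
      simp only [fejer, Finset.range_zero, Finset.prod_empty, pow_zero, one_mul]
      have : 0 ≤ ((1 : ℝ) / 2 ^ j) ^ 2 / 2 := by positivity
      linarith
    | succ k ih =>
      intro hk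
      have ih := ih (by omega)
      rw [fejer_succ]
      set q : ℝ := 2 ^ k / 2 ^ j with hq
      have hq0 : 0 ≤ q := by positivity
      have hq1 : q ≤ 1 / 2 := by
        rw [hq, div_le_iff₀ (by positivity)]
        have : (2 : ℝ) ^ (k + 1) ≤ 2 ^ j := pow_le_pow_right₀ (by norm_num) hk
        rw [pow_succ] at this; linarith
      have hang : |2 * Real.pi * (2 ^ k * z)| ≤ q := by
        have hpi := Real.pi_lt_four
        have hpi0 := Real.pi_pos
        rw [abs_mul, abs_mul, abs_mul, abs_of_pos (show (0 : ℝ) < 2 by norm_num), abs_of_pos hpi0,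
          abs_of_pos (show (0 : ℝ) < 2 ^ k by positivity), hq, le_div_iff₀ (by positivity)]
        calc 2 * Real.pi * (2 ^ k * |z|) * 2 ^ j
            = (Real.pi / 4) * 2 ^ k * (|z| * (8 * 2 ^ j)) := by ring
          _ ≤ 1 * 2 ^ k * 1 := by
              gcongr
              linarith
          _ = 2 ^ k := by ring
      have hcos : 1 - q ^ 2 / 2 ≤ Real.cos (2 * Real.pi * (2 ^ k * z)) := by
        have h1 := Real.one_sub_sq_div_two_le_cos (x := 2 * Real.pi * (2 ^ k * z))
        have h2 : (2 * Real.pi * (2 ^ k * z)) ^ 2 ≤ q ^ 2 := by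
          rw [← sq_abs]; gcongr
        linarith
      have e : (2 : ℝ) ^ (k + 1) / 2 ^ j = 2 * q := by rw [hq, pow_succ]; ring
      rw [e, pow_succ]
      have h2k : (0 : ℝ) < 2 ^ k := by positivity
      have hb : 0 ≤ 1 - q ^ 2 / 2 := by nlinarith
      calc 2 ^ k * 2 * (1 - (2 * q) ^ 2 / 2)
          ≤ 2 ^ k * (1 - q ^ 2 / 2) * (1 + (1 - q ^ 2 / 2)) := by
            have : 2 * (1 - (2 * q) ^ 2 / 2) ≤ (1 - q ^ 2 / 2) * (1 + (1 - q ^ 2 / 2)) := by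
              nlinarith [sq_nonneg (q ^ 2)]
            nlinarith
        _ ≤ _ := by
            apply mul_le_mul ih (by linarith) (by linarith) (fejer_nonneg _ _)
  have := key j le_rfl
  rw [div_self (by positivity)] at this
  linarith

lemma one_add_cos_eq (j : ℕ) (z : ℝ) : ((1 + Real.cos (2 * Real.pi * (2 ^ j * z)) : ℝ) : ℂ)
    = 1 + (1 / 2) * ech ((2 ^ j : ℤ) * z) + (1 / 2) * ech (((-2 ^ j : ℤ) : ℝ) * z) := by
  push_cast
  rw [Complex.cos, ech, ech]
  have h1 : (2 * Real.pi * ((2 ^ j : ℝ) * z : ℝ) * Complex.I : ℂ)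
    = 2 * Real.pi * (2 ^ j * z) * Complex.I := by push_cast; ring
  have h2 : (2 * Real.pi * (-(2 ^ j : ℝ) * z : ℝ) * Complex.I : ℂ)
    = -(2 * Real.pi * (2 ^ j * z)) * Complex.I := by push_cast; ring
  rw [h1, h2]; ring

open scoped Pointwise in
lemma fejer_sub_one_mem_tp (j : ℕ) :
    (fun z => (fejer j z : ℂ) - 1) ∈ tp {m | m ≠ 0 ∧ |m| < 2 ^ j} := by
  induction j with
  | zero =>
    have : (fun z => (fejer 0 z : ℂ) - 1) = 0 := by funext z; simp [fejer]
    rw [this]; exact Submodule.zero_mem _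
  | succ j ih =>
    have hf : (fun z => (fejer j z : ℂ)) ∈ tp {m | |m| < 2 ^ j} := by
      have h1 : (fun z => (fejer j z : ℂ)) = (fun z => (fejer j z : ℂ) - 1) + fun z => ech ((0 : ℤ) * z) := by
        funext z; simp
      rw [h1]
      exact Submodule.add_mem _ (tp_mono (fun m hm => hm.2) ih) (ech_mem_tp (by simp))
    have hsub : ∀ a : ℤ, |a| = 2 ^ j → (fun z => (fejer j z : ℂ)) * (fun z : ℝ => ech (a * z)) ∈
        tp {m | m ≠ 0 ∧ |m| < 2 ^ (j + 1)} := by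
      intro a ha
      refine tp_mono ?_ (mul_mem_tp hf (ech_mem_tp (Set.mem_singleton a)))
      rintro _ ⟨m, hm, b, rfl, rfl⟩
      simp only [Set.mem_ofPred_eq] at hm ⊢
      rw [pow_succ]
      rcases abs_cases m with h | h <;> rcases abs_cases b with h' | h' <;>
        refine ⟨by omega, abs_lt.2 ⟨by omega, by omega⟩⟩
    have e : (fun z => (fejer (j + 1) z : ℂ) - 1) = (fun z => (fejer j z : ℂ) - 1)
        + (1 / 2 : ℂ) • ((fun z => (fejer j z : ℂ)) * (fun z : ℝ => ech ((2 ^ j : ℤ) * z)))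
        + (1 / 2 : ℂ) • ((fun z => (fejer j z : ℂ)) * (fun z : ℝ => ech ((-2 ^ j : ℤ) * z))) := by
      funext z
      simp only [fejer_succ, Complex.ofReal_mul, one_add_cos_eq, Pi.add_apply, Pi.smul_apply,
        Pi.mul_apply, smul_eq_mul]
      ring
    rw [e]
    refine Submodule.add_mem _ (Submodule.add_mem _ (tp_mono ?_ ih)
      (Submodule.smul_mem _ _ (hsub _ (by simp)))) (Submodule.smul_mem _ _ (hsub _ (by simp)))
    rintro m ⟨h0, hm⟩
    exact ⟨h0, hm.trans_le (pow_le_pow_right₀ (by norm_num) (Nat.le_succ j))⟩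

lemma fejer_mem_tp (j : ℕ) : (fun z => (fejer j z : ℂ)) ∈ tp {m | |m| < 2 ^ j} := by
  have h1 : (fun z => (fejer j z : ℂ)) = (fun z => (fejer j z : ℂ) - 1) + fun z => ech ((0 : ℤ) * z) := by
    funext z; simp
  rw [h1]
  exact Submodule.add_mem _ (tp_mono (fun m hm => hm.2) (fejer_sub_one_mem_tp j)) (ech_mem_tp (by simp))

lemma sum_fejer_grid {j G : ℕ} (h : 2 ^ j ≤ G) (z : ℝ) :
    ∑ p ∈ Finset.range G, fejer j (z - p / G) = G := by
  have h1 := sum_grid_eq_zero (G := G) (fun m hm => ⟨hm.1, hm.2.trans_le (by exact_mod_cast h)⟩)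
    (fejer_sub_one_mem_tp j) z
  rw [Finset.sum_sub_distrib, sub_eq_zero, ← Complex.ofReal_sum] at h1
  simp only [Finset.sum_const, Finset.card_range, nsmul_eq_mul, mul_one] at h1
  exact_mod_cast h1

lemma sum_abs_fejer_sub_le {j G : ℕ} (h : 2 ^ j ≤ G) (z z' : ℝ) :
    ∑ p ∈ Finset.range G, |fejer j (z - p / G) - fejer j (z' - p / G)|
      ≤ G * (Real.pi * j * 2 ^ j * |z - z'|) := by
  induction j with
  | zero => simp [fejer]
  | succ j ih =>
    have hj : 2 ^ j ≤ G := (Nat.pow_le_pow_right (by norm_num) (Nat.le_succ j)).trans h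
    have ih := ih hj
    have step : ∀ p : ℕ, |fejer (j + 1) (z - p / G) - fejer (j + 1) (z' - p / G)|
        ≤ 2 * |fejer j (z - p / G) - fejer j (z' - p / G)|
          + fejer j (z' - p / G) * (2 * Real.pi * 2 ^ j * |z - z'|) := by
      intro p
      rw [fejer_succ, fejer_succ]
      set x := fejer j (z - p / G)
      set y := fejer j (z' - p / G) with hy
      set a := 2 * Real.pi * (2 ^ j * (z - p / G)) with ha
      set b := 2 * Real.pi * (2 ^ j * (z' - p / G)) with hb
      have hy0 : 0 ≤ y := fejer_nonneg _ _
      have e : x * (1 + Real.cos a) - y * (1 + Real.cos b)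
          = (x - y) * (1 + Real.cos a) + y * (Real.cos a - Real.cos b) := by ring
      have h1 : |1 + Real.cos a| ≤ 2 := by
        rw [abs_le]; constructor <;> linarith [Real.neg_one_le_cos a, Real.cos_le_one a]
      have h2 : |Real.cos a - Real.cos b| ≤ 2 * Real.pi * 2 ^ j * |z - z'| := by
        refine (Real.abs_cos_sub_cos_le a b).trans (le_of_eq ?_)
        rw [ha, hb, show 2 * Real.pi * (2 ^ j * (z - p / G)) - 2 * Real.pi * (2 ^ j * (z' - p / G))
          = 2 * Real.pi * 2 ^ j * (z - z') by ring, abs_mul, abs_of_pos (by positivity)]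
      rw [e]
      calc |(x - y) * (1 + Real.cos a) + y * (Real.cos a - Real.cos b)|
          ≤ |x - y| * |1 + Real.cos a| + y * |Real.cos a - Real.cos b| := by
            refine (abs_add_le _ _).trans ?_
            rw [abs_mul, abs_mul, abs_of_nonneg hy0]
        _ ≤ |x - y| * 2 + y * (2 * Real.pi * 2 ^ j * |z - z'|) := by gcongr
        _ = _ := by ring
    calc _ ≤ ∑ p ∈ Finset.range G, (2 * |fejer j (z - p / G) - fejer j (z' - p / G)|
          + fejer j (z' - p / G) * (2 * Real.pi * 2 ^ j * |z - z'|)) :=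
          Finset.sum_le_sum fun p _ => step p
      _ = 2 * ∑ p ∈ Finset.range G, |fejer j (z - p / G) - fejer j (z' - p / G)|
          + G * (2 * Real.pi * 2 ^ j * |z - z'|) := by
          rw [Finset.sum_add_distrib, ← Finset.mul_sum, ← Finset.sum_mul, sum_fejer_grid hj]
      _ ≤ 2 * (G * (Real.pi * j * 2 ^ j * |z - z'|)) + G * (2 * Real.pi * 2 ^ j * |z - z'|) := by
          gcongr
      _ = _ := by push_cast; rw [pow_succ]; ring

/-- A modulated Fejér kernel: its Fourier transform is the tent over
`[(i - 1) 2 ^ j, (i + 1) 2 ^ j]`. -/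
def ker (g : ℤ × ℕ) (z : ℝ) : ℂ := ech ((g.1 * 2 ^ g.2 : ℤ) * z) * fejer g.2 z

lemma norm_ker (g : ℤ × ℕ) (z : ℝ) : ‖ker g z‖ = fejer g.2 z := by
  rw [ker, norm_mul, norm_ech, one_mul, Complex.norm_real, Real.norm_of_nonneg (fejer_nonneg _ _)]

open scoped Pointwise in
lemma ker_mem_tp (g : ℤ × ℕ) : ker g ∈ tp {m | |m - g.1 * 2 ^ g.2| < 2 ^ g.2} := by
  have := mul_mem_tp (ech_mem_tp (Set.mem_singleton (g.1 * 2 ^ g.2 : ℤ))) (fejer_mem_tp g.2)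
  refine tp_mono ?_ this
  rintro _ ⟨_, rfl, m, hm, rfl⟩
  simpa using hm

lemma sum_norm_ker_grid {g : ℤ × ℕ} {G : ℕ} (h : 2 ^ g.2 ≤ G) (z : ℝ) :
    ∑ p ∈ Finset.range G, ‖ker g (z - p / G)‖ = G := by
  simp_rw [norm_ker, sum_fejer_grid h]

lemma norm_ech_sub_le (s t : ℝ) : ‖ech s - ech t‖ ≤ 2 * Real.pi * |s - t| := by
  have h1 : ech s - ech t = ech t * (ech (s - t) - 1) := by
    rw [mul_sub, ← ech_add, mul_one]; congr 2; ring
  have h2 : ech (s - t) = Complex.exp (Complex.I * ((2 * Real.pi * (s - t) : ℝ) : ℂ)) := by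
    rw [ech]; congr 1; push_cast; ring
  rw [h1, norm_mul, norm_ech, one_mul, h2]
  refine (Real.norm_exp_I_mul_ofReal_sub_one_le).trans (le_of_eq ?_)
  rw [Real.norm_eq_abs, abs_mul, abs_of_pos (by positivity)]

lemma sum_norm_ker_sub_le {g : ℤ × ℕ} {G : ℕ} (h : 2 ^ g.2 ≤ G) (z z' : ℝ) :
    ∑ p ∈ Finset.range G, ‖ker g (z - p / G) - ker g (z' - p / G)‖
      ≤ G * ((Real.pi * g.2 * 2 ^ g.2 + 2 * Real.pi * |(g.1 * 2 ^ g.2 : ℤ)|) * |z - z'|) := by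
  have step : ∀ p : ℕ, ‖ker g (z - p / G) - ker g (z' - p / G)‖
      ≤ |fejer g.2 (z - p / G) - fejer g.2 (z' - p / G)|
        + fejer g.2 (z' - p / G) * (2 * Real.pi * |(g.1 * 2 ^ g.2 : ℤ)| * |z - z'|) := by
    intro p
    rw [ker, ker]
    set M : ℤ := g.1 * 2 ^ g.2
    set x := fejer g.2 (z - p / G)
    set y := fejer g.2 (z' - p / G)
    have hy0 : 0 ≤ y := fejer_nonneg _ _
    have e : ech (M * (z - p / G)) * (x : ℂ) - ech (M * (z' - p / G)) * (y : ℂ)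
      = ech (M * (z - p / G)) * ((x - y : ℝ) : ℂ)
        + (y : ℂ) * (ech (M * (z - p / G)) - ech (M * (z' - p / G))) := by push_cast; ring
    rw [e]
    refine (norm_add_le _ _).trans ?_
    rw [norm_mul, norm_mul, norm_ech, one_mul, Complex.norm_real, Complex.norm_real,
      Real.norm_eq_abs, Real.norm_of_nonneg hy0]
    gcongr
    refine (norm_ech_sub_le _ _).trans (le_of_eq ?_)
    rw [← mul_sub, abs_mul]
    push_cast
    rw [show z - p / G - (z' - p / G) = z - z' by ring]; ring
  calc _ ≤ ∑ p ∈ Finset.range G, (|fejer g.2 (z - p / G) - fejer g.2 (z' - p / G)|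
        + fejer g.2 (z' - p / G) * (2 * Real.pi * |(g.1 * 2 ^ g.2 : ℤ)| * |z - z'|)) :=
        Finset.sum_le_sum fun p _ => step p
    _ ≤ G * (Real.pi * g.2 * 2 ^ g.2 * |z - z'|)
        + G * (2 * Real.pi * |(g.1 * 2 ^ g.2 : ℤ)| * |z - z'|) := by
        rw [Finset.sum_add_distrib, ← Finset.sum_mul, sum_fejer_grid h]
        gcongr
        exact sum_abs_fejer_sub_le h z z'
    _ = _ := by ring

lemma ker_succ (i : ℤ) (j : ℕ) (z : ℝ) : ker (i, j + 1) z
    = ker (2 * i, j) z + (1 / 2) * ker (2 * i + 1, j) z + (1 / 2) * ker (2 * i - 1, j) z := by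
  simp only [ker, fejer_succ, Complex.ofReal_mul, one_add_cos_eq]
  have e1 : ech (((2 * i + 1) * 2 ^ j : ℤ) * z) = ech ((i * 2 ^ (j + 1) : ℤ) * z) * ech ((2 ^ j : ℤ) * z) := by
    rw [← ech_add]; congr 1; push_cast; ring
  have e2 : ech (((2 * i - 1) * 2 ^ j : ℤ) * z) = ech ((i * 2 ^ (j + 1) : ℤ) * z) * ech ((-2 ^ j : ℤ) * z) := by
    rw [← ech_add]; congr 1; push_cast; ring
  have e3 : (2 * i * 2 ^ j : ℤ) = i * 2 ^ (j + 1) := by ring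
  rw [e1, e2, e3]; ring

/-- The tent function, the Fourier transform of `ker`. -/
def tent (g : ℤ × ℕ) (x : ℝ) : ℝ := max 0 (1 - |x / 2 ^ g.2 - g.1|)

lemma tent_aux_nonneg (u : ℝ) (hu : 0 ≤ u) : max 0 (1 - |u / 2|)
    = max 0 (1 - |u|) + (1 / 2) * max 0 (1 - |u - 1|) + (1 / 2) * max 0 (1 - |u + 1|) := by
  rw [abs_of_nonneg (by linarith : 0 ≤ u / 2), abs_of_nonneg hu, abs_of_nonneg (by linarith : 0 ≤ u + 1),
    max_eq_left (by linarith : 1 - (u + 1) ≤ 0)]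
  rcases le_total u 1 with h | h
  · rw [abs_of_nonpos (by linarith), max_eq_right (by linarith), max_eq_right (by linarith),
      max_eq_right (by linarith)]
    ring
  · rw [abs_of_nonneg (by linarith : 0 ≤ u - 1), max_eq_left (by linarith : 1 - u ≤ 0)]
    rcases le_total u 2 with h | h
    · rw [max_eq_right (by linarith), max_eq_right (by linarith)]; ring
    · rw [max_eq_left (by linarith), max_eq_left (by linarith)]; ring
lemma tent_aux (u : ℝ) : max 0 (1 - |u / 2|)
    = max 0 (1 - |u|) + (1 / 2) * max 0 (1 - |u - 1|) + (1 / 2) * max 0 (1 - |u + 1|) := by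
  rcases le_total 0 u with h | h
  · exact tent_aux_nonneg u h
  · have := tent_aux_nonneg (-u) (by linarith)
    rw [neg_div, abs_neg, abs_neg, show -u - 1 = -(u + 1) by ring, abs_neg,
      show -u + 1 = -(u - 1) by ring, abs_neg] at this
    rw [this]; ring

lemma tent_succ (i : ℤ) (j : ℕ) (x : ℝ) : tent (i, j + 1) x
    = tent (2 * i, j) x + (1 / 2) * tent (2 * i + 1, j) x + (1 / 2) * tent (2 * i - 1, j) x := by
  simp only [tent]
  push_cast
  have : x / 2 ^ (j + 1) = (x / 2 ^ j) / 2 := by rw [pow_succ]; field_simp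
  rw [this]
  generalize x / 2 ^ j = y
  generalize hu : y - 2 * (i : ℝ) = u
  have h1 : y / 2 - i = u / 2 := by linarith
  have h2 : y - (2 * (i : ℝ) + 1) = u - 1 := by linarith
  have h3 : y - (2 * (i : ℝ) - 1) = u + 1 := by linarith
  rw [h1, h2, h3, tent_aux]

/-- The tents of relative width at most `1 / W`, or of width one. -/
def goodPieces (W J : ℕ) : Finset (ℤ × ℕ) :=
  (Finset.Icc (-(2 * W : ℤ)) (2 * W) ×ˢ Finset.range (J + 1)).filter fun g =>
    (g.2 = 0 ∨ (W : ℤ) ≤ |g.1|) ∧ (|g.1| + 1) * 2 ^ g.2 ≤ 2 ^ J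

lemma card_goodPieces_le (W J : ℕ) : (goodPieces W J).card ≤ (4 * W + 1) * (J + 1) := by
  refine (Finset.card_filter_le _ _).trans ?_
  rw [Finset.card_product, Int.card_Icc, Finset.card_range]
  apply Nat.mul_le_mul_right
  omega

lemma exists_decomposition (W J : ℕ) : ∃ c : ℤ × ℕ → ℝ,
    (∀ g ∈ goodPieces W J, 0 ≤ c g ∧ c g ≤ 1) ∧
    ∀ z, (fejer J z : ℂ) = ∑ g ∈ goodPieces W J, (c g : ℂ) * ker g z := by
  have key : ∀ j ≤ J, ∀ i : ℤ, |i| ≤ 2 * W → (|i| + 1) * 2 ^ j ≤ 2 ^ J → ∃ c : ℤ × ℕ → ℝ,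
      (∀ g, 0 ≤ c g) ∧ (∀ z, ker (i, j) z = ∑ g ∈ goodPieces W J, (c g : ℂ) * ker g z) ∧
      ∀ x, tent (i, j) x = ∑ g ∈ goodPieces W J, c g * tent g x := by
    have base : ∀ j ≤ J, ∀ i : ℤ, |i| ≤ 2 * W → (|i| + 1) * 2 ^ j ≤ 2 ^ J →
      (j = 0 ∨ (W : ℤ) ≤ |i|) → ∃ c : ℤ × ℕ → ℝ,
      (∀ g, 0 ≤ c g) ∧ (∀ z, ker (i, j) z = ∑ g ∈ goodPieces W J, (c g : ℂ) * ker g z) ∧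
      ∀ x, tent (i, j) x = ∑ g ∈ goodPieces W J, c g * tent g x := by
      intro j hj i hi hJ h
      have hmem : (i, j) ∈ goodPieces W J := by
        simp only [goodPieces, Finset.mem_filter, Finset.mem_product, Finset.mem_Icc,
          Finset.mem_range]
        exact ⟨⟨abs_le.1 hi, by omega⟩, h, hJ⟩
      refine ⟨fun g => if g = (i, j) then 1 else 0, fun g => by dsimp only; split_ifs <;> simp, fun z => ?_,
        fun x => ?_⟩
      · rw [Finset.sum_eq_single (i, j)] <;> simp +contextual [hmem]
      · rw [Finset.sum_eq_single (i, j)] <;> simp +contextual [hmem]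
    intro j
    induction j with
    | zero => exact fun hj i hi hJ => base 0 hj i hi hJ (Or.inl rfl)
    | succ j ih =>
      intro hj i hi hJ
      by_cases h : (W : ℤ) ≤ |i|
      · exact base _ hj i hi hJ (Or.inr h)
      · have hp : (2 : ℤ) ^ (j + 1) = 2 * 2 ^ j := by rw [pow_succ]; ring
        have hp0 : (0 : ℤ) < 2 ^ j := by positivity
        rw [hp] at hJ
        have hch : ∀ d : ℤ, |d| ≤ 1 → |2 * i + d| ≤ 2 * W ∧ (|2 * i + d| + 1) * 2 ^ j ≤ 2 ^ J := by
          intro d hd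
          have h3 : |2 * i + d| ≤ 2 * |i| + 1 := by
            refine (abs_add_le _ _).trans ?_
            rw [abs_mul]; simp; exact hd
          refine ⟨by omega, le_trans ?_ hJ⟩
          nlinarith
        obtain ⟨c1, p1, k1, t1⟩ := ih (by omega) (2 * i + 0) (hch 0 (by simp)).1 (hch 0 (by simp)).2
        obtain ⟨c2, p2, k2, t2⟩ := ih (by omega) (2 * i + 1) (hch 1 (by simp)).1 (hch 1 (by simp)).2
        obtain ⟨c3, p3, k3, t3⟩ := ih (by omega) (2 * i + -1) (hch (-1) (by simp)).1
          (hch (-1) (by simp)).2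
        rw [add_zero] at k1 t1
        rw [← sub_eq_add_neg] at k3 t3
        refine ⟨fun g => c1 g + (1 / 2) * c2 g + (1 / 2) * c3 g, fun g => ?_, fun z => ?_, fun x => ?_⟩
        · have := p1 g; have := p2 g; have := p3 g; positivity
        · rw [ker_succ, k1, k2, k3, Finset.mul_sum, Finset.mul_sum, ← Finset.sum_add_distrib,
            ← Finset.sum_add_distrib]
          refine Finset.sum_congr rfl fun g _ => ?_
          push_cast; ring
        · rw [tent_succ, t1, t2, t3, Finset.mul_sum, Finset.mul_sum, ← Finset.sum_add_distrib,
            ← Finset.sum_add_distrib]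
          refine Finset.sum_congr rfl fun g _ => ?_
          ring
  obtain ⟨c, hc, hk, ht⟩ := key J le_rfl 0 (by simp) (by simp)
  refine ⟨c, fun g hg => ⟨hc g, ?_⟩, fun z => ?_⟩
  · have h1 := ht (g.1 * 2 ^ g.2)
    have h2 : c g * tent g (g.1 * 2 ^ g.2) ≤ ∑ g' ∈ goodPieces W J, c g' * tent g' (g.1 * 2 ^ g.2) :=
      Finset.single_le_sum (f := fun g' => c g' * tent g' (g.1 * 2 ^ g.2))
        (fun g' _ => mul_nonneg (hc g') (le_max_left _ _)) hg
    rw [← h1] at h2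
    have h3 : tent g (g.1 * 2 ^ g.2) = 1 := by simp [tent]
    have h4 : tent (0, J) (g.1 * 2 ^ g.2) ≤ 1 := by
      simp only [tent, max_le_iff]
      exact ⟨zero_le_one, by linarith [abs_nonneg ((g.1 : ℝ) * 2 ^ g.2 / 2 ^ J - (0 : ℤ))]⟩
    rw [h3, mul_one] at h2
    linarith
  · rw [← hk]; simp [ker]

/-- The frequency of `p ↦ e(m z + l y)` on the slice `x`. -/
def freq (x : ℝ) (m l : ℤ) : Par := (m, m * x + l, m * x ^ 2 / 2 + l * x)

/-- The frequencies on the slice `x` coming from a pair of tents. -/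
def freqSet (g h : ℤ × ℕ) (x : ℝ) : Set Par :=
  {ξ | ∃ m l : ℤ, |m - g.1 * 2 ^ g.2| < 2 ^ g.2 ∧ |l - h.1 * 2 ^ h.2| < 2 ^ h.2 ∧ ξ = freq x m l}

/-- The first coordinate on the slice `x`. -/
def zc (x : ℝ) (p : Par) : ℝ := pair (1, x, x ^ 2 / 2) p

/-- The second coordinate on the slice `x`. -/
def yc (x : ℝ) (p : Par) : ℝ := pair (0, 1, x) p

/-- The piece, at the tents `g` and `h`, of the smoothed indicator function of a set of
grid points, pulled back to the parameter space. -/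
def piece (G : ℕ) (E : Finset (ℕ × ℕ)) (g h : ℤ × ℕ) (x : ℝ) (p : Par) : ℂ :=
  (1 / (G : ℂ) ^ 2) * ∑ e ∈ E, ker g (zc x p - e.1 / G) * ker h (yc x p - e.2 / G)

open scoped Pointwise in
lemma mul_comp_mem_trig {I₁ I₂ : Set ℤ} {u v : ℝ → ℂ} (hu : u ∈ tp I₁) (hv : v ∈ tp I₂) (x s t : ℝ) :
    (fun p => u (zc x p - s) * v (yc x p - t)) ∈
      trig {ξ | ∃ m ∈ I₁, ∃ l ∈ I₂, ξ = freq x m l} := by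
  have h1 := comp_pair_mem_trig (shift_mem_tp hu s) (1, x, x ^ 2 / 2)
  have h2 := comp_pair_mem_trig (shift_mem_tp hv t) (0, 1, x)
  refine trig_mono ?_ (mul_mem_trig h1 h2)
  rintro _ ⟨_, ⟨m, hm, rfl⟩, _, ⟨l, hl, rfl⟩, rfl⟩
  refine ⟨m, hm, l, hl, ?_⟩
  ext <;> (simp [freq]; try ring)

lemma piece_mem_trig (G : ℕ) (E : Finset (ℕ × ℕ)) (g h : ℤ × ℕ) (x : ℝ) :
    piece G E g h x ∈ trig (freqSet g h x) := by
  have : piece G E g h x = (1 / (G : ℂ) ^ 2) •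
      ∑ e ∈ E, fun p => ker g (zc x p - e.1 / G) * ker h (yc x p - e.2 / G) := by
    funext p; simp [piece]
  rw [this]
  refine Submodule.smul_mem _ _ (Submodule.sum_mem _ fun e _ => ?_)
  refine trig_mono ?_ (mul_comp_mem_trig (ker_mem_tp g) (ker_mem_tp h) x _ _)
  rintro _ ⟨m, hm, l, hl, rfl⟩
  exact ⟨m, l, hm, hl, rfl⟩

lemma norm_piece_le_sum (G : ℕ) (E : Finset (ℕ × ℕ)) (g h : ℤ × ℕ) (x : ℝ) (p : Par) :
    ‖piece G E g h x p‖ ≤ (1 / (G : ℝ) ^ 2) *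
      ∑ e ∈ E, fejer g.2 (zc x p - e.1 / G) * fejer h.2 (yc x p - e.2 / G) := by
  rw [piece, norm_mul, norm_div, norm_one, norm_pow, Complex.norm_natCast]
  gcongr
  refine (norm_sum_le _ _).trans (le_of_eq ?_)
  simp_rw [norm_mul, norm_ker]

lemma norm_piece_le_one {G : ℕ} {E : Finset (ℕ × ℕ)} (hE : E ⊆ Finset.range G ×ˢ Finset.range G)
    {g h : ℤ × ℕ} (hg : 2 ^ g.2 ≤ G) (hh : 2 ^ h.2 ≤ G) (x : ℝ) (p : Par) :
    ‖piece G E g h x p‖ ≤ 1 := by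
  have hG : 0 < G := lt_of_lt_of_le (by positivity) hg
  refine (norm_piece_le_sum G E g h x p).trans ?_
  calc _ ≤ (1 / (G : ℝ) ^ 2) * ∑ e ∈ Finset.range G ×ˢ Finset.range G,
        fejer g.2 (zc x p - e.1 / G) * fejer h.2 (yc x p - e.2 / G) := by
        refine mul_le_mul_of_nonneg_left (Finset.sum_le_sum_of_subset_of_nonneg hE fun e _ _ =>
          mul_nonneg (fejer_nonneg _ _) (fejer_nonneg _ _)) (by positivity)
    _ = (1 / (G : ℝ) ^ 2) * (G * G) := by
        rw [Finset.sum_product]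
        dsimp only
        rw [← Finset.sum_mul_sum, sum_fejer_grid hg, sum_fejer_grid hh]
    _ = 1 := by field_simp

end Integration

section Slices

variable {μ : Measure Par} [IsProbabilityMeasure μ]

lemma integral_trig_eq_zero (hμ : BandLimited μ) {X : Set Par} {f : Par → ℂ}
    (hf : f ∈ trig X) (h : ∀ ξ ∈ X, 1 ≤ ‖ξ‖) : ∫ p, f p ∂μ = 0 := by
  have := integral_trig_mul_conj_eq_zero hμ hf (ch_mem_trig (Set.mem_singleton 0))
    (fun ξ hξ η hη => by rw [Set.mem_singleton_iff.1 hη, sub_zero]; exact h ξ hξ)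
  simpa [ch] using this

lemma one_le_norm_freq {x : ℝ} {m l : ℤ} (h : m ≠ 0 ∨ m = 0 ∧ l ≠ 0) : 1 ≤ ‖freq x m l‖ := by
  rw [freq, Prod.norm_def, Prod.norm_def, le_max_iff, le_max_iff]
  simp only [Real.norm_eq_abs]
  rcases h with h | ⟨rfl, h⟩
  · left; exact_mod_cast Int.one_le_abs h
  · right; left
    simp only [Int.cast_zero, zero_mul, zero_add]
    exact_mod_cast Int.one_le_abs h

lemma integral_fejer_mul (hμ : BandLimited μ) (i j : ℕ) (x s t : ℝ) :
    ∫ p, fejer i (zc x p - s) * fejer j (yc x p - t) ∂μ = 1 := by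
  have hone : (fun z : ℝ => (1 : ℂ)) ∈ tp {0} := by
    have : (fun z : ℝ => (1 : ℂ)) = fun z => ech ((0 : ℤ) * z) := by funext z; simp
    rw [this]; exact ech_mem_tp rfl
  have m1 := mul_comp_mem_trig (fejer_sub_one_mem_tp i) (fejer_mem_tp j) x s t
  have m2 := mul_comp_mem_trig hone (fejer_sub_one_mem_tp j) x s t
  have h1 := integral_trig_eq_zero hμ m1 (by
    rintro _ ⟨m, hm, l, hl, rfl⟩
    exact one_le_norm_freq (Or.inl hm.1))
  have h2 := integral_trig_eq_zero hμ m2 (by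
    rintro _ ⟨m, hm, l, hl, rfl⟩
    exact one_le_norm_freq (Or.inr ⟨hm, hl.1⟩))
  have e : ∀ p, ((fejer i (zc x p - s) * fejer j (yc x p - t) : ℝ) : ℂ)
      = ((fejer i (zc x p - s) : ℂ) - 1) * (fejer j (yc x p - t) : ℂ)
        + 1 * ((fejer j (yc x p - t) : ℂ) - 1) + 1 := by
    intro p; push_cast; ring
  have i1 := (BddCont.of_mem_trig m1).integrable (μ := μ)
  have i2 := (BddCont.of_mem_trig m2).integrable (μ := μ)
  have : ((∫ p, fejer i (zc x p - s) * fejer j (yc x p - t) ∂μ : ℝ) : ℂ) = 1 := by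
    rw [← integral_complex_ofReal]
    simp_rw [e]
    have h3 := integral_add (i1.add i2) (integrable_const (1 : ℂ))
    simp only [Pi.add_apply] at h3
    rw [h3, integral_add i1 i2, h1, h2]
    simp
  exact_mod_cast this

@[fun_prop] lemma continuous_fejer (j : ℕ) : Continuous (fejer j) := by
  unfold fejer; fun_prop

@[fun_prop] lemma continuous_zc (x : ℝ) : Continuous (zc x) := by
  unfold zc pair; fun_prop

@[fun_prop] lemma continuous_yc (x : ℝ) : Continuous (yc x) := by
  unfold yc pair; fun_prop

lemma integral_norm_piece_sq_le (hμ : BandLimited μ) {G : ℕ} {E : Finset (ℕ × ℕ)}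
    (hE : E ⊆ Finset.range G ×ˢ Finset.range G)
    {g h : ℤ × ℕ} (hg : 2 ^ g.2 ≤ G) (hh : 2 ^ h.2 ≤ G) (x : ℝ) :
    ∫ p, ‖piece G E g h x p‖ ^ 2 ∂μ ≤ E.card / (G : ℝ) ^ 2 := by
  have hb := BddCont.of_mem_trig (piece_mem_trig G E g h x)
  have hi : ∀ e ∈ E, Integrable (fun p => fejer g.2 (zc x p - e.1 / G) * fejer h.2 (yc x p - e.2 / G)) μ := by
    intro e _
    have := integral_fejer_mul hμ g.2 h.2 x (e.1 / G) (e.2 / G)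
    by_contra hc
    rw [integral_undef hc] at this
    exact zero_ne_one this
  calc ∫ p, ‖piece G E g h x p‖ ^ 2 ∂μ ≤ ∫ p, (1 / (G : ℝ) ^ 2) *
      ∑ e ∈ E, fejer g.2 (zc x p - e.1 / G) * fejer h.2 (yc x p - e.2 / G) ∂μ := by
        refine integral_mono (hb.integrable_norm_pow 2) ((integrable_finsetSum _ hi).const_mul _) fun p => ?_
        have h1 := norm_piece_le_one hE hg hh x p
        have h2 := norm_piece_le_sum G E g h x p
        have h3 := norm_nonneg (piece G E g h x p)
        refine le_trans ?_ h2
        nlinarith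
    _ = E.card / (G : ℝ) ^ 2 := by
        rw [integral_const_mul, integral_finsetSum _ hi]
        simp_rw [integral_fejer_mul hμ]
        simp; ring

/-- A Lipschitz constant for the grid averages of `ker`. -/
def kerLip (g : ℤ × ℕ) : ℝ := Real.pi * g.2 * 2 ^ g.2 + 2 * Real.pi * |(g.1 * 2 ^ g.2 : ℤ)|

lemma kerLip_nonneg (g : ℤ × ℕ) : 0 ≤ kerLip g := by
  have := Real.pi_pos
  unfold kerLip; positivity

lemma norm_coord_le (p : Par) : |p.1| ≤ ‖p‖ ∧ |p.2.1| ≤ ‖p‖ ∧ |p.2.2| ≤ ‖p‖ :=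
  ⟨norm_fst_le p, (norm_fst_le p.2).trans (norm_snd_le p), (norm_snd_le p.2).trans (norm_snd_le p)⟩

lemma abs_zc_sub_le {x : ℝ} (h0 : 0 ≤ x) (h1 : x ≤ 1) (p p' : Par) :
    |zc x p - zc x p'| ≤ 3 * ‖p - p'‖ := by
  obtain ⟨a1, a2, a3⟩ := norm_coord_le (p - p')
  simp only [Prod.fst_sub, Prod.snd_sub] at a1 a2 a3
  have e : zc x p - zc x p' = (p.1 - p'.1) + x * (p.2.1 - p'.2.1) + x ^ 2 / 2 * (p.2.2 - p'.2.2) := by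
    simp only [zc, pair]; ring
  have hx2 : x ^ 2 ≤ 1 := by nlinarith
  rw [e]
  refine (abs_add_three _ _ _).trans ?_
  rw [abs_mul, abs_mul, abs_of_nonneg h0, abs_of_nonneg (by positivity : 0 ≤ x ^ 2 / 2)]
  nlinarith [abs_nonneg (p.2.1 - p'.2.1), abs_nonneg (p.2.2 - p'.2.2)]

lemma abs_yc_sub_le {x : ℝ} (h0 : 0 ≤ x) (h1 : x ≤ 1) (p p' : Par) :
    |yc x p - yc x p'| ≤ 2 * ‖p - p'‖ := by
  obtain ⟨a1, a2, a3⟩ := norm_coord_le (p - p')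
  simp only [Prod.fst_sub, Prod.snd_sub] at a1 a2 a3
  have e : yc x p - yc x p' = (p.2.1 - p'.2.1) + x * (p.2.2 - p'.2.2) := by
    simp only [yc, pair]; ring
  rw [e]
  refine (abs_add_le _ _).trans ?_
  rw [abs_mul, abs_of_nonneg h0]
  nlinarith [abs_nonneg (p.2.1 - p'.2.1), abs_nonneg (p.2.2 - p'.2.2)]

lemma norm_piece_sub_le {G : ℕ} {E : Finset (ℕ × ℕ)} (hE : E ⊆ Finset.range G ×ˢ Finset.range G)
    {g h : ℤ × ℕ} (hg : 2 ^ g.2 ≤ G) (hh : 2 ^ h.2 ≤ G) {x : ℝ} (h0 : 0 ≤ x) (h1 : x ≤ 1)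
    (p p' : Par) :
    ‖piece G E g h x p - piece G E g h x p'‖ ≤ (3 * kerLip g + 2 * kerLip h) * ‖p - p'‖ := by
  have hG : 0 < G := lt_of_lt_of_le (by positivity) hg
  have e : piece G E g h x p - piece G E g h x p' = (1 / (G : ℂ) ^ 2) * ∑ e ∈ E,
      ((ker g (zc x p - e.1 / G) - ker g (zc x p' - e.1 / G)) * ker h (yc x p - e.2 / G)
      + ker g (zc x p' - e.1 / G) * (ker h (yc x p - e.2 / G) - ker h (yc x p' - e.2 / G))) := by
    rw [piece, piece, ← mul_sub, ← Finset.sum_sub_distrib]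
    congr 1
    refine Finset.sum_congr rfl fun e _ => by ring
  rw [e, norm_mul, norm_div, norm_one, norm_pow, Complex.norm_natCast]
  calc _ ≤ (1 / (G : ℝ) ^ 2) * ∑ e ∈ Finset.range G ×ˢ Finset.range G,
        (‖ker g (zc x p - e.1 / G) - ker g (zc x p' - e.1 / G)‖ * ‖ker h (yc x p - e.2 / G)‖
        + ‖ker g (zc x p' - e.1 / G)‖ * ‖ker h (yc x p - e.2 / G) - ker h (yc x p' - e.2 / G)‖) := by
        gcongr
        refine (norm_sum_le _ _).trans ?_
        refine le_trans ?_ (Finset.sum_le_sum_of_subset_of_nonneg hE fun e _ _ => by positivity)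
        refine Finset.sum_le_sum fun e _ => (norm_add_le _ _).trans ?_
        rw [norm_mul, norm_mul]
    _ ≤ (1 / (G : ℝ) ^ 2) * ((G * (kerLip g * (3 * ‖p - p'‖))) * G
        + G * (G * (kerLip h * (2 * ‖p - p'‖)))) := by
        gcongr
        rw [Finset.sum_add_distrib, Finset.sum_product, Finset.sum_product]
        dsimp only
        rw [← Finset.sum_mul_sum,
          ← Finset.sum_mul_sum, sum_norm_ker_grid hg, sum_norm_ker_grid hh]
        gcongr
        · refine (sum_norm_ker_sub_le hg _ _).trans ?_
          exact mul_le_mul_of_nonneg_left (mul_le_mul_of_nonneg_left (abs_zc_sub_le h0 h1 p p')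
            (kerLip_nonneg g)) (Nat.cast_nonneg G)
        · refine (sum_norm_ker_sub_le hh _ _).trans ?_
          exact mul_le_mul_of_nonneg_left (mul_le_mul_of_nonneg_left (abs_yc_sub_le h0 h1 p p')
            (kerLip_nonneg h)) (Nat.cast_nonneg G)
    _ = _ := by field_simp

/-- The smoothed indicator function of a set of grid points at scale `2 ^ J`. -/
def smoothed (J G : ℕ) (E : Finset (ℕ × ℕ)) (x : ℝ) (p : Par) : ℝ :=
  (1 / (G : ℝ) ^ 2) * ∑ e ∈ E, fejer J (zc x p - e.1 / G) * fejer J (yc x p - e.2 / G)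

lemma smoothed_nonneg (J G : ℕ) (E : Finset (ℕ × ℕ)) (x : ℝ) (p : Par) : 0 ≤ smoothed J G E x p :=
  mul_nonneg (by positivity) (Finset.sum_nonneg fun e _ => mul_nonneg (fejer_nonneg _ _) (fejer_nonneg _ _))

lemma smoothed_eq_sum {W J : ℕ} {c : ℤ × ℕ → ℝ}
    (hc : ∀ z, (fejer J z : ℂ) = ∑ g ∈ goodPieces W J, (c g : ℂ) * ker g z)
    (G : ℕ) (E : Finset (ℕ × ℕ)) (x : ℝ) (p : Par) :
    (smoothed J G E x p : ℂ) = ∑ q ∈ goodPieces W J ×ˢ goodPieces W J,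
      ((c q.1 * c q.2 : ℝ) : ℂ) * piece G E q.1 q.2 x p := by
  simp only [smoothed, piece]
  push_cast
  simp_rw [hc, Finset.sum_mul_sum, Finset.mul_sum]
  rw [Finset.sum_product]
  rw [Finset.sum_comm]
  refine Finset.sum_congr rfl fun g _ => ?_
  rw [Finset.sum_comm]
  refine Finset.sum_congr rfl fun h _ => Finset.sum_congr rfl fun e _ => ?_
  ring

lemma smoothed_lower {J : ℕ} {E : Finset (ℕ × ℕ)} {x : ℝ} {p : Par} {e : ℕ × ℕ} (he : e ∈ E)
    (k₁ k₂ : ℤ) (h1 : |4 * 2 ^ J * zc x p - e.1 - 4 * 2 ^ J * k₁| ≤ 1 / 2)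
    (h2 : |4 * 2 ^ J * yc x p - e.2 - 4 * 2 ^ J * k₂| ≤ 1 / 2) :
    1 / 64 ≤ smoothed J (4 * 2 ^ J) E x p := by
  have key : ∀ (z : ℝ) (n : ℕ) (k : ℤ), |4 * 2 ^ J * z - n - 4 * 2 ^ J * k| ≤ 1 / 2 →
      (2 : ℝ) ^ J / 2 ≤ fejer J (z - n / ((4 * 2 ^ J : ℕ) : ℝ)) := by
    intro z n k h
    rw [← fejer_sub_int J _ k]
    apply fejer_lower
    have e : 4 * 2 ^ J * z - n - 4 * 2 ^ J * k = (4 * 2 ^ J) * (z - n / ((4 * 2 ^ J : ℕ) : ℝ) - k) := by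
      push_cast; field_simp
    rw [e, abs_mul, abs_of_pos (by positivity)] at h
    linarith
  have h3 := key _ _ _ h1
  have h4 := key _ _ _ h2
  have h5 : ((2 : ℝ) ^ J / 2) * (2 ^ J / 2) ≤ ∑ e ∈ E, fejer J (zc x p - e.1 / ((4 * 2 ^ J : ℕ) : ℝ)) *
      fejer J (yc x p - e.2 / ((4 * 2 ^ J : ℕ) : ℝ)) := by
    refine le_trans ?_ (Finset.single_le_sum (f := fun e : ℕ × ℕ => fejer J (zc x p - e.1 / ((4 * 2 ^ J : ℕ) : ℝ)) *
      fejer J (yc x p - e.2 / ((4 * 2 ^ J : ℕ) : ℝ))) (fun e _ => mul_nonneg (fejer_nonneg _ _) (fejer_nonneg _ _)) he)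
    exact mul_le_mul h3 h4 (by positivity) (fejer_nonneg _ _)
  calc (1 : ℝ) / 64 = (1 / ((4 * 2 ^ J : ℕ) : ℝ) ^ 2) * ((2 ^ J / 2) * (2 ^ J / 2)) := by
        push_cast; field_simp; norm_num
    _ ≤ _ := by
        unfold smoothed; gcongr

lemma abs_sub_mul_le_of_overlap {m l l' x x' M₁ M₂ S : ℝ} (hx' : |x'| ≤ 1)
    (hxx : |x - x'| ≤ 1)
    (hm : 4 * |m - M₁| ≤ |M₁|) (hl : 4 * |l - M₂| ≤ |M₂|) (hl' : 4 * |l' - M₂| ≤ |M₂|)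
    (hS : S = |M₂| ∧ 1 ≤ |M₂| ∨ (S ^ 2 = |M₁| ∧ 1 ≤ S ∧ |M₂| ≤ S) ∨ S = 1)
    (h2 : |m * x + l - (m * x' + l')| < 1)
    (h3 : |m * x ^ 2 / 2 + l * x - (m * x' ^ 2 / 2 + l' * x')| < 1) :
    |x - x'| * S ≤ 8 := by
  rcases hS with ⟨rfl, h⟩ | ⟨hS, hS1, hM⟩ | rfl
  · set ε := m * x + l - (m * x' + l') with hε
    set d := x - x' with hd
    have hb : |d * ((l + l' + ε) / 2)| ≤ 2 := by
      have : d * ((l + l' + ε) / 2) =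
          (m * x ^ 2 / 2 + l * x - (m * x' ^ 2 / 2 + l' * x')) - ε * x' := by
        rw [hε, hd]; ring
      rw [this]
      refine (abs_sub _ _).trans ?_
      rw [abs_mul]
      nlinarith [abs_nonneg ε, abs_nonneg x']
    rw [abs_mul] at hb
    have hc : |M₂| / 4 ≤ |(l + l' + ε) / 2| := by
      rw [abs_div, abs_two]
      have h4 : 2 * M₂ = (l + l' + ε) - (l - M₂) - (l' - M₂) - ε := by ring
      have h5 : 2 * |M₂| = |2 * M₂| := by rw [abs_mul, abs_two]
      have t1 := abs_sub ((l + l' + ε) - (l - M₂) - (l' - M₂)) ε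
      have t2 := abs_sub ((l + l' + ε) - (l - M₂)) (l' - M₂)
      have t3 := abs_sub (l + l' + ε) (l - M₂)
      rw [← h4, ← h5] at t1
      linarith
    nlinarith [abs_nonneg d]
  · set d := x - x' with hd
    have e : m * d = (m * x + l - (m * x' + l')) - (l - M₂) + (l' - M₂) := by rw [hd]; ring
    have h4 : |m * d| ≤ 1 + |M₂| / 2 := by
      rw [e]
      refine (abs_add_le _ _).trans ?_
      have := abs_sub (m * x + l - (m * x' + l')) (l - M₂)
      linarith
    rw [abs_mul] at h4
    have h5 : 3 / 4 * S ^ 2 ≤ |m| := by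
      have := abs_sub_abs_le_abs_sub M₁ m
      rw [abs_sub_comm] at this
      linarith
    have h6 : 3 / 4 * S ^ 2 * |d| ≤ 3 / 2 * S := by
      calc 3 / 4 * S ^ 2 * |d| ≤ |m| * |d| := by gcongr
        _ ≤ 3 / 2 * S := by linarith
    have h7 : (3 / 4 * (|d| * S)) * S ≤ (3 / 2) * S := by linarith
    have h8 := le_of_mul_le_mul_right h7 (by linarith)
    linarith
  · linarith

/-- Two pairs of points with almost equal sums and almost equal sums of squares are close up
to a permutation. -/
lemma close_of_sum_of_sum_sq {u₁ u₂ u₃ u₄ a b : ℝ} (h1 : |u₁ + u₂ - u₃ - u₄| ≤ a)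
    (h2 : |(u₁ - u₂) ^ 2 - (u₃ - u₄) ^ 2| ≤ b ^ 2) (hb : 0 ≤ b) :
    (|u₁ - u₃| ≤ (a + b) / 2 ∧ |u₂ - u₄| ≤ (a + b) / 2) ∨
      (|u₁ - u₄| ≤ (a + b) / 2 ∧ |u₂ - u₃| ≤ (a + b) / 2) := by
  have h3 : |(u₁ - u₂) - (u₃ - u₄)| ≤ b ∨ |(u₁ - u₂) + (u₃ - u₄)| ≤ b := by
    by_contra h
    push Not at h
    rw [sq_sub_sq, abs_mul] at h2
    nlinarith
  rw [abs_le] at h1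
  rcases h3 with h | h <;> rw [abs_le] at h
  · left; constructor <;> rw [abs_le] <;> constructor <;> linarith
  · right; constructor <;> rw [abs_le] <;> constructor <;> linarith

lemma abs_alternating_le {a b c d k : ℝ} (ha : |a| ≤ k) (hb : |b| ≤ k) (hc : |c| ≤ k)
    (hd : |d| ≤ k) : |a + b - c - d| ≤ 4 * k := by
  rw [abs_le] at *
  constructor <;> linarith

lemma quadruple_close {M S w V : ℝ} {m l y : Fin 4 → ℝ} (hM : 0 < |M|) (hS : 1 ≤ S)
    (hMS : |M| ≤ S ^ 2) (hV : 2 ≤ V) (hw : S ≤ w * |M|) (hVw : V * w ≤ 1)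
    (hm : ∀ i, |m i - M| * V ^ 2 ≤ |M|) (hl : ∀ i, |l i| ≤ 5 / 4 * S)
    (hy0 : ∀ i, 0 ≤ y i) (hy : ∀ i, y i ≤ V * w)
    (h2 : |(m 0 * y 0 + l 0) + (m 1 * y 1 + l 1) - (m 2 * y 2 + l 2) - (m 3 * y 3 + l 3)| ≤ 1)
    (h3 : |(m 0 * y 0 ^ 2 / 2 + l 0 * y 0) + (m 1 * y 1 ^ 2 / 2 + l 1 * y 1)
      - (m 2 * y 2 ^ 2 / 2 + l 2 * y 2) - (m 3 * y 3 ^ 2 / 2 + l 3 * y 3)| ≤ 2) :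
    (|y 0 - y 2| ≤ 16 * w ∧ |y 1 - y 3| ≤ 16 * w) ∨
      (|y 0 - y 3| ≤ 16 * w ∧ |y 1 - y 2| ≤ 16 * w) := by
  set ρ := |M| with hρ
  have hw0 : 0 < w := by
    by_contra h
    push Not at h
    nlinarith
  have hw1 : w ≤ 1 := by nlinarith
  have hm3 : ∀ i, 3 / 4 * ρ ≤ |m i| := by
    intro i
    have h1 := abs_sub_abs_le_abs_sub M (m i)
    rw [abs_sub_comm] at h1
    have h4 := hm i
    have : |m i - M| * 4 ≤ |m i - M| * V ^ 2 := by
      apply mul_le_mul_of_nonneg_left _ (abs_nonneg _); nlinarith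
    linarith
  have hm0 : ∀ i, m i ≠ 0 := fun i h => by
    have := hm3 i; rw [h, abs_zero] at this; linarith
  set v : Fin 4 → ℝ := fun i => l i / m i with hv
  set u : Fin 4 → ℝ := fun i => y i + v i with hu
  have hvm : ∀ i, m i * v i = l i := fun i => by rw [hv]; field_simp [hm0 i]
  have hvb : ∀ i, |v i| ≤ 2 * w := by
    intro i
    rw [hv, abs_div, div_le_iff₀ (by linarith [hm3 i])]
    calc |l i| ≤ 5 / 4 * S := hl i
      _ ≤ 5 / 4 * (w * ρ) := by linarith
      _ ≤ 2 * w * (3 / 4 * ρ) := by nlinarith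
      _ ≤ _ := by gcongr; exact hm3 i
  have hub : ∀ i, |u i| ≤ 2 * (V * w) := by
    intro i
    have h1 := hvb i
    have h4 := abs_add_le (y i) (v i)
    rw [abs_of_nonneg (hy0 i)] at h4
    have : 2 * w ≤ V * w := by gcongr
    have := hy i
    exact h4.trans (by linarith)
  have hρw : 1 ≤ ρ * w ^ 2 := by
    have h1 : S ^ 2 ≤ (w * ρ) ^ 2 := by gcongr
    have h4 : ρ * 1 ≤ ρ * (ρ * w ^ 2) := by nlinarith
    exact le_of_mul_le_mul_left h4 hM
  have hmu : ∀ i, |(m i - M) * u i| ≤ ρ * w * (2 / V) := by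
    intro i
    rw [abs_mul]
    have h1 : |m i - M| ≤ ρ / V ^ 2 := by rw [le_div_iff₀ (by positivity)]; exact hm i
    calc |m i - M| * |u i| ≤ (ρ / V ^ 2) * (2 * (V * w)) := by
          gcongr; exact hub i
      _ = ρ * w * (2 / V) := by field_simp
  have hmu2 : ∀ i, |(m i - M) * u i ^ 2| ≤ ρ * (4 * w ^ 2) := by
    intro i
    rw [abs_mul, abs_pow]
    have h1 : |m i - M| ≤ ρ / V ^ 2 := by rw [le_div_iff₀ (by positivity)]; exact hm i
    calc |m i - M| * |u i| ^ 2 ≤ (ρ / V ^ 2) * (2 * (V * w)) ^ 2 := by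
          gcongr; exact hub i
      _ = ρ * (4 * w ^ 2) := by field_simp; ring
  have hlv : ∀ i, |l i * v i| ≤ ρ * (25 / 12 * w ^ 2) := by
    intro i
    have h1 : |v i| * (3 / 4 * ρ) ≤ 5 / 4 * S := by
      calc |v i| * (3 / 4 * ρ) ≤ |v i| * |m i| := by gcongr; exact hm3 i
        _ = |l i| := by rw [mul_comm, ← abs_mul, hvm]
        _ ≤ _ := hl i
    have h4 : |v i| ≤ 5 / 3 * w := by
      have : |v i| * (3 / 4 * ρ) ≤ (5 / 3 * w) * (3 / 4 * ρ) := by nlinarith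
      exact le_of_mul_le_mul_right this (by positivity)
    rw [abs_mul]
    calc |l i| * |v i| ≤ (5 / 4 * (w * ρ)) * (5 / 3 * w) := by
          gcongr; exact (hl i).trans (by linarith)
      _ = _ := by ring
  have s1 : |u 0 + u 1 - u 2 - u 3| ≤ w ^ 2 + 8 * (w / V) := by
    have e : M * (u 0 + u 1 - u 2 - u 3)
      = ((m 0 * y 0 + l 0) + (m 1 * y 1 + l 1) - (m 2 * y 2 + l 2) - (m 3 * y 3 + l 3))
        - ((m 0 - M) * u 0 + (m 1 - M) * u 1 - (m 2 - M) * u 2 - (m 3 - M) * u 3) := by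
      simp only [hu]
      linear_combination hvm 0 + hvm 1 - hvm 2 - hvm 3
    have h4 : ρ * |u 0 + u 1 - u 2 - u 3| ≤ ρ * (w ^ 2 + 8 * (w / V)) := by
      rw [hρ, ← abs_mul, e]
      refine (abs_sub _ _).trans ?_
      have := abs_alternating_le (hmu 0) (hmu 1) (hmu 2) (hmu 3)
      have e2 : ρ * (w ^ 2 + 8 * (w / V)) = ρ * w ^ 2 + 4 * (ρ * w * (2 / V)) := by ring
      rw [← hρ, e2]
      linarith
    exact le_of_mul_le_mul_left h4 hM
  have s2 : |u 0 ^ 2 + u 1 ^ 2 - u 2 ^ 2 - u 3 ^ 2| ≤ 29 * w ^ 2 := by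
    have e : M * (u 0 ^ 2 + u 1 ^ 2 - u 2 ^ 2 - u 3 ^ 2)
      = 2 * ((m 0 * y 0 ^ 2 / 2 + l 0 * y 0) + (m 1 * y 1 ^ 2 / 2 + l 1 * y 1)
      - (m 2 * y 2 ^ 2 / 2 + l 2 * y 2) - (m 3 * y 3 ^ 2 / 2 + l 3 * y 3))
        + (l 0 * v 0 + l 1 * v 1 - l 2 * v 2 - l 3 * v 3)
        - ((m 0 - M) * u 0 ^ 2 + (m 1 - M) * u 1 ^ 2 - (m 2 - M) * u 2 ^ 2
          - (m 3 - M) * u 3 ^ 2) := by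
      simp only [hu]
      linear_combination (2 * y 0 + v 0) * hvm 0 + (2 * y 1 + v 1) * hvm 1
        - (2 * y 2 + v 2) * hvm 2 - (2 * y 3 + v 3) * hvm 3
    have h4 : ρ * |u 0 ^ 2 + u 1 ^ 2 - u 2 ^ 2 - u 3 ^ 2| ≤ ρ * (29 * w ^ 2) := by
      rw [hρ, ← abs_mul, e]
      refine (abs_sub _ _).trans ?_
      have t1 := abs_alternating_le (hmu2 0) (hmu2 1) (hmu2 2) (hmu2 3)
      have t2 := abs_alternating_le (hlv 0) (hlv 1) (hlv 2) (hlv 3)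
      refine (add_le_add (abs_add_le _ _) t1).trans ?_
      rw [abs_mul, abs_two, ← hρ]
      nlinarith
    exact le_of_mul_le_mul_left h4 hM
  have hwV : w / V ≤ w / 2 := by gcongr
  have hww : w ^ 2 ≤ w := by nlinarith
  have s1' : |u 0 + u 1 - u 2 - u 3| ≤ 5 * w := by linarith
  have s3 : |(u 0 - u 1) ^ 2 - (u 2 - u 3) ^ 2| ≤ (16 * w) ^ 2 := by
    have e : (u 0 - u 1) ^ 2 - (u 2 - u 3) ^ 2 = 2 * (u 0 ^ 2 + u 1 ^ 2 - u 2 ^ 2 - u 3 ^ 2)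
      - (u 0 + u 1 - u 2 - u 3) * (u 0 + u 1 - (-u 2) - (-u 3)) := by ring
    have h4 := abs_alternating_le (hub 0) (hub 1) (by rw [abs_neg]; exact hub 2) (by rw [abs_neg]; exact hub 3)
    rw [e]
    refine (abs_sub _ _).trans ?_
    rw [abs_mul, abs_mul, abs_two]
    have h5 : |u 0 + u 1 - u 2 - u 3| * |u 0 + u 1 - -u 2 - -u 3|
        ≤ (w ^ 2 + 8 * (w / V)) * (4 * (2 * (V * w))) := by gcongr
    have h6 : (w ^ 2 + 8 * (w / V)) * (4 * (2 * (V * w))) = 8 * w ^ 2 * (V * w) + 64 * w ^ 2 := by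
      field_simp; ring
    have h7 : 8 * w ^ 2 * (V * w) ≤ 8 * w ^ 2 * 1 := by gcongr
    nlinarith
  have fin : ∀ i j, |u i - u j| ≤ (5 * w + 16 * w) / 2 → |y i - y j| ≤ 16 * w := by
    intro i j h
    have e : y i - y j = (u i - u j) - v i + v j := by simp only [hu]; ring
    have h1 := hvb i
    have h4 := hvb j
    rw [e]
    rw [abs_le] at *
    constructor <;> linarith
  rcases close_of_sum_of_sum_sq s1' s3 (by positivity) with ⟨ha, hb⟩ | ⟨ha, hb⟩
  · exact Or.inl ⟨fin _ _ ha, fin _ _ hb⟩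
  · exact Or.inr ⟨fin _ _ ha, fin _ _ hb⟩

/-- The frequencies on the slice `x` whose coordinates are close to `M₁` and `M₂`. -/
def nearFreq (V : ℕ) (M₁ M₂ : ℤ) (x : ℝ) : Set Par :=
  {ξ | ∃ m l : ℤ, |(m : ℝ) - M₁| * V ^ 2 ≤ |(M₁ : ℝ)| ∧ |(l : ℝ) - M₂| * V ^ 2 ≤ |(M₂ : ℝ)| ∧
    ξ = freq x m l}

/-- The separation parameter of a pair of frequencies. -/
def sepParam (M₁ M₂ : ℤ) : ℝ := max (max |(M₂ : ℝ)| (Real.sqrt |(M₁ : ℝ)|)) 1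

lemma one_le_sepParam (M₁ M₂ : ℤ) : 1 ≤ sepParam M₁ M₂ := le_max_right _ _

lemma abs_le_sepParam (M₁ M₂ : ℤ) : |(M₂ : ℝ)| ≤ sepParam M₁ M₂ :=
  (le_max_left _ _).trans (le_max_left _ _)

lemma abs_le_sepParam_sq (M₁ M₂ : ℤ) : |(M₁ : ℝ)| ≤ sepParam M₁ M₂ ^ 2 := by
  have h : Real.sqrt |(M₁ : ℝ)| ≤ sepParam M₁ M₂ := (le_max_right _ _).trans (le_max_left _ _)
  calc |(M₁ : ℝ)| = Real.sqrt |(M₁ : ℝ)| ^ 2 := (Real.sq_sqrt (abs_nonneg _)).symm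
    _ ≤ _ := by gcongr

lemma sepParam_cases (M₁ M₂ : ℤ) :
    sepParam M₁ M₂ = |(M₂ : ℝ)| ∧ 1 ≤ |(M₂ : ℝ)| ∨
      (sepParam M₁ M₂ ^ 2 = |(M₁ : ℝ)| ∧ 1 ≤ sepParam M₁ M₂ ∧ |(M₂ : ℝ)| ≤ sepParam M₁ M₂) ∨
        sepParam M₁ M₂ = 1 := by
  have h1 := one_le_sepParam M₁ M₂
  have h2 := abs_le_sepParam M₁ M₂
  rcases max_choice (max |(M₂ : ℝ)| (Real.sqrt |(M₁ : ℝ)|)) 1 with h | h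
  · rcases max_choice |(M₂ : ℝ)| (Real.sqrt |(M₁ : ℝ)|) with h' | h'
    · left
      have e : sepParam M₁ M₂ = |(M₂ : ℝ)| := h.trans h'
      exact ⟨e, e ▸ h1⟩
    · right; left
      have e : sepParam M₁ M₂ = Real.sqrt |(M₁ : ℝ)| := h.trans h'
      refine ⟨?_, h1, h2⟩
      rw [e, Real.sq_sqrt (abs_nonneg _)]
  · right; right; exact h

lemma sepParam_le {M₁ M₂ : ℤ} {N : ℝ} (hN : 1 ≤ N) (h1 : |(M₁ : ℝ)| ≤ N) (h2 : |(M₂ : ℝ)| ≤ N) :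
    sepParam M₁ M₂ ≤ N := by
  refine max_le (max_le h2 ?_) hN
  rw [Real.sqrt_le_left (by linarith)]
  nlinarith

lemma exists_of_integral_ne_zero {μ : Measure Par} [IsProbabilityMeasure μ] (hμ : BandLimited μ)
    {X Y : Set Par} {f g : Par → ℂ} (hf : f ∈ trig X) (hg : g ∈ trig Y)
    (h : ∫ p, f p * (starRingEnd ℂ) (g p) ∂μ ≠ 0) : ∃ ξ ∈ X, ∃ η ∈ Y, ‖ξ - η‖ < 1 := by
  by_contra hc
  push Not at hc
  exact h (integral_trig_mul_conj_eq_zero hμ hf hg hc)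

lemma freq_sub_coord_lt {ξ : Par} (h : ‖ξ‖ < 1) : |ξ.1| < 1 ∧ |ξ.2.1| < 1 ∧ |ξ.2.2| < 1 := by
  obtain ⟨a1, a2, a3⟩ := norm_coord_le ξ
  exact ⟨a1.trans_lt h, a2.trans_lt h, a3.trans_lt h⟩

lemma abs_sub_mul_le_of_freq {V : ℕ} (hV : 2 ≤ V) {M₁ M₂ : ℤ} {x x' : ℝ} (h0 : 0 ≤ x) (h1 : x ≤ 1)
    (h0' : 0 ≤ x') (h1' : x' ≤ 1) {ξ η : Par} (hξ : ξ ∈ nearFreq V M₁ M₂ x)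
    (hη : η ∈ nearFreq V M₁ M₂ x') (h : ‖ξ - η‖ < 1) : |x - x'| * sepParam M₁ M₂ ≤ 8 := by
  obtain ⟨m, l, hm, hl, rfl⟩ := hξ
  obtain ⟨m', l', hm', hl', rfl⟩ := hη
  obtain ⟨a1, a2, a3⟩ := freq_sub_coord_lt h
  simp only [freq, Prod.fst_sub, Prod.snd_sub] at a1 a2 a3
  have hmm : m = m' := by
    rw [← sub_eq_zero, ← Int.abs_lt_one_iff]
    exact_mod_cast a1
  subst hmm
  have hV4 : (4 : ℝ) ≤ (V : ℝ) ^ 2 := by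
    have : (2 : ℝ) ≤ V := by exact_mod_cast hV
    nlinarith
  have aux : ∀ a b : ℝ, |a| * (V : ℝ) ^ 2 ≤ b → 4 * |a| ≤ b := fun a b hab => by
    nlinarith [abs_nonneg a]
  refine abs_sub_mul_le_of_overlap (m := m) (l := l) (l' := l') (M₁ := M₁) (M₂ := M₂) ?_ ?_
    (aux _ _ hm) (aux _ _ hl) (aux _ _ hl') (sepParam_cases _ _) a2 a3
  · rw [abs_of_nonneg h0']; exact h1'
  · rw [abs_le]; constructor <;> linarith

lemma ncard_near_le (s : Set ℕ) (i R : ℕ) (h : ∀ j ∈ s, j ≤ i + R ∧ i ≤ j + R) :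
    s.ncard ≤ 2 * R + 1 := by
  have hs : s ⊆ (Finset.Icc (i - R) (i + R) : Finset ℕ) := by
    intro j hj
    have := h j hj
    simp only [Finset.coe_Icc, Set.mem_Icc]
    omega
  refine (Set.ncard_le_ncard hs (Finset.finite_toSet _)).trans ?_
  rw [Set.ncard_coe_finset, Nat.card_Icc]
  omega

end Slices

section Family

variable {μ : Measure Par} [IsProbabilityMeasure μ] {V N : ℕ} {M₁ M₂ : ℤ} {F : ℕ → Par → ℂ}
  {e : ℕ → ℝ}

/-- A sum of consecutive members of a family of functions. -/
def blk (F : ℕ → Par → ℂ) (a L : ℕ) (p : Par) : ℂ := ∑ j ∈ Finset.Ico a (a + L), F j p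

lemma blk_mem_trig (hF : ∀ j : ℕ, F j ∈ trig (nearFreq V M₁ M₂ (j / N))) (a L : ℕ) :
    blk F a L ∈ trig {ξ | ∃ j ∈ Finset.Ico a (a + L), ξ ∈ nearFreq V M₁ M₂ (j / N)} := by
  have : blk F a L = ∑ j ∈ Finset.Ico a (a + L), F j := by funext p; simp [blk]
  rw [this]
  refine Submodule.sum_mem _ fun j hj =>
    trig_mono (X := nearFreq V M₁ M₂ (j / N)) (fun ξ hξ => ?_) (hF j)
  exact ⟨j, hj, hξ⟩

lemma norm_blk_le (hF1 : ∀ j p, ‖F j p‖ ≤ 1) (a L : ℕ) (p : Par) : ‖blk F a L p‖ ≤ L := by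
  refine (norm_sum_le _ _).trans ?_
  refine (Finset.sum_le_sum fun j _ => hF1 j p).trans ?_
  simp

lemma integral_norm_blk_sq_le (hμ : BandLimited μ) (hV : 2 ≤ V) (hN : 0 < N)
    (hM₁ : |(M₁ : ℝ)| ≤ N) (hM₂ : |(M₂ : ℝ)| ≤ N)
    (hF : ∀ j : ℕ, F j ∈ trig (nearFreq V M₁ M₂ (j / N)))
    (he : ∀ j, ∫ p, ‖F j p‖ ^ 2 ∂μ ≤ e j) {a L : ℕ} (hL : a + L ≤ N) :
    ∫ p, ‖blk F a L p‖ ^ 2 ∂μ ≤ 17 * N / sepParam M₁ M₂ * ∑ j ∈ Finset.Ico a (a + L), e j := by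
  set S := sepParam M₁ M₂ with hS
  have hS1 : 1 ≤ S := one_le_sepParam _ _
  have hN1 : (1 : ℝ) ≤ N := by exact_mod_cast hN
  have hSN : S ≤ N := sepParam_le hN1 hM₁ hM₂
  set R := ⌊8 * N / S⌋₊ with hR
  have hN0 : (0 : ℝ) < N := by linarith
  have hS0 : 0 < S := by linarith
  have key : ∀ i ∈ Finset.Ico a (a + L), ∀ j ∈ Finset.Ico a (a + L),
      ∫ p, F i p * (starRingEnd ℂ) (F j p) ∂μ ≠ 0 → i ≤ j + R := by
    intro i hi j hj hij
    rw [Finset.mem_Ico] at hi hj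
    have hiN : (i : ℝ) ≤ N := by exact_mod_cast (by omega : i ≤ N)
    have hjN : (j : ℝ) ≤ N := by exact_mod_cast (by omega : j ≤ N)
    obtain ⟨ξ, hξ, η, hη, h⟩ := exists_of_integral_ne_zero hμ (hF i) (hF j) hij
    have h8 := abs_sub_mul_le_of_freq hV (by positivity) ((div_le_one hN0).2 hiN) (by positivity)
      ((div_le_one hN0).2 hjN) hξ hη h
    by_contra hc
    have hlt : R < i - j := by omega
    rw [hR, Nat.floor_lt (by positivity), Nat.cast_sub (by omega), div_lt_iff₀ hS0] at hlt
    have h9 := le_abs_self ((i : ℝ) / N - j / N)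
    have h10 : ((i : ℝ) / N - j / N) * S ≤ 8 := (mul_le_mul_of_nonneg_right h9 hS0.le).trans h8
    rw [← sub_div, div_mul_eq_mul_div, div_le_iff₀ hN0] at h10
    linarith
  have h := integral_norm_sum_sq_le (μ := μ) (Finset.Ico a (a + L)) (g := F)
    (fun j _ => BddCont.of_mem_trig (hF j)) (2 * R + 1) (by
      intro i hi
      apply ncard_near_le _ i R
      rintro j ⟨hj, hij⟩
      refine ⟨key j hj i hi ?_, key i hi j hj hij⟩
      intro h0
      apply hij
      have : ∫ p, F i p * (starRingEnd ℂ) (F j p) ∂μ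
          = (starRingEnd ℂ) (∫ p, F j p * (starRingEnd ℂ) (F i p) ∂μ) := by
        rw [← integral_conj]
        congr 1
        funext p
        simp [mul_comm]
      rw [this, h0, map_zero])
  have e1 : ((2 * R + 1 : ℕ) : ℝ) ≤ 17 * N / S := by
    have h1 : (R : ℝ) ≤ 8 * N / S := Nat.floor_le (by positivity)
    have h2 : 1 ≤ N / S := (one_le_div hS0).2 hSN
    have h3 : 17 * (N : ℝ) / S = 2 * (8 * N / S) + N / S := by ring
    push_cast
    linarith
  have hsum : ∑ j ∈ Finset.Ico a (a + L), ∫ p, ‖F j p‖ ^ 2 ∂μ ≤ ∑ j ∈ Finset.Ico a (a + L), e j :=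
    Finset.sum_le_sum fun j _ => he j
  have hsum0 : 0 ≤ ∑ j ∈ Finset.Ico a (a + L), ∫ p, ‖F j p‖ ^ 2 ∂μ :=
    Finset.sum_nonneg fun j _ => integral_nonneg fun p => by positivity
  refine h.trans ?_
  exact mul_le_mul e1 hsum hsum0 (by positivity)

lemma integral_norm_blk_pow_four_le (hμ : BandLimited μ) (hV : 2 ≤ V) (hN : 0 < N)
    (hM₁ : |(M₁ : ℝ)| ≤ N) (hM₂ : |(M₂ : ℝ)| ≤ N)
    (hF : ∀ j : ℕ, F j ∈ trig (nearFreq V M₁ M₂ (j / N))) (hF1 : ∀ j p, ‖F j p‖ ≤ 1)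
    (he : ∀ j, ∫ p, ‖F j p‖ ^ 2 ∂μ ≤ e j) {a L : ℕ} (hL : a + L ≤ N) :
    ∫ p, ‖blk F a L p‖ ^ 4 ∂μ ≤
      (L : ℝ) ^ 2 * (17 * N / sepParam M₁ M₂) * ∑ j ∈ Finset.Ico a (a + L), e j := by
  have hb := BddCont.of_mem_trig (blk_mem_trig hF a L)
  calc ∫ p, ‖blk F a L p‖ ^ 4 ∂μ ≤ ∫ p, (L : ℝ) ^ 2 * ‖blk F a L p‖ ^ 2 ∂μ := by
        refine integral_mono (hb.integrable_norm_pow 4) ((hb.integrable_norm_pow 2).const_mul _)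
          fun p => ?_
        have h1 := norm_blk_le hF1 a L p
        have : ‖blk F a L p‖ ^ 4 = ‖blk F a L p‖ ^ 2 * ‖blk F a L p‖ ^ 2 := by ring
        dsimp only
        rw [this]
        gcongr
    _ = (L : ℝ) ^ 2 * ∫ p, ‖blk F a L p‖ ^ 2 ∂μ := integral_const_mul _ _
    _ ≤ (L : ℝ) ^ 2 * (17 * N / sepParam M₁ M₂ * ∑ j ∈ Finset.Ico a (a + L), e j) := by
        gcongr
        exact integral_norm_blk_sq_le hμ hV hN hM₁ hM₂ hF he hL
    _ = _ := by ring

lemma sum_Ico_mul {R : Type*} [AddCommMonoid R] (f : ℕ → R) (a L V : ℕ) : ∑ j ∈ Finset.Ico a (a + V * L), f j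
    = ∑ b ∈ Finset.range V, ∑ j ∈ Finset.Ico (a + b * L) (a + b * L + L), f j := by
  induction V with
  | zero => simp
  | succ V ih =>
    rw [Finset.sum_range_succ, ← ih, Finset.sum_Ico_consecutive _ (by omega) (by omega)]
    congr 2; ring

lemma blk_mul (F : ℕ → Par → ℂ) (a L V : ℕ) (p : Par) :
    blk F a (V * L) p = ∑ b ∈ Finset.range V, blk F (a + b * L) L p :=
  sum_Ico_mul _ _ _ _

/-- The index of a child block containing `j`. -/
lemma child_close {N a L b₁ b₂ j₁ j₂ : ℕ} (hN : 0 < N)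
    (h1 : j₁ ∈ Finset.Ico (a + b₁ * L) (a + b₁ * L + L))
    (h2 : j₂ ∈ Finset.Ico (a + b₂ * L) (a + b₂ * L + L))
    (h : |((j₁ : ℝ) / N - a / N) - (j₂ / N - a / N)| ≤ 16 * (L / N)) :
    b₂ ≤ b₁ + 17 ∧ b₁ ≤ b₂ + 17 := by
  rw [Finset.mem_Ico] at h1 h2
  have hN0 : (0 : ℝ) < N := by exact_mod_cast hN
  have e : ((j₁ : ℝ) / N - a / N) - (j₂ / N - a / N) = (j₁ - j₂) / N := by ring
  rw [e, abs_div, abs_of_pos hN0, ← mul_div_assoc, div_le_div_iff_of_pos_right hN0, abs_le] at h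
  have h3 : (j₂ : ℝ) ≤ j₁ + 16 * L := by linarith
  have h4 : (j₁ : ℝ) ≤ j₂ + 16 * L := by linarith
  have h3' : j₂ ≤ j₁ + 16 * L := by exact_mod_cast h3
  have h4' : j₁ ≤ j₂ + 16 * L := by exact_mod_cast h4
  have hL : 0 < L := by omega
  constructor
  · by_contra hc
    have : (b₁ + 18) * L ≤ b₂ * L := Nat.mul_le_mul_right _ (by omega)
    nlinarith
  · by_contra hc
    have : (b₂ + 18) * L ≤ b₁ * L := Nat.mul_le_mul_right _ (by omega)
    nlinarith

lemma ncard_pairs_near_le (s : Set (ℕ × ℕ)) (b : ℕ × ℕ) (h : ∀ c ∈ s,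
    ((c.1 ≤ b.1 + 17 ∧ b.1 ≤ c.1 + 17) ∧ (c.2 ≤ b.2 + 17 ∧ b.2 ≤ c.2 + 17)) ∨
    ((c.2 ≤ b.1 + 17 ∧ b.1 ≤ c.2 + 17) ∧ (c.1 ≤ b.2 + 17 ∧ b.2 ≤ c.1 + 17))) :
    s.ncard ≤ 2450 := by
  set A := Finset.Icc (b.1 - 17) (b.1 + 17) with hA
  set B := Finset.Icc (b.2 - 17) (b.2 + 17) with hB
  have hs : s ⊆ ((A ×ˢ B ∪ B ×ˢ A : Finset (ℕ × ℕ)) : Set (ℕ × ℕ)) := by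
    intro c hc
    have := h c hc
    simp only [Finset.mem_coe, Finset.mem_union, Finset.mem_product, hA, hB, Finset.mem_Icc]
    omega
  have hA' : A.card ≤ 35 := by rw [hA, Nat.card_Icc]; omega
  have hB' : B.card ≤ 35 := by rw [hB, Nat.card_Icc]; omega
  refine (Set.ncard_le_ncard hs (Finset.finite_toSet _)).trans ?_
  rw [Set.ncard_coe_finset]
  refine (Finset.card_union_le _ _).trans ?_
  rw [Finset.card_product, Finset.card_product]
  nlinarith

set_option maxHeartbeats 800000 in
open scoped Pointwise in
lemma child_pairs_close (hμ : BandLimited μ) (hV : 2 ≤ V) (hN : 0 < N)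
    (hF : ∀ j : ℕ, F j ∈ trig (nearFreq V M₁ M₂ (j / N))) {a L : ℕ} (hL : a + V * L ≤ N)
    (hM : 0 < |(M₁ : ℝ)|) (hw : sepParam M₁ M₂ * N ≤ L * |(M₁ : ℝ)|) {b c : ℕ × ℕ}
    (hb : b ∈ Finset.range V ×ˢ Finset.range V) (hc : c ∈ Finset.range V ×ˢ Finset.range V)
    (h : ∫ p, (blk F (a + b.1 * L) L p * blk F (a + b.2 * L) L p) *
      (starRingEnd ℂ) (blk F (a + c.1 * L) L p * blk F (a + c.2 * L) L p) ∂μ ≠ 0) :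
    ((c.1 ≤ b.1 + 17 ∧ b.1 ≤ c.1 + 17) ∧ (c.2 ≤ b.2 + 17 ∧ b.2 ≤ c.2 + 17)) ∨
    ((c.2 ≤ b.1 + 17 ∧ b.1 ≤ c.2 + 17) ∧ (c.1 ≤ b.2 + 17 ∧ b.2 ≤ c.1 + 17)) := by
  obtain ⟨ξ, hξ, η, hη, hlt⟩ := exists_of_integral_ne_zero hμ
    (mul_mem_trig (blk_mem_trig hF (a + b.1 * L) L) (blk_mem_trig hF (a + b.2 * L) L))
    (mul_mem_trig (blk_mem_trig hF (a + c.1 * L) L) (blk_mem_trig hF (a + c.2 * L) L)) h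
  obtain ⟨_, ⟨j₀, hj₀, m₀, l₀, hm₀, hl₀, rfl⟩, _, ⟨j₁, hj₁, m₁, l₁, hm₁, hl₁, rfl⟩, rfl⟩ := hξ
  obtain ⟨_, ⟨j₂, hj₂, m₂, l₂, hm₂, hl₂, rfl⟩, _, ⟨j₃, hj₃, m₃, l₃, hm₃, hl₃, rfl⟩, rfl⟩ := hη
  obtain ⟨a1, a2, a3⟩ := freq_sub_coord_lt hlt
  simp only [freq, Prod.fst_sub, Prod.snd_sub, Prod.fst_add, Prod.snd_add] at a1 a2 a3
  have hN0 : (0 : ℝ) < N := by exact_mod_cast hN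
  have hV0 : (2 : ℝ) ≤ V := by exact_mod_cast hV
  have hmm : (m₀ : ℝ) + m₁ - (m₂ + m₃) = 0 := by
    have : m₀ + m₁ - (m₂ + m₃) = 0 := by
      rw [← Int.abs_lt_one_iff]
      exact_mod_cast a1
    exact_mod_cast this
  set S := sepParam M₁ M₂ with hS
  have hS1 : 1 ≤ S := one_le_sepParam _ _
  have hl : ∀ l : ℤ, |(l : ℝ) - M₂| * V ^ 2 ≤ |(M₂ : ℝ)| → |(l : ℝ)| ≤ 5 / 4 * S := by
    intro l h
    have h1 := abs_sub_abs_le_abs_sub (l : ℝ) M₂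
    have h2 := abs_le_sepParam M₁ M₂
    have hV4 : (4 : ℝ) ≤ (V : ℝ) ^ 2 := by nlinarith
    have : 4 * |(l : ℝ) - M₂| ≤ |(M₂ : ℝ)| := by nlinarith [abs_nonneg ((l : ℝ) - M₂)]
    linarith
  have hy : ∀ (d j : ℕ), d ∈ Finset.range V → j ∈ Finset.Ico (a + d * L) (a + d * L + L) →
      0 ≤ (j : ℝ) / N - a / N ∧ (j : ℝ) / N - a / N ≤ V * (L / N) := by
    intro d j hd hj
    rw [Finset.mem_range] at hd
    rw [Finset.mem_Ico] at hj
    have h1 : (d + 1) * L ≤ V * L := Nat.mul_le_mul_right _ (by omega)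
    have h2 : a ≤ j := by nlinarith
    have h3 : j ≤ a + V * L := by nlinarith
    have h2' : (a : ℝ) ≤ j := by exact_mod_cast h2
    have h3' : (j : ℝ) ≤ a + V * L := by exact_mod_cast h3
    rw [← sub_div, ← mul_div_assoc]
    constructor
    · exact div_nonneg (by linarith) hN0.le
    · rw [div_le_div_iff_of_pos_right hN0]; linarith
  rw [Finset.mem_product] at hb hc
  have y0 := hy _ _ hb.1 hj₀
  have y1 := hy _ _ hb.2 hj₁
  have y2 := hy _ _ hc.1 hj₂
  have y3 := hy _ _ hc.2 hj₃
  have haN : (a : ℝ) / N ≤ 1 := by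
    rw [div_le_one hN0]; exact_mod_cast (by omega : a ≤ N)
  have haN0 : 0 ≤ (a : ℝ) / N := by positivity
  set x₀ := (a : ℝ) / N with hx₀
  have main := quadruple_close (M := M₁) (S := S) (w := L / N) (V := V)
    (m := ![(m₀ : ℝ), m₁, m₂, m₃]) (l := ![(l₀ : ℝ), l₁, l₂, l₃])
    (y := ![(j₀ : ℝ) / N - x₀, j₁ / N - x₀, j₂ / N - x₀, j₃ / N - x₀]) hM hS1
    (abs_le_sepParam_sq _ _) hV0
    (by rw [div_mul_eq_mul_div, le_div_iff₀ hN0]; exact hw)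
    (by
      rw [← mul_div_assoc, div_le_one hN0]
      exact_mod_cast (by omega : V * L ≤ N))
    (by intro i; fin_cases i; exacts [hm₀, hm₁, hm₂, hm₃])
    (by intro i; fin_cases i; exacts [hl _ hl₀, hl _ hl₁, hl _ hl₂, hl _ hl₃])
    (by intro i; fin_cases i; exacts [y0.1, y1.1, y2.1, y3.1])
    (by intro i; fin_cases i; exacts [y0.2, y1.2, y2.2, y3.2])
    (by
      simp only [Matrix.cons_val]
      rw [show (m₀ * ((j₀ : ℝ) / N - x₀) + l₀) + (m₁ * ((j₁ : ℝ) / N - x₀) + l₁)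
        - (m₂ * ((j₂ : ℝ) / N - x₀) + l₂) - (m₃ * ((j₃ : ℝ) / N - x₀) + l₃) =
        (m₀ * ((j₀ : ℝ) / N) + l₀ + (m₁ * ((j₁ : ℝ) / N) + l₁)
        - (m₂ * ((j₂ : ℝ) / N) + l₂ + (m₃ * ((j₃ : ℝ) / N) + l₃))) by
          linear_combination (-x₀) * hmm]
      exact a2.le)
    (by
      simp only [Matrix.cons_val]
      have e : (m₀ * ((j₀ : ℝ) / N - x₀) ^ 2 / 2 + l₀ * ((j₀ : ℝ) / N - x₀))
        + (m₁ * ((j₁ : ℝ) / N - x₀) ^ 2 / 2 + l₁ * ((j₁ : ℝ) / N - x₀))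
        - (m₂ * ((j₂ : ℝ) / N - x₀) ^ 2 / 2 + l₂ * ((j₂ : ℝ) / N - x₀))
        - (m₃ * ((j₃ : ℝ) / N - x₀) ^ 2 / 2 + l₃ * ((j₃ : ℝ) / N - x₀))
        = (m₀ * ((j₀ : ℝ) / N) ^ 2 / 2 + l₀ * ((j₀ : ℝ) / N)
          + (m₁ * ((j₁ : ℝ) / N) ^ 2 / 2 + l₁ * ((j₁ : ℝ) / N))
        - (m₂ * ((j₂ : ℝ) / N) ^ 2 / 2 + l₂ * ((j₂ : ℝ) / N)
          + (m₃ * ((j₃ : ℝ) / N) ^ 2 / 2 + l₃ * ((j₃ : ℝ) / N))))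
        - x₀ * (m₀ * ((j₀ : ℝ) / N) + l₀ + (m₁ * ((j₁ : ℝ) / N) + l₁)
        - (m₂ * ((j₂ : ℝ) / N) + l₂ + (m₃ * ((j₃ : ℝ) / N) + l₃))) := by
          linear_combination (x₀ ^ 2 / 2) * hmm
      rw [e]
      refine (abs_sub _ _).trans ?_
      rw [abs_mul, abs_of_nonneg haN0]
      nlinarith [abs_nonneg (m₀ * ((j₀ : ℝ) / N) + l₀ + (m₁ * ((j₁ : ℝ) / N) + l₁)
        - (m₂ * ((j₂ : ℝ) / N) + l₂ + (m₃ * ((j₃ : ℝ) / N) + l₃)))])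
  simp only [Matrix.cons_val] at main
  rcases main with ⟨h1, h2⟩ | ⟨h1, h2⟩
  · exact Or.inl ⟨child_close hN hj₀ hj₂ h1, child_close hN hj₁ hj₃ h2⟩
  · exact Or.inr ⟨child_close hN hj₀ hj₃ h1, child_close hN hj₁ hj₂ h2⟩

lemma integral_norm_blk_pow_four_step (hμ : BandLimited μ) (hV : 2 ≤ V) (hN : 0 < N)
    (hF : ∀ j : ℕ, F j ∈ trig (nearFreq V M₁ M₂ (j / N))) {a L : ℕ} (hL : a + V * L ≤ N)
    (hM : 0 < |(M₁ : ℝ)|) (hw : sepParam M₁ M₂ * N ≤ L * |(M₁ : ℝ)|) :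
    ∫ p, ‖blk F a (V * L) p‖ ^ 4 ∂μ ≤
      2450 * V * ∑ b ∈ Finset.range V, ∫ p, ‖blk F (a + b * L) L p‖ ^ 4 ∂μ := by
  have hb : ∀ a, BddCont (blk F a L) := fun a => BddCont.of_mem_trig (blk_mem_trig hF a L)
  have hbb : ∀ b : ℕ × ℕ, BddCont fun p => blk F (a + b.1 * L) L p * blk F (a + b.2 * L) L p :=
    fun b => (hb _).mul (hb _)
  have e1 : ∀ p, ‖blk F a (V * L) p‖ ^ 4 = ‖∑ b ∈ Finset.range V ×ˢ Finset.range V,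
      blk F (a + b.1 * L) L p * blk F (a + b.2 * L) L p‖ ^ 2 := by
    intro p
    rw [Finset.sum_product]
    dsimp only
    rw [← Finset.sum_mul_sum, ← blk_mul, norm_mul]
    ring
  simp_rw [e1]
  refine (integral_norm_sum_sq_le (μ := μ) (Finset.range V ×ˢ Finset.range V)
    (g := fun b p => blk F (a + b.1 * L) L p * blk F (a + b.2 * L) L p)
    (fun b _ => hbb b) 2450 ?_).trans ?_
  · intro b hb'
    apply ncard_pairs_near_le _ b
    rintro c ⟨hc, h⟩
    exact child_pairs_close hμ hV hN hF hL hM hw hb' hc h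
  · push_cast
    rw [mul_assoc, ← integral_finsetSum _ fun b _ => (hbb b).integrable_norm_pow 2,
      ← integral_finsetSum _ fun b _ => (hb _).integrable_norm_pow 4,
      ← integral_const_mul (V : ℝ)]
    refine mul_le_mul_of_nonneg_left (a := (2450 : ℝ)) (integral_mono ?_ ?_ fun p => ?_) (by norm_num)
    · exact integrable_finsetSum _ fun b _ => (hbb b).integrable_norm_pow 2
    · exact (integrable_finsetSum _ fun b _ => (hb _).integrable_norm_pow 4).const_mul _
    · have h1 := sq_sum_le_card_mul_sum_sq (s := Finset.range V)
        (f := fun b => ‖blk F (a + b * L) L p‖ ^ 2)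
      rw [Finset.card_range] at h1
      rw [Finset.sum_product]
      dsimp only
      simp_rw [norm_mul, mul_pow]
      rw [← Finset.sum_mul_sum, ← sq]
      refine h1.trans (le_of_eq ?_)
      simp_rw [← pow_mul]

lemma integral_norm_blk_pow_four_iterate (hμ : BandLimited μ) (hV : 2 ≤ V) (hN : 0 < N)
    (hM₁ : |(M₁ : ℝ)| ≤ N) (hM₂ : |(M₂ : ℝ)| ≤ N)
    (hF : ∀ j : ℕ, F j ∈ trig (nearFreq V M₁ M₂ (j / N))) (hF1 : ∀ j p, ‖F j p‖ ≤ 1)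
    (he : ∀ j, ∫ p, ‖F j p‖ ^ 2 ∂μ ≤ e j) {L : ℕ}
    (hM : 0 < |(M₁ : ℝ)|) (hw : sepParam M₁ M₂ * N ≤ L * |(M₁ : ℝ)|) (i : ℕ) :
    ∀ a, a + V ^ i * L ≤ N → ∫ p, ‖blk F a (V ^ i * L) p‖ ^ 4 ∂μ ≤
      (2450 * V) ^ i * ((L : ℝ) ^ 2 * (17 * N / sepParam M₁ M₂)) *
        ∑ j ∈ Finset.Ico a (a + V ^ i * L), e j := by
  induction i with
  | zero =>
    intro a ha
    simpa using integral_norm_blk_pow_four_le hμ hV hN hM₁ hM₂ hF hF1 he (by simpa using ha)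
  | succ i ih =>
    intro a ha
    have e1 : V ^ (i + 1) * L = V * (V ^ i * L) := by ring
    rw [e1] at ha ⊢
    have hLi : (L : ℝ) ≤ (V ^ i * L : ℕ) := by
      exact_mod_cast Nat.le_mul_of_pos_left L (by positivity)
    refine (integral_norm_blk_pow_four_step hμ hV hN hF ha hM
      (hw.trans (mul_le_mul_of_nonneg_right hLi (abs_nonneg _)))).trans ?_
    rw [sum_Ico_mul]
    calc _ ≤ 2450 * (V : ℝ) * ∑ b ∈ Finset.range V, (2450 * (V : ℝ)) ^ i *
          ((L : ℝ) ^ 2 * (17 * N / sepParam M₁ M₂)) *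
          ∑ j ∈ Finset.Ico (a + b * (V ^ i * L)) (a + b * (V ^ i * L) + V ^ i * L), e j := by
          gcongr with b hb
          apply ih
          rw [Finset.mem_range] at hb
          have h1 : (b + 1) * (V ^ i * L) ≤ V * (V ^ i * L) := Nat.mul_le_mul_right _ (by omega)
          nlinarith
      _ = _ := by rw [← Finset.mul_sum]; ring

theorem integral_norm_sum_pow_four_le (hμ : BandLimited μ) (hV : 2 ≤ V) {D : ℕ} (hND : N = V ^ D)
    (hM₁ : |(M₁ : ℝ)| ≤ N) (hM₂ : |(M₂ : ℝ)| ≤ N)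
    (hF : ∀ j : ℕ, F j ∈ trig (nearFreq V M₁ M₂ (j / N))) (hF1 : ∀ j p, ‖F j p‖ ≤ 1)
    (he : ∀ j, ∫ p, ‖F j p‖ ^ 2 ∂μ ≤ e j) :
    ∫ p, ‖∑ j ∈ Finset.range N, F j p‖ ^ 4 ∂μ ≤
      17 * 2450 ^ D * V * N ^ 3 / max (max |(M₁ : ℝ)| |(M₂ : ℝ)|) 1 * ∑ j ∈ Finset.range N, e j := by
  classical
  have hV1 : (1 : ℝ) ≤ V := by exact_mod_cast (by omega : 1 ≤ V)
  have hN : 0 < N := by rw [hND]; positivity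
  have hN0 : (0 : ℝ) < N := by exact_mod_cast hN
  have hN1 : (1 : ℝ) ≤ N := by exact_mod_cast hN
  set S := sepParam M₁ M₂ with hS
  have hS1 : 1 ≤ S := one_le_sepParam _ _
  have hMS : |(M₂ : ℝ)| ≤ S := abs_le_sepParam _ _
  have hSN : S ≤ N := sepParam_le hN1 hM₁ hM₂
  have hsum : 0 ≤ ∑ j ∈ Finset.range N, e j := Finset.sum_nonneg fun j _ =>
    (integral_nonneg fun p => by positivity).trans (he j)
  have hD : (1 : ℝ) ≤ 2450 ^ D := one_le_pow₀ (by norm_num)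
  have hblk : ∀ p, ∑ j ∈ Finset.range N, F j p = blk F 0 N p := fun p => by
    rw [blk, zero_add, Finset.range_eq_Ico]
  rw [show (fun p => ‖∑ j ∈ Finset.range N, F j p‖ ^ 4) = fun p => ‖blk F 0 N p‖ ^ 4 from
    funext fun p => by rw [hblk]]
  by_cases hρ : |(M₁ : ℝ)| ≤ S
  · have h := integral_norm_blk_pow_four_le hμ hV hN hM₁ hM₂ hF hF1 he (a := 0) (L := N) (by simp)
    rw [zero_add, ← Finset.range_eq_Ico] at h
    refine h.trans (mul_le_mul_of_nonneg_right ?_ hsum)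
    calc (N : ℝ) ^ 2 * (17 * N / S) = 17 * 1 * 1 * N ^ 3 / S := by ring
      _ ≤ _ := by
        gcongr
        exact max_le (max_le hρ hMS) hS1
  · push Not at hρ
    have hρ0 : 0 < |(M₁ : ℝ)| := by linarith
    have hex : ∃ k, S * N ≤ (V : ℝ) ^ k * |(M₁ : ℝ)| := ⟨D, by
      have : (N : ℝ) = (V : ℝ) ^ D := by rw [hND]; push_cast; rfl
      rw [← this, mul_comm]
      gcongr⟩
    set k := Nat.find hex with hk
    have hk1 : S * N ≤ (V : ℝ) ^ k * |(M₁ : ℝ)| := Nat.find_spec hex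
    have hkD : k ≤ D := Nat.find_min' hex (by
      have : (N : ℝ) = (V : ℝ) ^ D := by rw [hND]; push_cast; rfl
      rw [← this, mul_comm]
      gcongr)
    have hk2 : (V : ℝ) ^ k * |(M₁ : ℝ)| ≤ V * (S * N) := by
      rcases Nat.eq_zero_or_pos k with h0 | h0
      · rw [h0, pow_zero, one_mul]
        calc |(M₁ : ℝ)| ≤ N := hM₁
          _ = 1 * (1 * N) := by ring
          _ ≤ V * (S * N) := by gcongr
      · have := Nat.find_min hex (m := k - 1) (by omega)
        push Not at this
        have e1 : (V : ℝ) ^ k = V * V ^ (k - 1) := by rw [← pow_succ']; congr 1; omega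
        rw [e1, mul_assoc]
        gcongr
    have hNk : V ^ (D - k) * V ^ k = N := by rw [← pow_add, hND]; congr 1; omega
    have h := integral_norm_blk_pow_four_iterate hμ hV hN hM₁ hM₂ hF hF1 he (L := V ^ k) hρ0
      (by push_cast; exact hk1) (D - k) 0 (by rw [hNk]; simp)
    rw [hNk, zero_add, ← Finset.range_eq_Ico] at h
    refine h.trans (mul_le_mul_of_nonneg_right ?_ hsum)
    have hmax : max (max |(M₁ : ℝ)| |(M₂ : ℝ)|) 1 = |(M₁ : ℝ)| := by
      rw [max_eq_left, max_eq_left] <;> [linarith; exact le_max_of_le_left (by linarith)]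
    rw [hmax]
    push_cast
    have hNk' : (V : ℝ) ^ (D - k) * V ^ k = N := by exact_mod_cast hNk
    rw [le_div_iff₀ hρ0]
    calc (2450 * (V : ℝ)) ^ (D - k) * (((V : ℝ) ^ k) ^ 2 * (17 * N / S)) * |(M₁ : ℝ)|
        = 2450 ^ (D - k) * ((V : ℝ) ^ (D - k) * V ^ k) * (17 * N / S) * (V ^ k * |(M₁ : ℝ)|) := by
          rw [mul_pow]; ring
      _ ≤ 2450 ^ D * N * (17 * N / S) * (V * (S * N)) := by
          rw [hNk']
          gcongr
          · norm_num
          · omega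
      _ = _ := by field_simp

end Family

section Core

variable {μ : Measure Par} [IsProbabilityMeasure μ]

open scoped Classical in
lemma card_mul_le_integral_pow_four {H : Par → ℂ} (hH : BddCont H) {Λ : Finset Par} {r h K m : ℝ}
    (hh : 0 ≤ h) (hK : ∀ p : Par, ((Λ.filter fun q => p ∈ Metric.closedBall q r).card : ℝ) ≤ K)
    (hHh : ∀ q ∈ Λ, ∀ p ∈ Metric.closedBall q r, h ≤ ‖H p‖)
    (hm : ∀ q ∈ Λ, m ≤ μ.real (Metric.closedBall q r)) :
    Λ.card * m * h ^ 4 ≤ K * ∫ p, ‖H p‖ ^ 4 ∂μ := by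
  have hmeas : ∀ q : Par, MeasurableSet (Metric.closedBall q r) := fun q =>
    Metric.isClosed_closedBall.measurableSet
  have h_int : ∀ q ∈ Λ, Integrable ((Metric.closedBall q r).indicator fun _ : Par => h ^ 4) μ :=
    fun q _ => (integrable_const _).indicator (hmeas q)
  calc Λ.card * m * h ^ 4 = ∑ q ∈ Λ, m * h ^ 4 := by rw [Finset.sum_const, nsmul_eq_mul]; ring
    _ ≤ ∑ q ∈ Λ, ∫ p, (Metric.closedBall q r).indicator (fun _ : Par => h ^ 4) p ∂μ := by
        refine Finset.sum_le_sum fun q hq => ?_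
        rw [integral_indicator_const _ (hmeas q), smul_eq_mul]
        gcongr
        exact hm q hq
    _ = ∫ p, ∑ q ∈ Λ, (Metric.closedBall q r).indicator (fun _ : Par => h ^ 4) p ∂μ :=
        (integral_finsetSum _ h_int).symm
    _ ≤ ∫ p, K * ‖H p‖ ^ 4 ∂μ := by
        refine integral_mono (integrable_finsetSum _ h_int) ((hH.integrable_norm_pow 4).const_mul _)
          fun p => ?_
        have e : ∑ q ∈ Λ, (Metric.closedBall q r).indicator (fun _ : Par => h ^ 4) p
            = ((Λ.filter fun q => p ∈ Metric.closedBall q r).card : ℝ) * h ^ 4 := by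
          simp_rw [Set.indicator_apply]
          rw [← Finset.sum_filter, Finset.sum_const, nsmul_eq_mul]
        dsimp only
        rw [e]
        rcases Finset.eq_empty_or_nonempty (Λ.filter fun q => p ∈ Metric.closedBall q r) with h0 | ⟨q, hq⟩
        · have := hK p
          rw [h0] at this ⊢
          simp only [Finset.card_empty, Nat.cast_zero, zero_mul] at this ⊢
          positivity
        · rw [Finset.mem_filter] at hq
          have h1 := hHh q hq.1 p hq.2
          have h2 := hK p
          have h3 : 0 ≤ K := le_trans (Nat.cast_nonneg _) h2
          gcongr
    _ = _ := integral_const_mul _ _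

open scoped Classical in
lemma card_filter_closedBall_le {Λ : Finset Par} {N : ℕ} {r : ℝ} (hr : 0 ≤ r)
    (hΛ : Set.InjOn (fun p : Par => (⌊N * p.2.1⌋, ⌊N * p.2.2⌋)) Λ) (p : Par) :
    ((Λ.filter fun q => p ∈ Metric.closedBall q r).card : ℝ) ≤ (2 * (N * r) + 2) ^ 2 := by
  set I : ℝ → Finset ℤ := fun t => Finset.Icc ⌊N * (t - r)⌋ ⌊N * (t + r)⌋ with hI
  have hcard : ∀ t, ((I t).card : ℝ) ≤ 2 * (N * r) + 2 := by
    intro t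
    have hle : ⌊N * (t - r)⌋ ≤ ⌊N * (t + r)⌋ := Int.floor_mono (by gcongr; linarith)
    have h1 : (((I t).card : ℤ) : ℝ) = ⌊N * (t + r)⌋ + 1 - ⌊N * (t - r)⌋ := by
      rw [hI, Int.card_Icc, Int.toNat_of_nonneg (by omega)]
      push_cast; ring
    have h2 := Int.floor_le (N * (t + r))
    have h3 := Int.lt_floor_add_one (N * (t - r))
    have h4 : ((I t).card : ℝ) = (((I t).card : ℤ) : ℝ) := by push_cast; rfl
    rw [h4, h1]
    nlinarith
  have hmem : ∀ s t : ℝ, |t - s| ≤ r → ⌊N * s⌋ ∈ I t := by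
    intro s t h
    rw [abs_le] at h
    rw [hI, Finset.mem_Icc]
    constructor <;> apply Int.floor_mono <;> gcongr <;> linarith
  have hsub : ((Λ.filter fun q => p ∈ Metric.closedBall q r).card : ℝ)
      ≤ ((I p.2.1 ×ˢ I p.2.2).card : ℝ) := by
    norm_cast
    refine Finset.card_le_card_of_injOn (fun p : Par => (⌊N * p.2.1⌋, ⌊N * p.2.2⌋)) ?_
      (hΛ.mono fun q hq => (Finset.mem_filter.1 hq).1)
    intro q hq
    have hq' := (Finset.mem_filter.1 hq).2
    rw [mem_closedBall_iff_norm] at hq'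
    obtain ⟨-, a2, a3⟩ := norm_coord_le (p - q)
    exact Finset.mem_product.2 ⟨hmem _ _ (a2.trans hq'), hmem _ _ (a3.trans hq')⟩
  refine hsub.trans ?_
  rw [Finset.card_product, Nat.cast_mul, sq]
  have h1 := hcard p.2.1
  have h2 := hcard p.2.2
  gcongr

lemma mem_goodPieces {W J : ℕ} {g : ℤ × ℕ} (hg : g ∈ goodPieces W J) :
    (g.2 = 0 ∨ (W : ℤ) ≤ |g.1|) ∧ (|g.1| + 1) * 2 ^ g.2 ≤ 2 ^ J ∧ g.2 ≤ J := by
  simp only [goodPieces, Finset.mem_filter, Finset.mem_product, Finset.mem_range] at hg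
  exact ⟨hg.2.1, hg.2.2, by omega⟩

lemma near_of_goodPieces {W J : ℕ} {g : ℤ × ℕ} (hg : g ∈ goodPieces W J) {m : ℤ}
    (hm : |m - g.1 * 2 ^ g.2| < 2 ^ g.2) :
    |(m : ℝ) - ((g.1 * 2 ^ g.2 : ℤ) : ℝ)| * W ≤ |((g.1 * 2 ^ g.2 : ℤ) : ℝ)| := by
  have key : |m - g.1 * 2 ^ g.2| * W ≤ |g.1 * 2 ^ g.2| := by
    rcases (mem_goodPieces hg).1 with h | h
    · rw [h, pow_zero, mul_one, Int.abs_lt_one_iff] at hm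
      rw [h, pow_zero, mul_one, hm]
      simp
    · rw [abs_mul, abs_of_nonneg (by positivity : (0 : ℤ) ≤ 2 ^ g.2), mul_comm]
      exact mul_le_mul h hm.le (abs_nonneg _) (abs_nonneg _)
  exact_mod_cast key

lemma goodPieces_bounds {W J : ℕ} (hW : 1 ≤ W) {g : ℤ × ℕ} (hg : g ∈ goodPieces W J) {R : ℝ}
    (hR : 1 ≤ R) (hgR : |((g.1 * 2 ^ g.2 : ℤ) : ℝ)| ≤ R) :
    2 ^ g.2 ≤ 2 ^ J ∧ |((g.1 * 2 ^ g.2 : ℤ) : ℝ)| ≤ ((2 ^ J : ℕ) : ℝ) ∧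
      kerLip g ≤ 4 * (J + 2) * R := by
  obtain ⟨h1, h2, h3⟩ := mem_goodPieces hg
  have hp : (0 : ℤ) < 2 ^ g.2 := by positivity
  have habs : |g.1 * 2 ^ g.2| = |g.1| * 2 ^ g.2 := by rw [abs_mul, abs_of_pos hp]
  refine ⟨Nat.pow_le_pow_right (by norm_num) h3, ?_, ?_⟩
  · have : |g.1 * 2 ^ g.2| ≤ 2 ^ J := by rw [habs]; nlinarith
    exact_mod_cast this
  · have h4 : (2 : ℝ) ^ g.2 ≤ R := by
      rcases h1 with h | h
      · rw [h, pow_zero]; exact hR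
      · refine le_trans ?_ hgR
        have : (2 : ℤ) ^ g.2 ≤ |g.1 * 2 ^ g.2| := by
          rw [habs]
          have : (1 : ℤ) ≤ |g.1| := le_trans (by exact_mod_cast hW) h
          nlinarith
        exact_mod_cast this
    have h5 : (g.2 : ℝ) ≤ J := by exact_mod_cast h3
    calc kerLip g ≤ Real.pi * J * R + 2 * Real.pi * R := by
          unfold kerLip
          have := Real.pi_pos
          have h6 : |((g.1 * 2 ^ g.2 : ℤ) : ℝ)| = ((|g.1 * 2 ^ g.2| : ℤ) : ℝ) := by push_cast; rfl
          rw [h6] at hgR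
          gcongr
      _ = Real.pi * ((J + 2) * R) := by ring
      _ ≤ 4 * ((J + 2) * R) := by gcongr; exact Real.pi_le_four
      _ = _ := by ring

/-- The point `p` meets the grid set `E` on the slice `x`. -/
def IsHit (N : ℕ) (E : Finset (ℕ × ℕ)) (x : ℝ) (p : Par) : Prop :=
  ∃ e ∈ E, ∃ k₁ k₂ : ℤ, |4 * N * zc x p - e.1 - 4 * N * k₁| ≤ 1 / 2 ∧
    |4 * N * yc x p - e.2 - 4 * N * k₂| ≤ 1 / 2

open scoped Classical in
lemma exists_large_piece {W J : ℕ} {E : ℕ → Finset (ℕ × ℕ)} {p : Par} {n : ℕ} {t P : ℝ} (ht : 0 < t)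
    (hP : ((goodPieces W J ×ˢ goodPieces W J).card : ℝ) ≤ P)
    (h : t ≤ ((Finset.range n).filter fun j : ℕ => IsHit (2 ^ J) (E j) (j / n) p).card) :
    ∃ q ∈ goodPieces W J ×ˢ goodPieces W J,
      t / (64 * P) ≤ ‖∑ j ∈ Finset.range n, piece (4 * 2 ^ J) (E j) q.1 q.2 (j / n) p‖ := by
  obtain ⟨c, hc01, hc⟩ := exists_decomposition W J
  set s := goodPieces W J ×ˢ goodPieces W J with hs
  have h1 : t / 64 ≤ ∑ j ∈ Finset.range n, smoothed J (4 * 2 ^ J) (E j) (j / n) p := by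
    calc t / 64 ≤ ((Finset.range n).filter fun j : ℕ => IsHit (2 ^ J) (E j) (j / n) p).card / 64 := by
          gcongr
      _ = ∑ j ∈ (Finset.range n).filter fun j : ℕ => IsHit (2 ^ J) (E j) (j / n) p, (1 / 64 : ℝ) := by
          rw [Finset.sum_const, nsmul_eq_mul]; ring
      _ ≤ ∑ j ∈ (Finset.range n).filter fun j : ℕ => IsHit (2 ^ J) (E j) (j / n) p,
            smoothed J (4 * 2 ^ J) (E j) (j / n) p := by
          refine Finset.sum_le_sum fun j hj => ?_
          obtain ⟨e, he, k₁, k₂, a, b⟩ := (Finset.mem_filter.1 hj).2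
          push_cast at a b
          exact smoothed_lower he k₁ k₂ a b
      _ ≤ _ := Finset.sum_le_sum_of_subset_of_nonneg (Finset.filter_subset _ _)
          fun j _ _ => smoothed_nonneg _ _ _ _ _
  have h2 : ∑ j ∈ Finset.range n, smoothed J (4 * 2 ^ J) (E j) (j / n) p
      ≤ ∑ q ∈ s, ‖∑ j ∈ Finset.range n, piece (4 * 2 ^ J) (E j) q.1 q.2 (j / n) p‖ := by
    have e : ((∑ j ∈ Finset.range n, smoothed J (4 * 2 ^ J) (E j) (j / n) p : ℝ) : ℂ)
        = ∑ q ∈ s, ((c q.1 * c q.2 : ℝ) : ℂ) *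
          ∑ j ∈ Finset.range n, piece (4 * 2 ^ J) (E j) q.1 q.2 (j / n) p := by
      push_cast
      simp_rw [smoothed_eq_sum hc, Finset.mul_sum]
      rw [Finset.sum_comm]
      push_cast
      rfl
    calc _ ≤ ‖((∑ j ∈ Finset.range n, smoothed J (4 * 2 ^ J) (E j) (j / n) p : ℝ) : ℂ)‖ := by
          rw [Complex.norm_real]; exact le_abs_self _
      _ ≤ _ := by
          rw [e]
          refine (norm_sum_le _ _).trans (Finset.sum_le_sum fun q hq => ?_)
          rw [hs, Finset.mem_product] at hq
          obtain ⟨a0, a1⟩ := hc01 _ hq.1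
          obtain ⟨b0, b1⟩ := hc01 _ hq.2
          rw [norm_mul, Complex.norm_real, Real.norm_eq_abs, abs_of_nonneg (by positivity)]
          exact mul_le_of_le_one_left (norm_nonneg _) (mul_le_one₀ a1 b0 b1)
  have hne : s.Nonempty := by
    rw [Finset.nonempty_iff_ne_empty]
    intro h0
    rw [h0, Finset.sum_empty] at h2
    linarith
  have hP0 : 0 < P := lt_of_lt_of_le (by exact_mod_cast hne.card_pos) hP
  refine Finset.exists_le_of_sum_le hne (f := fun _ => t / (64 * P)) ?_
  rw [Finset.sum_const, nsmul_eq_mul]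
  refine le_trans ?_ (h1.trans h2)
  calc (s.card : ℝ) * (t / (64 * P)) ≤ P * (t / (64 * P)) := by gcongr
    _ = t / 64 := by field_simp

open scoped Classical in
/-- The discretised estimate for a single piece. -/
lemma card_le_of_large_piece (hμ : BandLimited μ) {A c : ℝ} (hc : 0 < c)
    (hball : ∀ p : Par, ∀ ρ : ℝ, ‖p‖ ≤ A → 0 ≤ ρ → ρ ≤ 1 →
      ENNReal.ofReal (c * ρ ^ 3) ≤ μ (Metric.closedBall p ρ))
    {κ D : ℕ} (hκ : 1 ≤ κ) {E : ℕ → Finset (ℕ × ℕ)}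
    (hE : ∀ j, E j ⊆ Finset.range (4 * 2 ^ (κ * D)) ×ˢ Finset.range (4 * 2 ^ (κ * D)))
    {g h : ℤ × ℕ} (hg : g ∈ goodPieces ((2 ^ κ) ^ 2) (κ * D))
    (hh : h ∈ goodPieces ((2 ^ κ) ^ 2) (κ * D)) {Λ : Finset Par} (hΛA : ∀ p ∈ Λ, ‖p‖ ≤ A)
    (hΛ : Set.InjOn (fun p : Par => (⌊((2 ^ (κ * D) : ℕ) : ℝ) * p.2.1⌋,
      ⌊((2 ^ (κ * D) : ℕ) : ℝ) * p.2.2⌋)) Λ) {θ : ℝ} (hθ0 : 0 < θ) (hθ1 : θ ≤ 1)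
    (hbig : ∀ p ∈ Λ, θ * (2 ^ (κ * D) : ℕ) ≤ ‖∑ j ∈ Finset.range (2 ^ (κ * D)),
      piece (4 * 2 ^ (κ * D)) (E j) g h (j / (2 ^ (κ * D) : ℕ)) p‖) :
    Λ.card * (2 ^ (κ * D) : ℕ) * θ ^ 7 * c ≤
      17 * 2450 ^ D * 40 * 160 ^ 2 * (D + 2) ^ 3 * (2 ^ κ) ^ 4 *
        ∑ j ∈ Finset.range (2 ^ (κ * D)), ((E j).card : ℝ) := by
  set N : ℕ := 2 ^ (κ * D) with hN
  set V : ℕ := 2 ^ κ with hV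
  have hV2 : 2 ≤ V := by
    calc 2 = 2 ^ 1 := rfl
      _ ≤ 2 ^ κ := Nat.pow_le_pow_right (by norm_num) hκ
  have hNV : N = V ^ D := by rw [hN, hV, pow_mul]
  have hV1 : (2 : ℝ) ≤ V := by exact_mod_cast hV2
  have hNpos : 0 < N := by rw [hN]; positivity
  have hN1 : (1 : ℝ) ≤ N := by exact_mod_cast hNpos
  set M₁ : ℤ := g.1 * 2 ^ g.2 with hM₁
  set M₂ : ℤ := h.1 * 2 ^ h.2 with hM₂
  set R : ℝ := max (max |(M₁ : ℝ)| |(M₂ : ℝ)|) 1 with hR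
  have hR1 : 1 ≤ R := le_max_right _ _
  have hW : 1 ≤ V ^ 2 := Nat.one_le_pow _ _ (by omega)
  obtain ⟨g1, g2, g3⟩ := goodPieces_bounds hW hg hR1 ((le_max_left _ _).trans (le_max_left _ _))
  obtain ⟨h1, h2, h3⟩ := goodPieces_bounds hW hh hR1 ((le_max_right _ _).trans (le_max_left _ _))
  rw [← hN] at g1 g2 h1 h2
  rw [← hM₁] at g2
  rw [← hM₂] at h2
  have hRN : R ≤ N := max_le (max_le g2 h2) hN1
  have hgG : 2 ^ g.2 ≤ 4 * N := by omega
  have hhG : 2 ^ h.2 ≤ 4 * N := by omega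
  set F : ℕ → Par → ℂ := fun j => piece (4 * N) (E j) g h (j / N) with hF
  have hFt : ∀ j : ℕ, F j ∈ trig (nearFreq V M₁ M₂ (j / N)) := by
    intro j
    refine trig_mono ?_ (piece_mem_trig (4 * N) (E j) g h (j / N))
    rintro ξ ⟨m, l, hm, hl, rfl⟩
    refine ⟨m, l, ?_, ?_, rfl⟩
    · have := near_of_goodPieces hg hm
      push_cast [hM₁, hM₂] at this ⊢
      exact this
    · have := near_of_goodPieces hh hl
      push_cast [hM₁, hM₂] at this ⊢
      exact this
  have L4 := integral_norm_sum_pow_four_le hμ hV2 hNV g2 h2 hFt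
    (fun j p => norm_piece_le_one (hE j) hgG hhG _ p)
    (fun j => integral_norm_piece_sq_le hμ (hE j) hgG hhG (j / N))
  set H : Par → ℂ := fun p => ∑ j ∈ Finset.range N, F j p with hH
  have hHb : BddCont H := BddCont.sum _ fun j _ => BddCont.of_mem_trig (hFt j)
  set a : ℝ := 20 * (D + 2) * V with ha
  have ha0 : 0 < a := by positivity
  have hκV : (κ : ℝ) ≤ V := by
    rw [hV]; exact_mod_cast (Nat.lt_two_pow_self (n := κ)).le
  have hLip : ∀ p p', ‖H p - H p'‖ ≤ N * (a * R * ‖p - p'‖) := by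
    intro p p'
    rw [hH]
    dsimp only
    rw [← Finset.sum_sub_distrib]
    refine (norm_sum_le _ _).trans ?_
    have : ∀ j ∈ Finset.range N, ‖F j p - F j p'‖ ≤ a * R * ‖p - p'‖ := by
      intro j hj
      rw [Finset.mem_range] at hj
      refine (norm_piece_sub_le (hE j) hgG hhG (by positivity) ?_ p p').trans ?_
      · rw [div_le_one (by linarith)]; exact_mod_cast hj.le
      · gcongr
        have : (4 : ℝ) * ((κ * D : ℕ) + 2) * R ≤ 4 * ((D + 2) * V) * R := by
          gcongr
          push_cast
          nlinarith [(Nat.cast_nonneg D : (0 : ℝ) ≤ D)]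
        rw [ha]
        linarith
    refine (Finset.sum_le_sum this).trans ?_
    rw [Finset.sum_const, Finset.card_range, nsmul_eq_mul]
  set r : ℝ := θ / (2 * a * R) with hr
  have hr0 : 0 < r := by positivity
  have ha1 : 1 ≤ a := by
    rw [ha]; nlinarith [(Nat.cast_nonneg D : (0 : ℝ) ≤ D)]
  have hr1 : r ≤ 1 := by
    rw [hr, div_le_one (by positivity)]
    nlinarith
  have hHh : ∀ q ∈ Λ, ∀ p ∈ Metric.closedBall q r, θ * N / 2 ≤ ‖H p‖ := by
    intro q hq p hp
    rw [mem_closedBall_iff_norm, norm_sub_rev] at hp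
    have t1 := hbig q hq
    have t2 := hLip q p
    have t3 : N * (a * R * ‖q - p‖) ≤ θ * N / 2 := by
      calc N * (a * R * ‖q - p‖) ≤ N * (a * R * r) := by gcongr
        _ = θ * N / 2 := by rw [hr]; field_simp
    have t4 := norm_sub_norm_le (H q) (H p)
    have t5 : θ * N ≤ ‖H q‖ := t1
    linarith
  have hm : ∀ q ∈ Λ, c * r ^ 3 ≤ μ.real (Metric.closedBall q r) := by
    intro q hq
    have := hball q r (hΛA q hq) hr0.le hr1
    exact (ENNReal.ofReal_le_iff_le_toReal (measure_ne_top _ _)).1 this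
  have main := card_mul_le_integral_pow_four hHb (by positivity)
    (card_filter_closedBall_le hr0.le hΛ) hHh hm
  set T₀ : ℝ := ∑ j ∈ Finset.range N, ((E j).card : ℝ) with hT
  have hT0 : 0 ≤ T₀ := Finset.sum_nonneg fun j _ => Nat.cast_nonneg _
  have hsum : ∑ j ∈ Finset.range N, ((E j).card : ℝ) / ((4 * N : ℕ) : ℝ) ^ 2 = T₀ / (16 * N ^ 2) := by
    rw [← Finset.sum_div, ← hT]; push_cast; ring_nf
  rw [hsum, ← hR] at L4
  have hKr : 2 * (N * r) + 2 ≤ 8 * a / θ * (N * r) := by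
    have e1 : 2 ≤ 4 * a / θ * (N * r) := by
      have e : 4 * a / θ * (N * r) = 2 * (N / R) := by rw [hr]; field_simp; norm_num
      rw [e]
      have : 1 ≤ N / R := by rw [one_le_div (by linarith)]; exact hRN
      linarith
    have e2 : 2 ≤ 4 * a / θ := by
      rw [le_div_iff₀ hθ0]; linarith
    have : 0 ≤ N * r := by positivity
    calc 2 * (N * r) + 2 ≤ 4 * a / θ * (N * r) + 4 * a / θ * (N * r) := by gcongr
      _ = _ := by ring
  have fin : Λ.card * (c * r ^ 3) * (θ * N / 2) ^ 4 ≤ (8 * a / θ * (N * r)) ^ 2 *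
      (17 * 2450 ^ D * V * N ^ 3 / R * (T₀ / (16 * N ^ 2))) := by
    refine main.trans ?_
    have : 0 ≤ ∫ p, ‖H p‖ ^ 4 ∂μ := integral_nonneg fun p => by positivity
    gcongr
  have hfac : 0 < r ^ 2 * N ^ 3 / (16 * R * θ ^ 2) := by positivity
  refine le_of_mul_le_mul_right ?_ hfac
  calc Λ.card * N * θ ^ 7 * c * (r ^ 2 * N ^ 3 / (16 * R * θ ^ 2))
      = 2 * a * (Λ.card * (c * r ^ 3) * (θ * N / 2) ^ 4) := by
        rw [hr]; field_simp; ring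
    _ ≤ 2 * a * ((8 * a / θ * (N * r)) ^ 2 *
      (17 * 2450 ^ D * V * N ^ 3 / R * (T₀ / (16 * N ^ 2)))) := by gcongr
    _ = _ := by rw [ha, hV]; push_cast; field_simp; ring

set_option maxHeartbeats 1000000 in
open scoped Classical in
/-- The discretised Kakeya estimate. -/
theorem exists_discrete_estimate (A : ℝ) (hA : 0 < A) (D : ℕ) : ∃ C : ℝ, 0 < C ∧
    ∀ κ : ℕ, 1 ≤ κ → ∀ θ : ℝ, 0 < θ → θ ≤ 1 → ∀ (E : ℕ → Finset (ℕ × ℕ)) (Λ : Finset Par),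
    (∀ j, E j ⊆ Finset.range (4 * 2 ^ (κ * D)) ×ˢ Finset.range (4 * 2 ^ (κ * D))) →
    (∀ p ∈ Λ, ‖p‖ ≤ A) →
    Set.InjOn (fun p : Par => (⌊((2 ^ (κ * D) : ℕ) : ℝ) * p.2.1⌋,
      ⌊((2 ^ (κ * D) : ℕ) : ℝ) * p.2.2⌋)) Λ →
    (∀ p ∈ Λ, θ * (2 ^ (κ * D) : ℕ) ≤ ((Finset.range (2 ^ (κ * D))).filter fun j : ℕ =>
      IsHit (2 ^ (κ * D)) (E j) (j / (2 ^ (κ * D) : ℕ)) p).card) →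
    Λ.card * (2 ^ (κ * D) : ℕ) * θ ^ 7 ≤
      C * (2 ^ κ) ^ 52 * ∑ j ∈ Finset.range (2 ^ (κ * D)), ((E j).card : ℝ) := by
  obtain ⟨μ, hμp, hμ, c, hc, hball⟩ := exists_bandLimited A hA
  set B : ℝ := 25 * (D + 1) ^ 2 with hB
  have hB1 : 1 ≤ B := by rw [hB]; nlinarith [(Nat.cast_nonneg D : (0 : ℝ) ≤ D)]
  obtain ⟨K, hK⟩ : ∃ K : ℝ, K = 17 * 2450 ^ D * 40 * 160 ^ 2 * (D + 2) ^ 3 := ⟨_, rfl⟩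
  have hK0 : 0 < K := by rw [hK]; positivity
  refine ⟨(64 * B) ^ 7 * B * K / c, by positivity, ?_⟩
  intro κ hκ θ hθ0 hθ1 E Λ hE hΛA hΛ hhit
  set N : ℕ := 2 ^ (κ * D) with hN
  set V : ℝ := 2 ^ κ with hV
  have hV1 : 1 ≤ V := one_le_pow₀ (by norm_num)
  have hNpos : 0 < N := by rw [hN]; positivity
  have hN1 : (1 : ℝ) ≤ N := by exact_mod_cast hNpos
  set s := goodPieces ((2 ^ κ) ^ 2) (κ * D) ×ˢ goodPieces ((2 ^ κ) ^ 2) (κ * D) with hs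
  have hcard : (s.card : ℝ) ≤ B * V ^ 6 := by
    have h1 : ((goodPieces ((2 ^ κ) ^ 2) (κ * D)).card : ℝ) ≤ (4 * V ^ 2 + 1) * (κ * D + 1) := by
      rw [hV]; exact_mod_cast card_goodPieces_le ((2 ^ κ) ^ 2) (κ * D)
    have hκV : (κ : ℝ) ≤ V := by
      rw [hV]; exact_mod_cast (Nat.lt_two_pow_self (n := κ)).le
    have h2 : ((goodPieces ((2 ^ κ) ^ 2) (κ * D)).card : ℝ) ≤ (5 * V ^ 2) * ((D + 1) * V) := by
      refine h1.trans ?_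
      have : (1 : ℝ) ≤ V ^ 2 := one_le_pow₀ hV1
      gcongr
      · linarith
      · nlinarith [(Nat.cast_nonneg D : (0 : ℝ) ≤ D)]
    rw [hs, Finset.card_product, Nat.cast_mul]
    calc _ ≤ ((5 * V ^ 2) * ((D + 1) * V)) * ((5 * V ^ 2) * ((D + 1) * V)) := by gcongr
      _ = _ := by rw [hB]; ring
  set P : ℝ := B * V ^ 6 with hP
  have hP1 : 1 ≤ P := by
    have : (1 : ℝ) ≤ V ^ 6 := one_le_pow₀ hV1
    rw [hP]; nlinarith
  have hex : ∀ p ∈ Λ, ∃ q ∈ s, θ * N / (64 * P) ≤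
      ‖∑ j ∈ Finset.range N, piece (4 * 2 ^ (κ * D)) (E j) q.1 q.2 (j / N) p‖ := fun p hp =>
    exists_large_piece (by positivity) hcard (hhit p hp)
  choose! f hfs hf using hex
  have hT0 : 0 ≤ ∑ j ∈ Finset.range N, ((E j).card : ℝ) := Finset.sum_nonneg fun j _ => Nat.cast_nonneg _
  have hsum : (Λ.card : ℝ) = ∑ q ∈ s, ((Λ.filter fun p => f p = q).card : ℝ) := by
    exact_mod_cast Finset.card_eq_sum_card_fiberwise (fun p hp => hfs p hp)
  set T := ∑ j ∈ Finset.range N, ((E j).card : ℝ) with hT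
  clear_value T
  set θ' : ℝ := θ / (64 * P) with hθ'
  have hθ'0 : 0 < θ' := by positivity
  have hθ'1 : θ' ≤ 1 := by
    rw [hθ', div_le_one (by positivity)]; linarith
  have hq : ∀ q ∈ s, ((Λ.filter fun p => f p = q).card : ℝ) * (N * θ' ^ 7 * c) ≤
      K * V ^ 4 * T := by
    intro q hq
    rw [hs, Finset.mem_product] at hq
    have := card_le_of_large_piece hμ hc hball hκ hE hq.1 hq.2 (Λ := Λ.filter fun p => f p = q)
      (fun p hp => hΛA p (Finset.mem_filter.1 hp).1)
      (hΛ.mono fun p hp => (Finset.mem_filter.1 hp).1) hθ'0 hθ'1 (by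
        intro p hp
        obtain ⟨h1, rfl⟩ := Finset.mem_filter.1 hp
        refine le_trans (le_of_eq ?_) (hf p h1)
        rw [hθ']; ring)
    rw [hK, hT]
    refine le_trans (le_of_eq ?_) this
    ring
  have htot : (Λ.card : ℝ) * (N * θ' ^ 7 * c) ≤ P * (K * V ^ 4 * T) := by
    rw [hsum, Finset.sum_mul]
    refine (Finset.sum_le_sum hq).trans ?_
    rw [Finset.sum_const, nsmul_eq_mul]
    exact mul_le_mul_of_nonneg_right hcard (by positivity)
  have hθP : θ = 64 * P * θ' := by
    rw [hθ']; exact (mul_div_cancel₀ θ (by positivity)).symm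
  have hcc : c / c = 1 := div_self hc.ne'
  calc (Λ.card : ℝ) * N * θ ^ 7 = (64 * P) ^ 7 / c * (Λ.card * (N * θ' ^ 7 * c)) := by
        rw [hθP]
        linear_combination (-(Λ.card * N * (64 * P * θ') ^ 7)) * hcc
    _ ≤ (64 * P) ^ 7 / c * (P * (K * V ^ 4 * T)) := by gcongr
    _ = _ := by rw [hP]; ring

end Core

section Reduction

/-- The grid points of `(ℤ / 4 N ℤ)²` close to `4 * N * (z, y)`. -/
def gridNear (N M : ℕ) (z y : ℝ) : Finset (ℕ × ℕ) :=
  (Finset.Icc (-(M : ℤ)) M ×ˢ Finset.Icc (-(M : ℤ)) M).image fun s : ℤ × ℤ =>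
    (((⌊4 * N * z⌋ + s.1) % (4 * N : ℕ)).toNat, ((⌊4 * N * y⌋ + s.2) % (4 * N : ℕ)).toNat)

theorem card_gridNear_le (N M : ℕ) (z y : ℝ) : (gridNear N M z y).card ≤ (2 * M + 1) ^ 2 := by
  refine Finset.card_image_le.trans ?_
  rw [Finset.card_product, Int.card_Icc, sq]
  gcongr <;> omega

theorem gridNear_subset {N : ℕ} (hN : 0 < N) (M : ℕ) (z y : ℝ) :
    gridNear N M z y ⊆ Finset.range (4 * N) ×ˢ Finset.range (4 * N) := by
  intro e he
  obtain ⟨s, -, rfl⟩ := Finset.mem_image.1 he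
  have key : ∀ n : ℤ, (n % (4 * N : ℕ)).toNat < 4 * N := fun n => by
    have h1 := Int.emod_lt_of_pos n (b := (4 * N : ℕ)) (by positivity)
    have h2 := Int.emod_nonneg n (b := (4 * N : ℕ)) (by positivity)
    omega
  simp only [Finset.mem_product, Finset.mem_range]
  exact ⟨key _, key _⟩

theorem exists_round_near {N M : ℕ} (hN : 0 < N) {z w : ℝ} (h : |4 * N * w - 4 * N * z| ≤ M) :
    ∃ s ∈ Finset.Icc (-((M + 2 : ℕ) : ℤ)) (M + 2 : ℕ), ∃ k : ℤ,
      |4 * N * w - (((⌊4 * N * z⌋ + s) % (4 * N : ℕ)).toNat : ℝ) - 4 * N * k| ≤ 1 / 2 := by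
  set n := round (4 * N * w) with hn
  have h1 := abs_sub_round (4 * N * w)
  rw [← hn] at h1
  have h2 := Int.floor_le (4 * N * z)
  have h3 := Int.lt_floor_add_one (4 * N * z)
  set f := ⌊4 * N * z⌋ with hf
  rw [abs_le] at h h1
  refine ⟨n - f, ?_, n / (4 * N : ℕ), ?_⟩
  · rw [Finset.mem_Icc]
    constructor
    · have : (-((M + 2 : ℕ) : ℤ) : ℝ) ≤ ((n - f : ℤ) : ℝ) := by push_cast; linarith
      exact_mod_cast this
    · have : ((n - f : ℤ) : ℝ) ≤ ((M + 2 : ℕ) : ℤ) := by push_cast; linarith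
      exact_mod_cast this
  · rw [add_sub_cancel]
    have h4 := Int.emod_nonneg n (b := (4 * N : ℕ)) (by positivity)
    have h5 : (((n % (4 * N : ℕ)).toNat : ℤ) : ℝ) = ((n % (4 * N : ℕ) : ℤ) : ℝ) := by
      rw [Int.toNat_of_nonneg h4]
    have h6 : (n : ℝ) = ((n % (4 * N : ℕ) : ℤ) : ℝ) + 4 * N * ((n / (4 * N : ℕ) : ℤ) : ℝ) := by
      exact_mod_cast (Int.emod_add_mul_ediv n (4 * N : ℕ)).symm
    rw [Int.cast_natCast] at h5
    rw [h5, abs_le]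
    constructor <;> linarith

theorem isHit_of_near {N M : ℕ} (hN : 0 < N) {E : Finset (ℕ × ℕ)} {z y x : ℝ} {p : Par}
    (hE : gridNear N (M + 2) z y ⊆ E) (hz : |4 * N * zc x p - 4 * N * z| ≤ M)
    (hy : |4 * N * yc x p - 4 * N * y| ≤ M) : IsHit N E x p := by
  obtain ⟨s, hs, k, hk⟩ := exists_round_near hN hz
  obtain ⟨t, ht, l, hl⟩ := exists_round_near hN hy
  refine ⟨_, hE (Finset.mem_image_of_mem _ (Finset.mk_mem_product hs ht)), k, l, hk, hl⟩

theorem card_filter_abs_sub_le (s : Finset ℕ) (y : ℝ) :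
    (s.filter fun j : ℕ => |(j : ℝ) - y| ≤ 2).card ≤ 6 := by
  have : (s.filter fun j : ℕ => |(j : ℝ) - y| ≤ 2).card ≤ (Finset.Icc (⌊y⌋ - 2) (⌊y⌋ + 3)).card := by
    refine Finset.card_le_card_of_injOn (fun j : ℕ => (j : ℤ)) ?_ (fun a _ b _ h => Nat.cast_injective h)
    intro j hj
    have hj := (Finset.mem_filter.1 hj).2
    rw [abs_le] at hj
    have h2 := Int.floor_le y
    have h3 := Int.lt_floor_add_one y
    rw [Finset.mem_coe, Finset.mem_Icc]
    constructor
    · have : ((⌊y⌋ - 2 : ℤ) : ℝ) ≤ ((j : ℤ) : ℝ) := by push_cast; linarith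
      exact_mod_cast this
    · have : ((j : ℤ) : ℝ) ≤ ((⌊y⌋ + 3 : ℤ) : ℝ) := by push_cast; linarith
      exact_mod_cast this
  refine this.trans ?_
  rw [Int.card_Icc]
  omega

open scoped Classical in
/-- The discretised Kakeya estimate, for a finite family of small balls. -/
theorem exists_ball_estimate (A : ℝ) (hA : 0 < A) (D M : ℕ) : ∃ C : ℝ, 0 < C ∧
    ∀ κ : ℕ, 1 ≤ κ → ∀ θ : ℝ, 0 < θ → θ ≤ 1 → ∀ (I : Finset ℕ) (x y z : ℕ → ℝ) (Λ : Finset Par),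
    (∀ p ∈ Λ, ‖p‖ ≤ A) →
    Set.InjOn (fun p : Par => (⌊((2 ^ (κ * D) : ℕ) : ℝ) * p.2.1⌋,
      ⌊((2 ^ (κ * D) : ℕ) : ℝ) * p.2.2⌋)) Λ →
    (∀ p ∈ Λ, θ * (2 ^ (κ * D) : ℕ) ≤ ((Finset.range (2 ^ (κ * D))).filter fun j : ℕ =>
      ∃ i ∈ I, |(j : ℝ) - (2 ^ (κ * D) : ℕ) * x i| ≤ 2 ∧
        |4 * (2 ^ (κ * D) : ℕ) * zc (j / (2 ^ (κ * D) : ℕ)) p - 4 * (2 ^ (κ * D) : ℕ) * z i| ≤ M ∧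
        |4 * (2 ^ (κ * D) : ℕ) * yc (j / (2 ^ (κ * D) : ℕ)) p -
          4 * (2 ^ (κ * D) : ℕ) * y i| ≤ M).card) →
    Λ.card * (2 ^ (κ * D) : ℕ) * θ ^ 7 ≤ C * (2 ^ κ) ^ 52 * I.card := by
  obtain ⟨C, hC, h⟩ := exists_discrete_estimate A hA D
  refine ⟨C * (6 * (2 * (M + 2) + 1) ^ 2), by positivity, ?_⟩
  intro κ hκ θ hθ hθ1 I x y z Λ hΛA hΛ hhit
  set N : ℕ := 2 ^ (κ * D) with hN
  have hN0 : 0 < N := by positivity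
  set E : ℕ → Finset (ℕ × ℕ) := fun j =>
    (I.filter fun i => |(j : ℝ) - N * x i| ≤ 2).biUnion fun i => gridNear N (M + 2) (z i) (y i) with hE
  have main := h κ hκ θ hθ hθ1 E Λ (fun j => Finset.biUnion_subset.2 fun i _ =>
    gridNear_subset hN0 _ _ _) hΛA hΛ (fun p hp => (hhit p hp).trans (by
      gcongr
      rintro ⟨i, hi, h1, h2, h3⟩
      exact isHit_of_near hN0 (Finset.subset_biUnion_of_mem
        (fun i => gridNear N (M + 2) (z i) (y i)) (Finset.mem_filter.2 ⟨hi, h1⟩)) h2 h3))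
  have hcard : ∑ j ∈ Finset.range N, (E j).card ≤ 6 * (2 * (M + 2) + 1) ^ 2 * I.card := by
    calc ∑ j ∈ Finset.range N, (E j).card
        ≤ ∑ j ∈ Finset.range N, ∑ i ∈ I, if |(j : ℝ) - N * x i| ≤ 2 then (2 * (M + 2) + 1) ^ 2 else 0 := by
          refine Finset.sum_le_sum fun j _ => ?_
          rw [← Finset.sum_filter]
          exact Finset.card_biUnion_le.trans (Finset.sum_le_sum fun i _ => card_gridNear_le _ _ _ _)
      _ = ∑ i ∈ I, ((Finset.range N).filter fun j : ℕ => |(j : ℝ) - N * x i| ≤ 2).card *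
            (2 * (M + 2) + 1) ^ 2 := by
          rw [Finset.sum_comm]
          refine Finset.sum_congr rfl fun i _ => ?_
          rw [← Finset.sum_filter, Finset.sum_const, smul_eq_mul]
      _ ≤ ∑ i ∈ I, 6 * (2 * (M + 2) + 1) ^ 2 := by
          gcongr with i
          exact card_filter_abs_sub_le _ _
      _ = _ := by rw [Finset.sum_const, smul_eq_mul, mul_comm]
  refine main.trans ?_
  have : ∑ j ∈ Finset.range N, ((E j).card : ℝ) ≤ 6 * (2 * (M + 2) + 1) ^ 2 * I.card := by
    exact_mod_cast hcard
  calc _ ≤ C * (2 ^ κ) ^ 52 * (6 * (2 * (M + 2) + 1) ^ 2 * (I.card : ℝ)) := by gcongr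
    _ = _ := by ring

end Reduction

section Covering

/-- Pigeonhole for countable unions with geometric weights. -/
theorem exists_measure_ge_of_subset_iUnion {X : Type*} [MeasurableSpace X] {μ : Measure X} {S : Set X}
    {T : ℕ → Set X} (h0 : μ S ≠ 0) (htop : μ S ≠ ∞) (h : S ⊆ ⋃ κ, T κ) :
    ∃ κ, μ S * ((2 : ℝ≥0∞)⁻¹ ^ κ / 4) ≤ μ (T κ) := by
  by_contra! hlt
  have h1 : μ S ≤ μ S * (2 / 4) := by
    calc μ S ≤ ∑' κ, μ (T κ) := (measure_mono h).trans (measure_iUnion_le _)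
      _ ≤ ∑' κ : ℕ, μ S * ((2 : ℝ≥0∞)⁻¹ ^ κ / 4) := ENNReal.tsum_le_tsum fun κ => (hlt κ).le
      _ = μ S * (2 / 4) := by
        rw [ENNReal.tsum_mul_left]
        simp only [div_eq_mul_inv]
        rw [ENNReal.tsum_mul_right, ENNReal.tsum_geometric, ENNReal.one_sub_inv_two, inv_inv]
  have h2 : (2 / 4 : ℝ≥0∞) < 1 := by
    rw [ENNReal.div_lt_iff (by norm_num) (by norm_num)]; norm_num
  have h3 : μ S * (2 / 4) < μ S * 1 := ENNReal.mul_lt_mul_right h0 htop h2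
  rw [mul_one] at h3
  exact absurd h1 (not_le.2 h3)

/-- Null sets for the Hausdorff measure admit efficient covers by balls of dyadic-type radii. -/
theorem exists_ball_cover {X : Type*} [MetricSpace X] [Nonempty X] [MeasurableSpace X] [BorelSpace X]
    {U : Set X} {s : ℝ} (hs : 0 < s) (hU : μH[s] U = 0) {D : ℕ} (hD : 1 ≤ D) {ε : ℝ} (hε : 0 < ε)
    (hε' : ε ≤ (((2 : ℝ) ^ D)⁻¹) ^ s) :
    ∃ (q : ℕ → X) (k : ℕ → ℕ), (∀ i, 1 ≤ k i) ∧
      U ⊆ ⋃ i, Metric.closedBall (q i) (((2 : ℝ) ^ D)⁻¹ ^ (k i)) ∧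
      ∀ κ, {i | k i = κ}.Finite ∧
        ∀ I : Finset ℕ, (∀ i ∈ I, k i = κ) → I.card * ((((2 : ℝ) ^ D)⁻¹) ^ (κ + 1)) ^ s ≤ ε := by
  have hy0 : (0 : ℝ) < ((2 : ℝ) ^ D)⁻¹ := by positivity
  have hy1 : ((2 : ℝ) ^ D)⁻¹ < 1 := inv_lt_one_of_one_lt₀ (one_lt_pow₀ (by norm_num) (by omega))
  set y : ℝ := ((2 : ℝ) ^ D)⁻¹ with hy
  have hε2 : ENNReal.ofReal (ε / 2) ≠ 0 := by
    rw [Ne, ENNReal.ofReal_eq_zero, not_le]; positivity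
  rw [Measure.hausdorffMeasure_apply] at hU
  have h1 := (ENNReal.iSup_eq_zero.1 ((ENNReal.iSup_eq_zero.1 hU) 1)) one_pos
  obtain ⟨t, ht⟩ := iInf_lt_iff.1 (h1.trans_lt (pos_iff_ne_zero.2 hε2))
  obtain ⟨htU, ht⟩ := iInf_lt_iff.1 ht
  obtain ⟨-, ht⟩ := iInf_lt_iff.1 ht
  obtain ⟨δ, hδ0, hδ⟩ := ENNReal.exists_pos_sum_of_countable' hε2 ℕ
  set w : ℕ → ℝ≥0∞ := fun i => (⨆ _ : (t i).Nonempty, Metric.ediam (t i) ^ s) + δ i with hw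
  have hwsum : ∑' i, w i < ENNReal.ofReal ε := by
    rw [hw, ENNReal.tsum_add]
    calc _ < ENNReal.ofReal (ε / 2) + ENNReal.ofReal (ε / 2) := ENNReal.add_lt_add ht hδ
      _ = ENNReal.ofReal ε := by rw [← ENNReal.ofReal_add (by positivity) (by positivity)]; ring_nf
  have hwε : ∀ i, w i < ENNReal.ofReal ε := fun i => (ENNReal.le_tsum i).trans_lt hwsum
  have hwtop : ∀ i, w i ≠ ∞ := fun i => ((hwε i).trans ENNReal.ofReal_lt_top).ne
  have hw0 : ∀ i, 0 < (w i).toReal := fun i =>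
    ENNReal.toReal_pos ((hδ0 i).trans_le le_add_self).ne' (hwtop i)
  have hwε' : ∀ i, (w i).toReal ≤ ε := fun i => ENNReal.toReal_le_of_le_ofReal hε.le (hwε i).le
  have hk : ∀ i, ∃ k : ℕ, 1 ≤ k ∧ (y ^ (k + 1)) ^ s ≤ (w i).toReal ∧
      (w i).toReal ≤ (y ^ k) ^ s := by
    intro i
    set ρ : ℝ := (w i).toReal ^ s⁻¹ with hρ
    have hρ0 : 0 < ρ := Real.rpow_pos_of_pos (hw0 i) _
    have hρs : ρ ^ s = (w i).toReal := by
      rw [hρ, ← Real.rpow_mul (hw0 i).le, inv_mul_cancel₀ hs.ne', Real.rpow_one]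
    have hρy : ρ / y ≤ 1 := by
      rw [div_le_one hy0, ← Real.rpow_le_rpow_iff hρ0.le hy0.le hs, hρs]
      exact (hwε' i).trans hε'
    obtain ⟨n, hn1, hn2⟩ := exists_nat_pow_near_of_lt_one (div_pos hρ0 hy0) hρy hy0 hy1
    rw [lt_div_iff₀ hy0, ← pow_succ] at hn1
    rw [div_le_iff₀ hy0, ← pow_succ] at hn2
    refine ⟨n + 1, by omega, ?_, ?_⟩
    · rw [← hρs]; exact Real.rpow_le_rpow (by positivity) hn1.le hs.le
    · rw [← hρs]; exact Real.rpow_le_rpow hρ0.le hn2 hs.le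
  choose k hk1 hk2 hk3 using hk
  have hq : ∀ i, ∃ q : X, t i ⊆ Metric.closedBall q (y ^ k i) := by
    intro i
    rcases (t i).eq_empty_or_nonempty with h | ⟨q, hq⟩
    · exact ⟨Classical.arbitrary X, by simp [h]⟩
    refine ⟨q, fun u hu => ?_⟩
    have e1 : edist u q ^ s ≤ w i := by
      calc edist u q ^ s ≤ Metric.ediam (t i) ^ s :=
            ENNReal.rpow_le_rpow (Metric.edist_le_ediam_of_mem hu hq) hs.le
        _ ≤ ⨆ _ : (t i).Nonempty, Metric.ediam (t i) ^ s :=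
            le_iSup (fun _ : (t i).Nonempty => Metric.ediam (t i) ^ s) ⟨q, hq⟩
        _ ≤ w i := le_self_add
    have e2 : dist u q ^ s ≤ (w i).toReal := by
      rw [dist_edist, ENNReal.toReal_rpow]
      exact ENNReal.toReal_mono (hwtop i) e1
    rw [Metric.mem_closedBall, ← Real.rpow_le_rpow_iff dist_nonneg (by positivity) hs]
    exact e2.trans (hk3 i)
  choose q hq using hq
  have hcount : ∀ κ, ∀ I : Finset ℕ, (∀ i ∈ I, k i = κ) → I.card * (y ^ (κ + 1)) ^ s ≤ ε := by
    intro κ I hI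
    have e1 : ∑ i ∈ I, (w i).toReal ≤ ε := by
      rw [← ENNReal.toReal_sum fun i _ => hwtop i]
      exact ENNReal.toReal_le_of_le_ofReal hε.le ((ENNReal.sum_le_tsum I).trans hwsum.le)
    refine le_trans ?_ e1
    rw [← nsmul_eq_mul]
    refine Finset.card_nsmul_le_sum _ _ _ fun i hi => ?_
    rw [← hI i hi]
    exact hk2 i
  refine ⟨q, k, hk1, htU.trans (Set.iUnion_mono hq), fun κ => ⟨?_, hcount κ⟩⟩
  have hpos : ENNReal.ofReal ((y ^ (κ + 1)) ^ s) ≠ 0 := by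
    rw [Ne, ENNReal.ofReal_eq_zero, not_le]; positivity
  refine (ENNReal.finite_const_le_of_tsum_ne_top (hwsum.trans ENNReal.ofReal_lt_top).ne hpos).subset ?_
  rintro i rfl
  exact ENNReal.ofReal_le_of_le_toReal (hk2 i)

end Covering

section Discretisation

theorem exists_cell_representatives {G : Set Par} {A : ℝ} (hG : ∀ p ∈ G, ‖p‖ ≤ A) {N : ℕ} (hN : 0 < N) :
    ∃ Λ : Finset Par, (Λ : Set Par) ⊆ G ∧
      Set.InjOn (fun p : Par => (⌊(N : ℝ) * p.2.1⌋, ⌊(N : ℝ) * p.2.2⌋)) Λ ∧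
      volume (Prod.snd '' G) ≤ Λ.card * ENNReal.ofReal (1 / N ^ 2) := by
  classical
  set cell : Par → ℤ × ℤ := fun p => (⌊(N : ℝ) * p.2.1⌋, ⌊(N : ℝ) * p.2.2⌋) with hcell
  have hN' : (0 : ℝ) < N := by exact_mod_cast hN
  have hfin : (cell '' G).Finite := by
    refine (Set.finite_Icc ((⌊-(N * A)⌋, ⌊-(N * A)⌋) : ℤ × ℤ) (⌊N * A⌋, ⌊N * A⌋)).subset ?_
    rintro _ ⟨p, hp, rfl⟩
    have h1 : |p.2.1| ≤ A := ((norm_fst_le p.2).trans (norm_snd_le p)).trans (hG p hp)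
    have h2 : |p.2.2| ≤ A := ((norm_snd_le p.2).trans (norm_snd_le p)).trans (hG p hp)
    rw [abs_le] at h1 h2
    rw [Set.mem_Icc, Prod.le_def, Prod.le_def]
    refine ⟨⟨?_, ?_⟩, ?_, ?_⟩ <;> refine Int.floor_le_floor ?_ <;> nlinarith
  choose! rep hrepG hrep using fun i (hi : i ∈ cell '' G) => (hi : ∃ p, p ∈ G ∧ cell p = i)
  have hinj : Set.InjOn rep (hfin.toFinset : Set (ℤ × ℤ)) := by
    intro i hi j hj h
    rw [← hrep i (by simpa using hi), ← hrep j (by simpa using hj), h]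
  refine ⟨hfin.toFinset.image rep, ?_, ?_, ?_⟩
  · intro p hp
    obtain ⟨i, hi, rfl⟩ := Finset.mem_image.1 (Finset.mem_coe.1 hp)
    exact hrepG i (hfin.mem_toFinset.1 hi)
  · intro p hp p' hp' h
    obtain ⟨i, hi, rfl⟩ := Finset.mem_image.1 (Finset.mem_coe.1 hp)
    obtain ⟨j, hj, rfl⟩ := Finset.mem_image.1 (Finset.mem_coe.1 hp')
    have : cell (rep i) = cell (rep j) := h
    rw [hrep i (hfin.mem_toFinset.1 hi), hrep j (hfin.mem_toFinset.1 hj)] at this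
    rw [this]
  · rw [Finset.card_image_of_injOn hinj]
    set R : ℤ × ℤ → Set (ℝ × ℝ) := fun i => Set.Ico ((i.1 : ℝ) / N) ((i.1 + 1) / N) ×ˢ
      Set.Ico ((i.2 : ℝ) / N) ((i.2 + 1) / N) with hR
    have hsub : Prod.snd '' G ⊆ ⋃ i ∈ hfin.toFinset, R i := by
      rintro _ ⟨p, hp, rfl⟩
      refine Set.mem_biUnion (x := cell p) (hfin.mem_toFinset.2 ⟨p, hp, rfl⟩) ?_
      have key : ∀ u : ℝ, u ∈ Set.Ico ((⌊N * u⌋ : ℝ) / N) ((⌊N * u⌋ + 1) / N) := fun u => by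
        rw [Set.mem_Ico, div_le_iff₀ hN', lt_div_iff₀ hN', mul_comm u]
        exact ⟨Int.floor_le _, Int.lt_floor_add_one _⟩
      exact ⟨key _, key _⟩
    have hvol : ∀ i, volume (R i) = ENNReal.ofReal (1 / N ^ 2) := by
      intro i
      rw [hR, Measure.volume_eq_prod, Measure.prod_prod, Real.volume_Ico, Real.volume_Ico,
        ← ENNReal.ofReal_mul (by rw [← sub_div, add_sub_cancel_left]; positivity)]
      congr 1
      field_simp
      ring
    refine (measure_mono hsub).trans ((measure_biUnion_finset_le _ _).trans ?_)
    simp_rw [hvol]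
    rw [Finset.sum_const, nsmul_eq_mul]

open scoped Classical in
theorem volume_le_card_filter {X : Set ℝ} (hX : X ⊆ Set.Ico 0 1) {N : ℕ} (hN : 0 < N) :
    volume X ≤ ((Finset.range N).filter fun j : ℕ => ∃ x ∈ X, x ∈ Set.Ico ((j : ℝ) / N) ((j + 1) / N)).card *
      ENNReal.ofReal (1 / N) := by
  have hN' : (0 : ℝ) < N := by exact_mod_cast hN
  set J := (Finset.range N).filter fun j : ℕ => ∃ x ∈ X, x ∈ Set.Ico ((j : ℝ) / N) ((j + 1) / N) with hJ
  have hsub : X ⊆ ⋃ j ∈ J, Set.Ico ((j : ℝ) / N) ((j + 1) / N) := by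
    intro x hx
    have hx01 := hX hx
    have hmem : x ∈ Set.Ico ((⌊N * x⌋₊ : ℝ) / N) ((⌊N * x⌋₊ + 1) / N) := by
      rw [Set.mem_Ico, div_le_iff₀ hN', lt_div_iff₀ hN', mul_comm x]
      exact ⟨Nat.floor_le (mul_nonneg hN'.le hx01.1), Nat.lt_floor_add_one _⟩
    refine Set.mem_biUnion (x := ⌊N * x⌋₊) ?_ hmem
    refine Finset.mem_coe.2 (Finset.mem_filter.2 ⟨?_, x, hx, hmem⟩)
    rw [Finset.mem_range, Nat.floor_lt (mul_nonneg hN'.le hx01.1)]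
    nlinarith [hx01.2]
  have hvol : ∀ j : ℕ, volume (Set.Ico ((j : ℝ) / N) ((j + 1) / N)) = ENNReal.ofReal (1 / N) := by
    intro j
    rw [Real.volume_Ico]
    congr 1
    ring
  refine (measure_mono hsub).trans ((measure_biUnion_finset_le _ _).trans ?_)
  simp_rw [hvol]
  rw [Finset.sum_const, nsmul_eq_mul]

theorem near_of_dist_le {A : ℝ} {N : ℕ} (hN : 0 < N) {M : ℕ} (hM : 4 * (3 * A + 3) ≤ M) {j : ℕ}
    (hj : j < N) {p : Par} (hp : ‖p‖ ≤ A) {x q₀ q₁ q₂ : ℝ} (hx : x ∈ Set.Ico ((j : ℝ) / N) ((j + 1) / N))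
    (h₀ : |x - q₀| ≤ 1 / N) (h₁ : |p.2.1 + x * p.2.2 - q₁| ≤ 1 / N)
    (h₂ : |-2 * p.1 - x * p.2.1 - q₂| ≤ 1 / N) :
    |(j : ℝ) - N * q₀| ≤ 2 ∧ |4 * N * zc (j / N) p - 4 * N * ((q₀ * q₁ - q₂) / 2)| ≤ M ∧
      |4 * N * yc (j / N) p - 4 * N * q₁| ≤ M := by
  have hN' : (0 : ℝ) < N := by exact_mod_cast hN
  have hA : 0 ≤ A := (norm_nonneg p).trans hp
  have hb : |p.2.1| ≤ A := ((norm_fst_le p.2).trans (norm_snd_le p)).trans hp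
  have hc : |p.2.2| ≤ A := ((norm_snd_le p.2).trans (norm_snd_le p)).trans hp
  have hj0 : 0 ≤ (j : ℝ) / N := by positivity
  have hj1 : ((j : ℝ) + 1) / N ≤ 1 := by
    rw [div_le_one hN']; exact_mod_cast hj
  have hN1 : 1 / (N : ℝ) ≤ 1 := by
    rw [div_le_one hN']; exact_mod_cast hN
  have hNr : (N : ℝ) * (1 / N) = 1 := by field_simp
  set r : ℝ := 1 / N with hr
  have hr0 : 0 < r := by positivity
  set u : ℝ := (j : ℝ) / N with hu
  have hju : (j : ℝ) = N * u := by rw [hu]; field_simp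
  have hur : ((j : ℝ) + 1) / N = u + r := by rw [hu, hr]; ring
  rw [hur] at hx hj1
  have hux : |u - x| ≤ r := by
    rw [abs_le]; constructor <;> linarith [hx.1, hx.2]
  have hx1 : |x| ≤ 1 := by
    rw [abs_le]; constructor <;> linarith [hx.1, hx.2]
  have hu1 : |u| ≤ 1 := by
    rw [abs_le]; constructor <;> linarith
  have hyu : |yc u p - q₁| ≤ (A + 1) * r := by
    have e : yc u p - q₁ = (u - x) * p.2.2 + (p.2.1 + x * p.2.2 - q₁) := by
      simp only [yc, pair]; ring
    rw [e]
    refine (abs_add_le _ _).trans ?_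
    rw [abs_mul]
    nlinarith [mul_le_mul hux hc (abs_nonneg _) hr0.le]
  have hq1 : |q₁| ≤ 2 * A + 1 := by
    have e : q₁ = p.2.1 + x * p.2.2 - (p.2.1 + x * p.2.2 - q₁) := by ring
    rw [e]
    refine (abs_sub _ _).trans ?_
    refine (add_le_add (abs_add_le _ _) h₁).trans ?_
    rw [abs_mul]
    nlinarith [mul_le_mul hx1 hc (abs_nonneg _) zero_le_one]
  have hzu : |zc u p - (q₀ * q₁ - q₂) / 2| ≤ (3 * A + 3) * r := by
    have e : zc u p - (q₀ * q₁ - q₂) / 2 = ((u - x) * p.2.1 + (u - x) * ((u + x) / 2 * p.2.2)) +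
        (x * (p.2.1 + x * p.2.2 - q₁) + (x - q₀) * q₁ - (-2 * p.1 - x * p.2.1 - q₂)) / 2 := by
      simp only [zc, pair]; ring
    have t1 : |(u - x) * p.2.1| ≤ r * A := by
      rw [abs_mul]; exact mul_le_mul hux hb (abs_nonneg _) hr0.le
    have t2 : |(u - x) * ((u + x) / 2 * p.2.2)| ≤ r * (1 * A) := by
      rw [abs_mul, abs_mul]
      refine mul_le_mul hux (mul_le_mul ?_ hc (abs_nonneg _) zero_le_one) (by positivity) hr0.le
      rw [abs_le] at hu1 hx1 ⊢
      constructor <;> linarith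
    have t3 : |x * (p.2.1 + x * p.2.2 - q₁)| ≤ 1 * r := by
      rw [abs_mul]; exact mul_le_mul hx1 h₁ (abs_nonneg _) zero_le_one
    have t4 : |(x - q₀) * q₁| ≤ r * (2 * A + 1) := by
      rw [abs_mul]; exact mul_le_mul h₀ hq1 (abs_nonneg _) hr0.le
    have t5 := h₂
    rw [e]
    rw [abs_le] at t1 t2 t3 t4 t5 ⊢
    have := mul_nonneg hr0.le hA
    constructor <;> nlinarith
  have scale : ∀ {v w : ℝ} {B : ℝ}, |v - w| ≤ B * r → 4 * B ≤ M → |4 * N * v - 4 * N * w| ≤ M := by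
    intro v w B h hB
    rw [← mul_sub, abs_mul, abs_of_pos (by positivity : (0 : ℝ) < 4 * N)]
    calc 4 * N * |v - w| ≤ 4 * N * (B * r) := by gcongr
      _ = 4 * B * (N * r) := by ring
      _ ≤ M := by rw [hNr, mul_one]; exact hB
  refine ⟨?_, scale hzu hM, scale hyu (by linarith)⟩
  rw [hju, ← mul_sub, abs_mul, abs_of_pos hN']
  have : |u - q₀| ≤ 2 * r := by
    rw [show u - q₀ = (u - x) + (x - q₀) by ring]
    exact (abs_add_le _ _).trans (by linarith)
  calc N * |u - q₀| ≤ N * (2 * r) := by gcongr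
    _ = 2 * (N * r) := by ring
    _ = 2 := by rw [hNr, mul_one]

end Discretisation

section Main

/-- The point with first coordinate `x` on the `SL(2)` line with parameters `p`. -/
def curvePt (p : Par) (x : ℝ) : E3 := !₂[x, p.2.1 + x * p.2.2, -2 * p.1 - x * p.2.1]

theorem abs_sub_coord_le_dist (u v : E3) (i : Fin 3) : |u i - v i| ≤ dist u v := by
  rw [dist_eq_norm, ← Real.norm_eq_abs]
  exact PiLp.norm_apply_le (u - v) i

theorem exists_card_ge {U : Set E3} {s : ℝ} (hs : 0 < s) (hU : μH[s] U = 0) {G : Set Par} {A : ℝ} (hA : 0 < A)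
    (hGA : ∀ p ∈ G, ‖p‖ ≤ A) (hGU : ∀ p ∈ G, ∀ x ∈ Set.Ico (0 : ℝ) 1, curvePt p x ∈ U)
    (h0 : volume (Prod.snd '' G) ≠ 0) {D : ℕ} (hD : 1 ≤ D) :
    ∃ c : ℝ, 0 < c ∧ ∀ ε : ℝ, 0 < ε → ε ≤ (((2 : ℝ) ^ D)⁻¹) ^ s → ∃ (κ : ℕ) (I : Finset ℕ), 1 ≤ κ ∧
      I.card * ((((2 : ℝ) ^ D)⁻¹) ^ (κ + 1)) ^ s ≤ ε ∧
      c * ((2 : ℝ) ^ (κ * D)) ^ 3 ≤ (2 ^ κ) ^ 60 * I.card := by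
  classical
  have htop : volume (Prod.snd '' G) ≠ ∞ := by
    have : Bornology.IsBounded (Prod.snd '' G) := by
      refine isBounded_iff_forall_norm_le.2 ⟨A, ?_⟩
      rintro _ ⟨p, hp, rfl⟩
      exact (norm_snd_le p).trans (hGA p hp)
    exact this.measure_lt_top.ne
  set m : ℝ := (volume (Prod.snd '' G)).toReal with hm
  have hm0 : 0 < m := ENNReal.toReal_pos h0 htop
  obtain ⟨M, hM⟩ := exists_nat_ge (4 * (3 * A + 3))
  obtain ⟨C, hC, hest⟩ := exists_ball_estimate A hA D M
  refine ⟨m / (4 ^ 8 * C), by positivity, fun ε hε hε' => ?_⟩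
  obtain ⟨q, k, hk1, hcov, hfin⟩ := exists_ball_cover hs hU hD hε hε'
  set X : Par → ℕ → Set ℝ := fun p κ => {x ∈ Set.Ico (0 : ℝ) 1 | ∃ i, k i = κ ∧
    dist (curvePt p x) (q i) ≤ ((2 : ℝ) ^ D)⁻¹ ^ κ} with hX
  set T : ℕ → Set Par := fun κ => {p ∈ G | (2 : ℝ≥0∞)⁻¹ ^ κ / 4 ≤ volume (X p κ)} with hT
  have hGT : Prod.snd '' G ⊆ ⋃ κ, Prod.snd '' T κ := by
    rintro _ ⟨p, hp, rfl⟩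
    have hcovp : Set.Ico (0 : ℝ) 1 ⊆ ⋃ κ, X p κ := by
      intro x hx
      obtain ⟨i, hi⟩ := Set.mem_iUnion.1 (hcov (hGU p hp x hx))
      exact Set.mem_iUnion.2 ⟨k i, hx, i, rfl, hi⟩
    have hv : volume (Set.Ico (0 : ℝ) 1) = 1 := by rw [Real.volume_Ico]; simp
    obtain ⟨κ, hκ⟩ := exists_measure_ge_of_subset_iUnion (μ := volume) (by rw [hv]; simp)
      (by rw [hv]; simp) hcovp
    rw [hv, one_mul] at hκ
    exact Set.mem_iUnion.2 ⟨κ, p, ⟨hp, hκ⟩, rfl⟩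
  obtain ⟨κ, hκ⟩ := exists_measure_ge_of_subset_iUnion (μ := volume) h0 htop hGT
  obtain ⟨N, hN⟩ : ∃ N : ℕ, N = 2 ^ (κ * D) := ⟨_, rfl⟩
  have hN0 : 0 < N := by rw [hN]; positivity
  have hN' : (0 : ℝ) < N := by exact_mod_cast hN0
  have hNr : ((2 : ℝ) ^ D)⁻¹ ^ κ = 1 / N := by
    rw [hN, mul_comm κ D, pow_mul]; push_cast; rw [inv_pow, one_div]
  obtain ⟨θ, hθ⟩ : ∃ θ : ℝ, θ = (2 ^ κ)⁻¹ / 4 := ⟨_, rfl⟩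
  have hθ0 : 0 < θ := by rw [hθ]; positivity
  have hθ1 : θ ≤ 1 := by
    have : ((2 : ℝ) ^ κ)⁻¹ ≤ 1 := inv_le_one_of_one_le₀ (one_le_pow₀ (by norm_num))
    rw [hθ]; linarith
  have hθE : (2 : ℝ≥0∞)⁻¹ ^ κ / 4 = ENNReal.ofReal θ := by
    rw [hθ, ENNReal.ofReal_div_of_pos (by norm_num), ENNReal.ofReal_inv_of_pos (by positivity),
      ENNReal.ofReal_pow (by norm_num), ENNReal.inv_pow]
    norm_num
  rw [hθE] at hκ
  have hTne : (T κ).Nonempty := by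
    rw [Set.nonempty_iff_ne_empty]
    intro h
    rw [h, Set.image_empty, measure_empty, nonpos_iff_eq_zero, mul_eq_zero] at hκ
    rcases hκ with h | h
    · exact h0 h
    · rw [ENNReal.ofReal_eq_zero] at h; linarith
  have hXp : ∀ p ∈ T κ, ENNReal.ofReal θ ≤ volume (X p κ) := fun p hp => by
    rw [← hθE]; exact hp.2
  have hκ1 : 1 ≤ κ := by
    obtain ⟨p, hp⟩ := hTne
    have : (X p κ).Nonempty := by
      rw [Set.nonempty_iff_ne_empty]
      intro h
      have := hXp p hp
      rw [h, measure_empty, nonpos_iff_eq_zero, ENNReal.ofReal_eq_zero] at this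
      linarith
    obtain ⟨x, -, i, hi, -⟩ := this
    rw [← hi]; exact hk1 i
  obtain ⟨Λ, hΛT, hΛinj, hΛvol⟩ := exists_cell_representatives (G := T κ) (fun p hp => hGA p hp.1) hN0
  obtain ⟨hfinκ, hcount⟩ := hfin κ
  set I := hfinκ.toFinset with hI
  have hmemI : ∀ i, i ∈ I ↔ k i = κ := fun i => by rw [hI, Set.Finite.mem_toFinset]; rfl
  have main := hest κ hκ1 θ hθ0 hθ1 I (fun i => q i 0) (fun i => q i 1)
    (fun i => (q i 0 * q i 1 - q i 2) / 2) Λ (fun p hp => hGA p (hΛT hp).1)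
  rw [← hN] at main
  have main := main hΛinj (by
    intro p hp
    have h1 := (hXp p (hΛT hp)).trans (volume_le_card_filter (X := X p κ) (fun x hx => hx.1) hN0)
    rw [← ENNReal.ofReal_natCast, ← ENNReal.ofReal_mul (by positivity),
      ENNReal.ofReal_le_ofReal_iff (by positivity), mul_one_div, le_div_iff₀ hN'] at h1
    refine h1.trans ?_
    have hpA := hGA p (hΛT hp).1
    refine Nat.cast_le.2 (Finset.card_le_card fun j hj => ?_)
    rw [Finset.mem_filter] at hj ⊢
    obtain ⟨hj, x, ⟨-, i, hi, hd⟩, hxj⟩ := hj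
    refine ⟨hj, i, (hmemI i).2 hi, ?_⟩
    rw [hNr] at hd
    exact near_of_dist_le hN0 hM (Finset.mem_range.1 hj) hpA (x := x) hxj
      ((abs_sub_coord_le_dist _ _ 0).trans hd) ((abs_sub_coord_le_dist _ _ 1).trans hd)
      ((abs_sub_coord_le_dist _ _ 2).trans hd))
  have hΛ : m * θ * N ^ 2 ≤ Λ.card := by
    have h1 := hκ.trans hΛvol
    rw [← ENNReal.ofReal_toReal htop, ← hm, ← ENNReal.ofReal_natCast, ← ENNReal.ofReal_mul hm0.le,
      ← ENNReal.ofReal_mul (by positivity), ENNReal.ofReal_le_ofReal_iff (by positivity), mul_one_div,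
      le_div_iff₀ (by positivity)] at h1
    exact h1
  refine ⟨κ, I, hκ1, hcount I fun i hi => (hmemI i).1 hi, ?_⟩
  have hNc : (2 : ℝ) ^ (κ * D) = N := by rw [hN]; push_cast; rfl
  rw [hNc]
  set V : ℝ := 2 ^ κ with hV
  have hV0 : 0 < V := by positivity
  have hfinal : m * θ ^ 8 * N ^ 3 ≤ C * V ^ 52 * I.card := by
    refine le_trans ?_ main
    calc m * θ ^ 8 * N ^ 3 = (m * θ * N ^ 2) * N * θ ^ 7 := by ring
      _ ≤ _ := by gcongr
  have hθV : θ * (4 * V) = 1 := by rw [hθ]; field_simp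
  calc m / (4 ^ 8 * C) * (N : ℝ) ^ 3 = m * (θ * (4 * V)) ^ 8 * N ^ 3 / (4 ^ 8 * C) := by
        rw [hθV]; ring
    _ = V ^ 8 / C * (m * θ ^ 8 * N ^ 3) := by field_simp
    _ ≤ V ^ 8 / C * (C * V ^ 52 * I.card) := by gcongr
    _ = V ^ 60 * I.card := by field_simp

theorem volume_image_snd_eq_zero {U : Set E3} {s : ℝ} (hs : 0 < s) (hs3 : s < 3) (hU : μH[s] U = 0)
    {G : Set Par} (hGU : ∀ p ∈ G, ∀ x ∈ Set.Ico (0 : ℝ) 1, curvePt p x ∈ U) :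
    volume (Prod.snd '' G) = 0 := by
  have key : ∀ n : ℕ, volume (Prod.snd '' {p ∈ G | ‖p‖ ≤ n + 1}) = 0 := by
    intro n
    by_contra h0
    obtain ⟨D, hD⟩ := exists_nat_ge (60 / (3 - s) + 1)
    have hD1 : 1 ≤ D := by
      have : 0 ≤ 60 / (3 - s) := div_nonneg (by norm_num) (by linarith)
      exact_mod_cast (by linarith : (1 : ℝ) ≤ D)
    have hD60 : 60 ≤ D * (3 - s) := by
      rw [← div_le_iff₀ (by linarith)]; linarith
    obtain ⟨c, hc, h⟩ := exists_card_ge hs hU (G := {p ∈ G | ‖p‖ ≤ n + 1}) (A := n + 1) (by positivity)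
      (fun p hp => hp.2) (fun p hp => hGU p hp.1) h0 hD1
    set y : ℝ := (((2 : ℝ) ^ D)⁻¹) ^ s with hy
    have hy0 : 0 < y := by positivity
    set ε : ℝ := min y (c * y / 2) with hε
    have hε0 : 0 < ε := lt_min hy0 (by positivity)
    obtain ⟨κ, I, hκ, h1, h2⟩ := h ε hε0 (min_le_left _ _)
    have h3 : ε ≤ c * y / 2 := min_le_right _ _
    have e1 : ((((2 : ℝ) ^ D)⁻¹) ^ (κ + 1)) ^ s = y * (((2 : ℝ) ^ κ) ^ (D * s))⁻¹ := by
      rw [pow_succ', Real.mul_rpow (by positivity) (by positivity), ← hy, inv_pow,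
        Real.inv_rpow (by positivity), ← pow_mul, mul_comm D κ, pow_mul, Real.rpow_mul (by positivity),
        Real.rpow_natCast]
    have e2 : ((2 : ℝ) ^ (κ * D)) ^ 3 = ((2 : ℝ) ^ κ) ^ (D * (3 - s)) * ((2 : ℝ) ^ κ) ^ (D * s) := by
      rw [← Real.rpow_add (by positivity), pow_mul, ← pow_mul, ← Real.rpow_natCast]
      congr 1
      push_cast; ring
    have hV1 : (1 : ℝ) ≤ 2 ^ κ := one_le_pow₀ (by norm_num)
    rw [e1] at h1
    rw [e2] at h2
    set V : ℝ := 2 ^ κ with hV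
    have e3 : V ^ 60 ≤ V ^ (D * (3 - s)) := by
      rw [← Real.rpow_natCast]
      exact Real.rpow_le_rpow_of_exponent_le hV1 (by exact_mod_cast hD60)
    set W := V ^ (D * s) with hW
    have hW0 : 0 < W := by positivity
    have h4 : c * W ≤ I.card := by
      have : V ^ 60 * (c * W) ≤ V ^ 60 * I.card := by
        refine le_trans ?_ h2
        calc V ^ 60 * (c * W) ≤ V ^ (D * (3 - s)) * (c * W) := by gcongr
          _ = _ := by ring
      exact le_of_mul_le_mul_left this (by positivity)
    have h5 : c * y ≤ ε := by
      refine le_trans ?_ h1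
      calc c * y = c * W * (y * W⁻¹) := by field_simp
        _ ≤ _ := by gcongr
    have : 0 < c * y := by positivity
    linarith
  have hsub : Prod.snd '' G ⊆ ⋃ n : ℕ, Prod.snd '' {p ∈ G | ‖p‖ ≤ n + 1} := by
    rintro _ ⟨p, hp, rfl⟩
    obtain ⟨n, hn⟩ := exists_nat_ge ‖p‖
    exact Set.mem_iUnion.2 ⟨n, p, ⟨hp, hn.trans (by linarith)⟩, rfl⟩
  exact measure_mono_null hsub (measure_iUnion_null key)

end Main

section Directions

theorem hausdorffMeasure_two_range_eq_zero {f : ℝ → E3} (hf : ContDiff ℝ 1 f) : μH[2] (Set.range f) = 0 := by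
  have h := hf.dimH_range_le
  rw [Module.finrank_self] at h
  have h1 : dimH (Set.range f) < ((2 : NNReal) : ℝ≥0∞) :=
    h.trans_lt (by rw [Nat.cast_one]; exact ENNReal.coe_lt_coe.2 one_lt_two)
  have h2 := hausdorffMeasure_of_dimH_lt h1
  rwa [NNReal.coe_ofNat] at h2

theorem norm_sq_E3 (e : E3) : ‖e‖ ^ 2 = e 0 ^ 2 + e 1 ^ 2 + e 2 ^ 2 := by
  rw [EuclideanSpace.real_norm_sq_eq, Fin.sum_univ_three]

theorem exists_cos_sin {x y : ℝ} (h : x ^ 2 + y ^ 2 = 1) : ∃ t, x = Real.cos t ∧ y = Real.sin t := by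
  have hn : ‖(⟨x, y⟩ : ℂ)‖ = 1 := by
    rw [Complex.norm_def, Complex.normSq_mk, ← sq, ← sq, h, Real.sqrt_one]
  refine ⟨Complex.arg ⟨x, y⟩, ?_, ?_⟩
  · have := Complex.norm_mul_cos_arg ⟨x, y⟩
    rw [hn, one_mul] at this
    exact this.symm
  · have := Complex.norm_mul_sin_arg ⟨x, y⟩
    rw [hn, one_mul] at this
    exact this.symm

theorem hausdorffMeasure_two_equator : μH[2] {e : E3 | ‖e‖ = 1 ∧ e 2 = 0} = 0 := by
  refine measure_mono_null ?_ (hausdorffMeasure_two_range_eq_zero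
    (f := fun t => !₂[Real.cos t, Real.sin t, 0]) ?_)
  · rintro e ⟨h1, h2⟩
    have h := norm_sq_E3 e
    obtain ⟨t, h3, h4⟩ := exists_cos_sin (x := e 0) (y := e 1) (by rw [h1, h2] at h; linarith)
    refine ⟨t, ?_⟩
    ext i
    fin_cases i <;> simp [h2, h3, h4]
  · rw [contDiff_euclidean]
    intro i
    fin_cases i
    · exact Real.contDiff_cos
    · exact Real.contDiff_sin
    · exact contDiff_const

theorem hausdorffMeasure_two_meridian : μH[2] {e : E3 | ‖e‖ = 1 ∧ e 0 = 0} = 0 := by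
  refine measure_mono_null ?_ (hausdorffMeasure_two_range_eq_zero
    (f := fun t => !₂[0, Real.cos t, Real.sin t]) ?_)
  · rintro e ⟨h1, h2⟩
    have h := norm_sq_E3 e
    obtain ⟨t, h3, h4⟩ := exists_cos_sin (x := e 1) (y := e 2) (by rw [h1, h2] at h; linarith)
    refine ⟨t, ?_⟩
    ext i
    fin_cases i <;> simp [h2, h3, h4]
  · rw [contDiff_euclidean]
    intro i
    fin_cases i
    · exact contDiff_const
    · exact Real.contDiff_cos
    · exact Real.contDiff_sin

theorem norm_normalize_sub_le {E : Type*} [NormedAddCommGroup E] [NormedSpace ℝ E] {v w : E}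
    (hv : 1 ≤ ‖v‖) (hw : 1 ≤ ‖w‖) : ‖‖v‖⁻¹ • v - ‖w‖⁻¹ • w‖ ≤ 2 * ‖v - w‖ := by
  have hv0 : 0 < ‖v‖ := by linarith
  have hw0 : 0 < ‖w‖ := by linarith
  have e : ‖v‖⁻¹ • v - ‖w‖⁻¹ • w = ‖v‖⁻¹ • ((v - w) + ((‖w‖ - ‖v‖) * ‖w‖⁻¹) • w) := by
    rw [smul_add, smul_smul, smul_sub, sub_add, ← sub_smul]
    congr 2
    field_simp
    ring
  rw [e, norm_smul, norm_inv, norm_norm]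
  have h1 : ‖(v - w) + ((‖w‖ - ‖v‖) * ‖w‖⁻¹) • w‖ ≤ 2 * ‖v - w‖ := by
    refine (norm_add_le _ _).trans ?_
    rw [norm_smul, norm_mul, norm_inv, norm_norm, mul_assoc, inv_mul_cancel₀ hw0.ne', mul_one,
      Real.norm_eq_abs, abs_sub_comm]
    linarith [abs_norm_sub_norm_le v w]
  calc ‖v‖⁻¹ * _ ≤ 1 * (2 * ‖v - w‖) := by
        gcongr
        exact inv_le_one_of_one_le₀ hv
    _ = _ := one_mul _

/-- The vector spanning the direction of the `SL(2)` lines with parameters `(_, u)`. -/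
def dirVec (u : ℝ × ℝ) : E3 := !₂[1, u.2, -u.1]

theorem one_le_norm_dirVec (u : ℝ × ℝ) : 1 ≤ ‖dirVec u‖ := by
  have := norm_sq_E3 (dirVec u)
  have h : ‖dirVec u‖ ^ 2 = 1 + u.2 ^ 2 + u.1 ^ 2 := by
    rw [this]; simp [dirVec]
  nlinarith [norm_nonneg (dirVec u), sq_nonneg u.1, sq_nonneg u.2]

theorem norm_dirVec_sub_le (u v : ℝ × ℝ) : ‖dirVec u - dirVec v‖ ≤ 2 * ‖u - v‖ := by
  have h : ‖dirVec u - dirVec v‖ ^ 2 = (u.2 - v.2) ^ 2 + (u.1 - v.1) ^ 2 := by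
    rw [norm_sq_E3]; simp [dirVec]; ring
  have h1 : |u.1 - v.1| ≤ ‖u - v‖ := norm_fst_le (u - v)
  have h2 : |u.2 - v.2| ≤ ‖u - v‖ := norm_snd_le (u - v)
  have h3 := sq_le_sq' (by linarith [abs_nonneg (u.1 - v.1), norm_nonneg (u - v)]) h1
  have h4 := sq_le_sq' (by linarith [abs_nonneg (u.2 - v.2), norm_nonneg (u - v)]) h2
  rw [sq_abs] at h3 h4
  refine abs_le_of_sq_le_sq' ?_ (by positivity) |>.2
  nlinarith [sq_nonneg ‖u - v‖]

theorem lipschitzWith_normalize_dirVec : LipschitzWith 4 fun u => ‖dirVec u‖⁻¹ • dirVec u := by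
  refine LipschitzWith.of_dist_le_mul fun u v => ?_
  rw [dist_eq_norm, dist_eq_norm]
  refine (norm_normalize_sub_le (one_le_norm_dirVec u) (one_le_norm_dirVec v)).trans ?_
  have := norm_dirVec_sub_le u v
  push_cast
  linarith

theorem hausdorffMeasure_two_directions {Z : Set (ℝ × ℝ)} (hZ : volume Z = 0) :
    μH[2] {e : E3 | ‖e‖ = 1 ∧ ∃ r : ℝ, ∃ u ∈ Z, e = r • dirVec u} = 0 := by
  have h0 : μH[2] ((fun u => ‖dirVec u‖⁻¹ • dirVec u) '' Z) = 0 := by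
    have h := lipschitzWith_normalize_dirVec.hausdorffMeasure_image_le (d := 2) (by norm_num) Z
    rw [hausdorffMeasure_prod_real, hZ, mul_zero] at h
    exact nonpos_iff_eq_zero.1 h
  have h1 : μH[2] ((fun e : E3 => -e) '' ((fun u => ‖dirVec u‖⁻¹ • dirVec u) '' Z)) = 0 := by
    rw [(isometry_neg (G := E3)).hausdorffMeasure_image (Or.inl (by norm_num)), h0]
  refine measure_mono_null ?_ (measure_union_null h0 h1)
  rintro e ⟨he, r, u, hu, rfl⟩
  have hd : 0 < ‖dirVec u‖ := lt_of_lt_of_le one_pos (one_le_norm_dirVec u)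
  rw [norm_smul, Real.norm_eq_abs] at he
  rcases abs_cases r with ⟨h, -⟩ | ⟨h, -⟩ <;> rw [h] at he
  · exact Or.inl ⟨u, hu, by rw [eq_inv_of_mul_eq_one_left he]⟩
  · refine Or.inr ⟨_, ⟨u, hu, rfl⟩, ?_⟩
    change -(‖dirVec u‖⁻¹ • dirVec u) = r • dirVec u
    rw [← eq_inv_of_mul_eq_one_left he, ← neg_smul, neg_neg]

/-- The directions of a family of `SL(2)` lines lie on two great circles, apart from those
determined by the parameters of the lines of the family. -/
theorem dirSet_subset {𝓛 : Set (Set E3)} (h𝓛 : 𝓛 ⊆ SL2Lines) :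
    dirSet 𝓛 ⊆ {e : E3 | ‖e‖ = 1 ∧ e 2 = 0} ∪ {e : E3 | ‖e‖ = 1 ∧ e 0 = 0} ∪
      {e : E3 | ‖e‖ = 1 ∧ ∃ r : ℝ, ∃ u ∈ Prod.snd '' {p : Par | ∀ x, curvePt p x ∈ ⋃₀ 𝓛},
        e = r • dirVec u} := by
  rintro e ⟨he, L, hL, x, hLx⟩
  have hx0 : x ∈ L := by rw [hLx]; exact ⟨0, by simp⟩
  have hx1 : x + e ∈ L := by rw [hLx]; exact ⟨1, by simp⟩
  rcases h𝓛 hL with ⟨γ, δ, -, h⟩ | ⟨α, β, γ, δ, hdet, h⟩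
  · rw [h] at hx0 hx1
    obtain ⟨s, hs⟩ := hx0
    obtain ⟨t, ht⟩ := hx1
    refine Or.inl (Or.inl ⟨he, ?_⟩)
    have h1 := congrFun hs 2
    have h2 := congrFun ht 2
    simp at h1 h2
    linarith
  · rw [h] at hx0 hx1
    obtain ⟨s, hs⟩ := hx0
    obtain ⟨t, ht⟩ := hx1
    have e0 : e 0 = (t - s) * γ := by
      have h1 := congrFun hs 0
      have h2 := congrFun ht 0
      simp at h1 h2
      linarith
    have e1 : e 1 = (t - s) * δ := by
      have h1 := congrFun hs 1
      have h2 := congrFun ht 1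
      simp at h1 h2
      linarith
    have e2 : e 2 = t - s := by
      have h1 := congrFun hs 2
      have h2 := congrFun ht 2
      simp at h1 h2
      linarith
    rcases eq_or_ne γ 0 with hγ | hγ
    · exact Or.inl (Or.inr ⟨he, by rw [e0, hγ, mul_zero]⟩)
    refine Or.inr ⟨he, (t - s) * γ, (-1 / γ, δ / γ), ⟨(α / (2 * γ), -1 / γ, δ / γ), ?_, rfl⟩, ?_⟩
    · intro X
      refine ⟨L, hL, ?_⟩
      rw [h]
      refine ⟨(X - α) / γ, ?_⟩
      funext i
      fin_cases i
      · simp [curvePt]; field_simp; ring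
      · simp [curvePt]; field_simp; linear_combination hdet
      · simp [curvePt]; field_simp; ring
    · ext i
      fin_cases i
      · simp [dirVec, e0]
      · simp [dirVec, e1]; field_simp
      · simp [dirVec, e2]; field_simp

end Directions

/-- If a family of `SL(2)` lines has direction set of positive `H²` measure,
then its union has Hausdorff dimension `3`. -/
theorem sl2_kakeya (𝓛 : Set (Set E3)) (h𝓛 : 𝓛 ⊆ SL2Lines)
    (hdir : 0 < μH[2] (dirSet 𝓛)) :
    dimH (⋃₀ 𝓛) = 3 := by
  refine le_antisymm ?_ ?_
  · refine (dimH_mono (Set.subset_univ _)).trans ?_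
    rw [Real.dimH_univ_eq_finrank, finrank_euclideanSpace, Fintype.card_fin]
    norm_num
  by_contra hlt
  rw [not_le] at hlt
  obtain ⟨s, hs, hs3⟩ := ENNReal.lt_iff_exists_nnreal_btwn.1 hlt
  have hs0 : 0 < (s : ℝ) := by
    have := (zero_le : 0 ≤ dimH (⋃₀ 𝓛)).trans_lt hs
    exact_mod_cast this
  have hs3' : (s : ℝ) < 3 := by exact_mod_cast hs3
  have hvol := volume_image_snd_eq_zero hs0 hs3' (hausdorffMeasure_of_dimH_lt hs)
    (G := {p : Par | ∀ x, curvePt p x ∈ ⋃₀ 𝓛}) fun p hp x _ => hp x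
  refine hdir.ne' (measure_mono_null (dirSet_subset h𝓛) (measure_union_null
    (measure_union_null hausdorffMeasure_two_equator hausdorffMeasure_two_meridian)
    (hausdorffMeasure_two_directions hvol)))
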